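/- (Generalized τ-Li criterion.) Let F ∈ S^♯♭(σ0,σ1), and let τ ≥ σ1 be a real number such that 0 ∉ Z(F) and τ ∉ Z(F). Then the following two statements are equivalent: (i) σ1 − τ/2 ≤ Re ρ ≤ τ/2 for every ρ ∈ Z(F); (ii) Re(λ_F(n,τ)) ≥ 0 for every positive integer n. -/

import Mathlib

open Complex Filter MeasureTheory Finset

noncomputable section

/-- The order of vanishing of `f` at `ρ`. -/
noncomputable def zeroOrder (f : ℂ → ℂ) (ρ : ℂ) : ℕ :=
  sInf {k : ℕ | iteratedDeriv k f ρ ≠ 0}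

/-- The class `S^♯♭(σ₀,σ₁)` of `L`-functions. -/
structure SSF (σ0 σ1 : ℝ) : Type where
  hσ1pos : 0 < σ1
  hσ : σ1 ≤ σ0
  /-- The `L`-function itself (as a function, analytic away from the poles). -/
  F : ℂ → ℂ
  /-- Dirichlet series coefficients. -/
  a : ℕ → ℂ
  hDir : ∀ s : ℂ, σ0 < s.re →
    HasSum (fun n : ℕ => a (n + 1) * ((n + 1 : ℕ) : ℂ) ^ (-s)) (F s)
  hDirAbs : ∀ s : ℂ, σ0 < s.re →
    Summable (fun n : ℕ => ‖a (n + 1) * ((n + 1 : ℕ) : ℂ) ^ (-s)‖)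
  /-- The number of poles. -/
  N : ℕ
  /-- The poles `s₁, …, s_N`. -/
  pole : Fin N → ℂ
  /-- Their orders `m₁, …, m_N`. -/
  m : Fin N → ℕ
  hm : ∀ i, 0 < m i
  /-- Entire continuation of `∏ (s - sᵢ)^{mᵢ} · F s`, of finite order. -/
  G : ℂ → ℂ
  hGdiff : Differentiable ℂ G
  hGord : ∃ c B : ℝ, ∀ s : ℂ, ‖G s‖ ≤ c * Real.exp (‖s‖ ^ B)
  hGF : ∀ s : ℂ, (∀ i, s ≠ pole i) → G s = (∏ i, (s - pole i) ^ m i) * F s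
  Q : ℝ
  hQ : 0 < Q
  r : ℕ
  lam : Fin r → ℝ
  hlam : ∀ j, 0 < lam j
  mu : Fin r → ℂ
  ω : ℂ
  hω : ‖ω‖ = 1
  M : ℕ
  /-- `δ(σ₁) ∈ {0,1}`. -/
  dlt : ℕ
  hdlt : dlt ≤ 1
  hMN : 2 * M + dlt ≤ N
  hpair : ∀ (j : ℕ) (h1 : 2 * j < N) (h2 : 2 * j + 1 < N), j < M →
    pole ⟨2 * j, h1⟩ + (starRingEnd ℂ) (pole ⟨2 * j + 1, h2⟩) = (σ1 : ℂ)
  hdelta : dlt = 1 ↔ ∃ i, pole i = (σ1 / 2 : ℂ)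
  hdeltaPos : dlt = 1 → ∀ h2 : 2 * M < N, pole ⟨2 * M, h2⟩ = (σ1 / 2 : ℂ)
  /-- The completed function `ξ_F` (the analytic continuation of the completed product). -/
  xi : ℂ → ℂ
  hxiDiff : Differentiable ℂ xi
  hxiEq : ∀ s : ℂ, (∀ i, s ≠ pole i) →
    (∀ (j : Fin r) (k : ℕ), (lam j : ℂ) * s + mu j ≠ -(k : ℂ)) →
    xi s = F s * (Q : ℂ) ^ s * (∏ j, Complex.Gamma ((lam j : ℂ) * s + mu j)) *
      (∏ i, (s - pole i) ^ m i) *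
      ∏ i : Fin N, (if 2 * M + dlt ≤ (i : ℕ) then ((σ1 : ℂ) - s - (starRingEnd ℂ) (pole i)) ^ m i else 1)
  hFE : ∀ s : ℂ, xi s = ω * (starRingEnd ℂ) (xi ((σ1 : ℂ) - (starRingEnd ℂ) s))
  /-- The coefficients of the Dirichlet series of `-F'/F`. -/
  c : ℕ → ℂ
  hEuler : ∀ s : ℂ, σ0 < s.re →
    HasSum (fun n : ℕ => c (n + 2) * ((n + 2 : ℕ) : ℂ) ^ (-s)) (-(deriv F s / F s))
  hEulerAbs : ∀ s : ℂ, σ0 < s.re →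
    Summable (fun n : ℕ => ‖c (n + 2) * ((n + 2 : ℕ) : ℂ) ^ (-s)‖)

namespace SSF

variable {σ0 σ1 : ℝ}

/-- Truncated sum over the nontrivial zeros (zeros of `ξ_F`) with `|Im ρ| ≤ T`,
counted with multiplicity. -/
noncomputable def zsum (S : SSF σ0 σ1) (w : ℂ → ℂ) (T : ℝ) : ℂ :=
  ∑' ρ : {ρ : ℂ // S.xi ρ = 0 ∧ |ρ.im| ≤ T}, (zeroOrder S.xi ρ : ℂ) * w ρ

end SSF

/-- Second-order Taylor remainder of `w ↦ (1 + w) ^ n`. -/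
lemma norm_one_add_pow_sub_le {w : ℂ} {r : ℝ} (hr : 1 ≤ r) (hw : ‖1 + w‖ ≤ r) (n : ℕ) :
    ‖(1 + w) ^ n - 1 - n * w‖ ≤ (n : ℝ) ^ 2 * r ^ n * ‖w‖ ^ 2 := by
  induction n with
  | zero => simp
  | succ n ih =>
    have h1 : (1 + w) ^ (n + 1) - 1 - ((n + 1 : ℕ) : ℂ) * w
        = (1 + w) * ((1 + w) ^ n - 1 - n * w) + n * w ^ 2 := by push_cast; ring
    have h2 : (1 : ℝ) ≤ r ^ (n + 1) := one_le_pow₀ hr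
    calc ‖(1 + w) ^ (n + 1) - 1 - ((n + 1 : ℕ) : ℂ) * w‖
        ≤ ‖1 + w‖ * ‖(1 + w) ^ n - 1 - n * w‖ + n * ‖w‖ ^ 2 := by
          rw [h1]
          refine (norm_add_le _ _).trans_eq ?_
          simp
      _ ≤ r * ((n : ℝ) ^ 2 * r ^ n * ‖w‖ ^ 2) + n * ‖w‖ ^ 2 := by gcongr
      _ ≤ ((n + 1 : ℕ) : ℝ) ^ 2 * r ^ (n + 1) * ‖w‖ ^ 2 := by
          have h3 : (n : ℝ) * ‖w‖ ^ 2 ≤ n * ‖w‖ ^ 2 * r ^ (n + 1) :=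
            le_mul_of_one_le_right (by positivity) h2
          have h4 : 0 ≤ ((n : ℝ) + 1) * (‖w‖ ^ 2 * r ^ (n + 1)) := by positivity
          have h5 : r * ((n : ℝ) ^ 2 * r ^ n * ‖w‖ ^ 2)
              = (n : ℝ) ^ 2 * (‖w‖ ^ 2 * r ^ (n + 1)) := by ring
          have h6 : 0 ≤ (n : ℝ) * (‖w‖ ^ 2 * r ^ (n + 1)) := by positivity
          push_cast
          linarith

/-- Powers of finitely many unimodular numbers are simultaneously close to `1` infinitely often. -/
lemma frequently_pow_re_ge {ι : Type*} [Finite ι] (x : ι → Circle) :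
    ∃ᶠ n : ℕ in atTop, ∀ i, (1 : ℝ) / 2 < (((x i : ℂ)) ^ n).re := by
  have h := mapClusterPt_one_atTop_pow x
  have hU : {y : ι → Circle | ∀ i, (1 : ℝ) / 2 < (y i : ℂ).re} ∈ nhds (1 : ι → Circle) := by
    have : IsOpen {y : ι → Circle | ∀ i, (1 : ℝ) / 2 < (y i : ℂ).re} := by
      simp only [Set.ofPred_forall]
      exact isOpen_iInter_of_finite fun i => isOpen_lt continuous_const (by fun_prop)
    exact this.mem_nhds (by intro i; simp; norm_num)
  refine (h.frequently hU).mono ?_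
  intro n hn i
  simpa using hn i

/-- The Bombieri-Lagarias argument: nonnegativity of the real parts of all the power sums
`∑ mᵢ (1 - (1 + wᵢ) ^ n)` forces `‖1 + wᵢ‖ ≤ 1`. -/
lemma norm_one_add_le_one_of_powersum {ι : Type*} (m : ι → ℕ) (hm : ∀ i, 1 ≤ m i) (w : ι → ℂ)
    (C : ℝ) (hC : ∀ i, |(w i).re| ≤ C * ‖w i‖ ^ 2)
    (hs : Summable fun i => (m i : ℝ) * ‖w i‖ ^ 2)
    (s : ℝ → Finset ι) (hsT : Tendsto s atTop atTop)
    (H : ∀ n : ℕ, 0 < n → ∃ L : ℂ,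
      Tendsto (fun T => ∑ i ∈ s T, (m i : ℂ) * (1 - (1 + w i) ^ n)) atTop (nhds L) ∧ 0 ≤ L.re) :
    ∀ i, ‖1 + w i‖ ≤ 1 := by
  classical
  by_contra! hcon
  obtain ⟨i₀, hi₀⟩ := hcon
  have hw2 : Summable fun i => ‖w i‖ ^ 2 := by
    refine hs.of_nonneg_of_le (fun i => by positivity) fun i => ?_
    exact le_mul_of_one_le_left (by positivity) (by exact_mod_cast hm i)
  have hfin : ∀ ε > 0, {i | ε ≤ ‖w i‖}.Finite := by
    intro ε hε
    have := hw2.tendsto_cofinite_zero.eventually (gt_mem_nhds (show (0 : ℝ) < ε ^ 2 by positivity))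
    refine (Filter.eventually_cofinite.1 this).subset fun i hi => ?_
    simp only [Set.mem_ofPred_eq, not_lt] at hi ⊢
    gcongr
  have hfin' : ∀ r > 1, {i | r ≤ ‖1 + w i‖}.Finite := by
    intro r hr
    refine (hfin (r - 1) (by linarith)).subset fun i hi => ?_
    simp only [Set.mem_ofPred_eq] at hi ⊢
    have := norm_add_le (1 : ℂ) (w i)
    simp at this
    linarith
  -- the maximal modulus
  set A := (hfin' _ hi₀).toFinset with hA
  have hi₀A : i₀ ∈ A := by simp [hA]
  obtain ⟨i₁, hi₁A, hi₁⟩ := A.exists_max_image (fun i => ‖1 + w i‖) ⟨i₀, hi₀A⟩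
  set M := ‖1 + w i₁‖ with hM
  have hM1 : 1 < M := hi₀.trans_le (hi₁ _ hi₀A)
  have hmax : ∀ i, ‖1 + w i‖ ≤ M := by
    intro i
    by_cases h : ‖1 + w i₀‖ ≤ ‖1 + w i‖
    · exact hi₁ i (by simpa [hA] using h)
    · exact (not_le.1 h).le.trans (hi₁ _ hi₀A)
  set K := (hfin' _ hM1).toFinset with hK
  have hKM : ∀ i ∈ K, ‖1 + w i‖ = M := fun i hi =>
    le_antisymm (hmax i) (by simpa [hK] using hi)
  have hi₁K : i₁ ∈ K := by simp [hK, hM]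
  obtain ⟨r, hr1, hrM, hr⟩ : ∃ r, 1 ≤ r ∧ r < M ∧ ∀ i ∉ K, ‖1 + w i‖ ≤ r := by
    set q := (1 + M) / 2 with hq
    set D := (hfin' q (by linarith)).toFinset \ K
    by_cases hD : D.Nonempty
    · obtain ⟨j, hj, hjmax⟩ := D.exists_max_image (fun i => ‖1 + w i‖) hD
      have hjK : j ∉ K := (Finset.mem_sdiff.1 hj).2
      have hjM : ‖1 + w j‖ < M := by
        rw [hK] at hjK
        simpa using hjK
      refine ⟨max q ‖1 + w j‖, le_max_of_le_left (by linarith), max_lt (by linarith) hjM,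
        fun i hi => ?_⟩
      by_cases hqi : q ≤ ‖1 + w i‖
      · exact le_max_of_le_right (hjmax i (Finset.mem_sdiff.2 ⟨by simpa using hqi, hi⟩))
      · exact le_max_of_le_left (not_le.1 hqi).le
    · refine ⟨q, by linarith, by linarith, fun i hi => ?_⟩
      by_contra h
      exact hD ⟨i, Finset.mem_sdiff.2 ⟨by simpa using (not_le.1 h).le, hi⟩⟩
  set S := ∑' i, (m i : ℝ) * ‖w i‖ ^ 2 with hS
  have hS0 : 0 ≤ S := tsum_nonneg fun i => by positivity
  have hC0 : 0 ≤ |C| := abs_nonneg C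
  have hCabs : ∀ i, |(w i).re| ≤ |C| * ‖w i‖ ^ 2 := fun i =>
    (hC i).trans (by gcongr; exact le_abs_self C)
  set mK : ℝ := ∑ i ∈ K, (m i : ℝ) with hmK
  have hmK1 : 1 ≤ mK := by
    have : (m i₁ : ℝ) ≤ mK := Finset.single_le_sum (f := fun i => (m i : ℝ))
      (fun i _ => by positivity) hi₁K
    exact le_trans (by exact_mod_cast hm i₁) this
  -- the growth comparison
  have hgrow : ∀ᶠ n : ℕ in atTop, mK - M ^ n * (mK / 2) + (|C| + 1) * ((n : ℝ) ^ 2 * r ^ n) * S < 0 := by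
    have hM0 : 0 < M := by linarith
    have hrM' : |r / M| < 1 := by
      rw [abs_of_nonneg (by positivity), div_lt_one hM0]; exact hrM
    have t1 : Tendsto (fun n : ℕ => mK * (1 / M) ^ n - mK / 2
        + (|C| + 1) * ((n : ℝ) ^ 2 * (r / M) ^ n) * S) atTop
        (nhds (mK * 0 - mK / 2 + (|C| + 1) * 0 * S)) := by
      refine Tendsto.add (Tendsto.sub_const (Tendsto.const_mul _ ?_) _)
        (Tendsto.mul_const _ (Tendsto.const_mul _ ?_))
      · exact tendsto_pow_atTop_nhds_zero_of_lt_one (by positivity)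
          (by rw [div_lt_one hM0]; exact hM1)
      · exact tendsto_pow_const_mul_const_pow_of_abs_lt_one 2 hrM'
    have := t1.eventually (gt_mem_nhds (show mK * 0 - mK / 2 + (|C| + 1) * 0 * S < 0 by linarith))
    filter_upwards [this] with n hn
    have hMn : 0 < M ^ n := by positivity
    have : mK - M ^ n * (mK / 2) + (|C| + 1) * ((n : ℝ) ^ 2 * r ^ n) * S
        = M ^ n * (mK * (1 / M) ^ n - mK / 2 + (|C| + 1) * ((n : ℝ) ^ 2 * (r / M) ^ n) * S) := by
      rw [div_pow, div_pow, one_pow]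
      field_simp
    rw [this]
    exact mul_neg_of_pos_of_neg hMn hn
  -- simultaneous approximation
  have hfreq : ∃ᶠ n : ℕ in atTop, ∀ i ∈ K, M ^ n / 2 ≤ ((1 + w i) ^ n).re := by
    have hM0 : 0 < M := by linarith
    have hne : ∀ i : K, (1 + w i) / (M : ℂ) ∈ Submonoid.unitSphere ℂ := by
      intro i
      have : ‖1 + w i‖ = M := hKM i i.2
      simp [Submonoid.unitSphere, this, abs_of_pos hM0, hM0.ne']
    refine (frequently_pow_re_ge (fun i : K => (⟨_, hne i⟩ : Circle))).mono ?_
    intro n hn i hi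
    have h1 := hn ⟨i, hi⟩
    have h2 : ((1 + w i) / (M : ℂ)) ^ n = ((1 / M ^ n : ℝ) : ℂ) * (1 + w i) ^ n := by
      rw [div_pow]; push_cast; ring
    simp only at h1
    have h1' : (1 : ℝ) / 2 < (((1 + w i) / (M : ℂ)) ^ n).re := h1
    rw [h2, re_ofReal_mul] at h1'
    have hMn : 0 < M ^ n := by positivity
    rw [div_mul_eq_mul_div, one_mul, lt_div_iff₀ hMn] at h1'
    linarith
  obtain ⟨n, hn1, hn2, hn0⟩ := (hfreq.and_eventually (hgrow.and (eventually_gt_atTop 0))).exists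
  obtain ⟨L, hL, hL0⟩ := H n hn0
  have hLre := (continuous_re.tendsto L).comp hL
  have hev : ∀ᶠ T in atTop, (∑ i ∈ s T, (m i : ℂ) * (1 - (1 + w i) ^ n)).re
      ≤ mK - M ^ n * (mK / 2) + (|C| + 1) * ((n : ℝ) ^ 2 * r ^ n) * S := by
    filter_upwards [hsT.eventually (eventually_ge_atTop K)] with T hT
    rw [re_sum, ← Finset.sum_sdiff hT, add_comm]
    have e1 : ∑ i ∈ K, ((m i : ℂ) * (1 - (1 + w i) ^ n)).re ≤ mK - M ^ n * (mK / 2) := by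
      have : mK - M ^ n * (mK / 2) = ∑ i ∈ K, (m i : ℝ) * (1 - M ^ n / 2) := by
        rw [← Finset.sum_mul]; ring
      rw [this]
      refine Finset.sum_le_sum fun i hi => ?_
      have e : ((m i : ℂ) * (1 - (1 + w i) ^ n)).re = (m i : ℝ) * (1 - ((1 + w i) ^ n).re) := by
        rw [← ofReal_natCast, re_ofReal_mul]; simp
      rw [e]
      have := hn1 i hi
      gcongr
    have e2 : ∑ i ∈ s T \ K, ((m i : ℂ) * (1 - (1 + w i) ^ n)).re
        ≤ (|C| + 1) * ((n : ℝ) ^ 2 * r ^ n) * S := by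
      calc _ ≤ ∑ i ∈ s T \ K, (|C| + 1) * ((n : ℝ) ^ 2 * r ^ n) * ((m i : ℝ) * ‖w i‖ ^ 2) := by
            refine Finset.sum_le_sum fun i hi => ?_
            have hiK := (Finset.mem_sdiff.1 hi).2
            have e : ((m i : ℂ) * (1 - (1 + w i) ^ n)).re
                = (m i : ℝ) * (1 - ((1 + w i) ^ n).re) := by
              rw [← ofReal_natCast, re_ofReal_mul]; simp
            have b1 := (abs_re_le_norm _).trans (norm_one_add_pow_sub_le hr1 (hr i hiK) n)
            have e' : ((1 + w i) ^ n - 1 - n * w i).re = ((1 + w i) ^ n).re - 1 - n * (w i).re := by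
              rw [← ofReal_natCast, sub_re, sub_re, re_ofReal_mul]; simp
            rw [e'] at b1
            have b2 := hCabs i
            have b3 : (n : ℝ) * |(w i).re| ≤ (n : ℝ) ^ 2 * r ^ n * (|C| * ‖w i‖ ^ 2) := by
              have hn1' : (1 : ℝ) ≤ n := by exact_mod_cast hn0
              have : (n : ℝ) ≤ (n : ℝ) ^ 2 * r ^ n := by
                have := one_le_pow₀ hr1 (n := n)
                nlinarith
              gcongr
            rw [e]
            have b4 : 1 - ((1 + w i) ^ n).re ≤ (|C| + 1) * ((n : ℝ) ^ 2 * r ^ n) * ‖w i‖ ^ 2 := by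
              have := (abs_le.1 b1).1
              have h5 : -(n * (w i).re) ≤ n * |(w i).re| := by
                have := neg_abs_le (w i).re
                have hn' : (0 : ℝ) ≤ n := by positivity
                nlinarith
              nlinarith
            calc (m i : ℝ) * (1 - ((1 + w i) ^ n).re)
                ≤ m i * ((|C| + 1) * ((n : ℝ) ^ 2 * r ^ n) * ‖w i‖ ^ 2) := by gcongr
              _ = _ := by ring
        _ = (|C| + 1) * ((n : ℝ) ^ 2 * r ^ n) * ∑ i ∈ s T \ K, ((m i : ℝ) * ‖w i‖ ^ 2) := by
            rw [Finset.mul_sum]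
        _ ≤ _ := by
            gcongr
            exact hs.sum_le_tsum _ fun i _ => by positivity
    exact add_le_add e1 e2
  have := le_of_tendsto hLre hev
  linarith

lemma analyticOrderAt_ne_top_of_entire {f : ℂ → ℂ} (hf : Differentiable ℂ f) {a : ℂ} (ha : f a ≠ 0)
    (z : ℂ) : analyticOrderAt f z ≠ ⊤ := by
  intro h
  rw [analyticOrderAt_eq_top] at h
  have := (hf.differentiableOn.analyticOnNhd isOpen_univ).eq_of_eventuallyEq
    (g := fun _ => 0) analyticOnNhd_const h
  exact ha (congrFun this a)

lemma zeroOrder_eq_analyticOrderAt {f : ℂ → ℂ} (hf : Differentiable ℂ f) {z : ℂ}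
    (h : analyticOrderAt f z ≠ ⊤) : (zeroOrder f z : ℕ∞) = analyticOrderAt f z := by
  obtain ⟨N, hN⟩ := ENat.ne_top_iff_exists.1 h
  have hA : AnalyticAt ℂ f z := hf.analyticAt z
  have h1 : ∀ i < N, iteratedDeriv i f z = 0 :=
    (natCast_le_analyticOrderAt_iff_iteratedDeriv_eq_zero hA).1 hN.le
  have h2 : ¬ ∀ i < N + 1, iteratedDeriv i f z = 0 := by
    intro h3
    have := (natCast_le_analyticOrderAt_iff_iteratedDeriv_eq_zero hA).2 h3
    rw [← hN] at this
    exact absurd (by exact_mod_cast this : N + 1 ≤ N) (by omega)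
  have h3 : iteratedDeriv N f z ≠ 0 := by
    push Not at h2
    obtain ⟨i, hi, hi0⟩ := h2
    rcases Nat.lt_succ_iff_lt_or_eq.1 hi with h | h
    · exact absurd (h1 i h) hi0
    · exact h ▸ hi0
  rw [← hN]
  norm_cast
  refine le_antisymm (Nat.sInf_le h3) ?_
  refine le_csInf ⟨N, h3⟩ fun k hk => ?_
  by_contra hlt
  exact hk (h1 k (not_le.1 hlt))

lemma one_le_zeroOrder {f : ℂ → ℂ} (hf : Differentiable ℂ f) {a : ℂ} (ha : f a ≠ 0) {z : ℂ}
    (hz : f z = 0) : 1 ≤ zeroOrder f z := by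
  have h := zeroOrder_eq_analyticOrderAt hf (analyticOrderAt_ne_top_of_entire hf ha z)
  have h0 : analyticOrderAt f z ≠ 0 := (hf.analyticAt z).analyticOrderAt_ne_zero.2 hz
  rw [← h] at h0
  have : zeroOrder f z ≠ 0 := by exact_mod_cast h0
  omega

/-- The zeros of a nonzero entire function in a bounded set are finite in number. -/
lemma finite_zeros_of_isBounded {f : ℂ → ℂ} (hf : Differentiable ℂ f) {a : ℂ} (ha : f a ≠ 0)
    {s : Set ℂ} (hs : Bornology.IsBounded s) : {z | f z = 0 ∧ z ∈ s}.Finite := by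
  obtain ⟨R, hR⟩ := hs.subset_closedBall 0
  have hK : IsCompact (Metric.closedBall (0 : ℂ) R) := isCompact_closedBall 0 R
  by_contra hinf
  obtain ⟨z, hz, hacc⟩ := Set.Infinite.exists_accPt_of_subset_isCompact hinf hK
    (fun z hz => hR hz.2)
  have hfr : ∃ᶠ w in nhdsWithin z {z}ᶜ, f w = 0 := by
    have := accPt_iff_frequently_nhdsNE.1 hacc
    exact this.mono fun w hw => hw.1
  have := (hf.differentiableOn.analyticOnNhd isOpen_univ).eq_of_frequently_eq
    (g := fun _ => 0) (z₀ := z) analyticOnNhd_const hfr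
  exact ha (congrFun this a)

lemma exists_entire_quotient {f : ℂ → ℂ} (hf : Differentiable ℂ f) {z : ℂ} {n : ℕ}
    (h : analyticOrderAt f z = n) :
    ∃ g : ℂ → ℂ, Differentiable ℂ g ∧ g z ≠ 0 ∧ ∀ s, f s = (s - z) ^ n * g s := by
  classical
  obtain ⟨k, hk, hk0, hfk⟩ := (hf.analyticAt z).analyticOrderAt_eq_natCast.1 h
  have hg : ∀ s ≠ z, DifferentiableAt ℂ
      (Function.update (fun s => f s / (s - z) ^ n) z (k z)) s := by
    intro s hs
    have : DifferentiableAt ℂ (fun s => f s / (s - z) ^ n) s :=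
      (hf s).div (by fun_prop) (pow_ne_zero _ (sub_ne_zero.2 hs))
    refine this.congr_of_eventuallyEq ?_
    filter_upwards [isOpen_ne.mem_nhds hs] with w hw
    rw [Function.update_of_ne hw]
  refine ⟨Function.update (fun s => f s / (s - z) ^ n) z (k z), fun s => ?_, by simpa, fun s => ?_⟩
  · by_cases hs : s = z
    · subst hs
      refine hk.differentiableAt.congr_of_eventuallyEq ?_
      filter_upwards [hfk] with w hw
      by_cases hws : w = s
      · simp [hws]
      · rw [Function.update_of_ne hws, hw, smul_eq_mul,
          mul_div_cancel_left₀ _ (pow_ne_zero _ (sub_ne_zero.2 hws))]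
    · exact hg s hs
  · by_cases hs : s = z
    · subst hs
      have := hfk.self_of_nhds
      simpa using this
    · rw [Function.update_of_ne hs, mul_div_cancel₀ _ (pow_ne_zero _ (sub_ne_zero.2 hs))]

/-- Dividing out finitely many zeros of an entire function, with multiplicity. -/
lemma exists_entire_factorization {f : ℂ → ℂ} (hf : Differentiable ℂ f) {a : ℂ} (ha : f a ≠ 0)
    (Z : Finset ℂ) :
    ∃ g : ℂ → ℂ, Differentiable ℂ g ∧ (∀ z ∈ Z, g z ≠ 0) ∧
      ∀ s, f s = (∏ z ∈ Z, (s - z) ^ zeroOrder f z) * g s := by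
  classical
  induction Z using Finset.induction_on with
  | empty => exact ⟨f, hf, by simp, by simp⟩
  | insert z Z hz ih =>
    obtain ⟨g, hg, hg0, hfg⟩ := ih
    set P : ℂ → ℂ := fun s => ∏ z ∈ Z, (s - z) ^ zeroOrder f z with hP
    have hPd : Differentiable ℂ P := by
      rw [hP]; fun_prop
    have hPz : P z ≠ 0 := by
      rw [hP]
      refine Finset.prod_ne_zero_iff.2 fun w hw => pow_ne_zero _ (sub_ne_zero.2 ?_)
      rintro rfl
      exact hz hw
    have hord : analyticOrderAt g z = zeroOrder f z := by
      rw [zeroOrder_eq_analyticOrderAt hf (analyticOrderAt_ne_top_of_entire hf ha z)]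
      have : f = P * g := funext hfg
      rw [this, analyticOrderAt_mul (hPd.analyticAt z) (hg.analyticAt z),
        (hPd.analyticAt z).analyticOrderAt_eq_zero.2 hPz, zero_add]
    obtain ⟨k, hk, hkz, hgk⟩ := exists_entire_quotient hg hord
    refine ⟨k, hk, fun w hw => ?_, fun s => ?_⟩
    · rcases Finset.mem_insert.1 hw with rfl | hw
      · exact hkz
      · intro h
        exact hg0 w hw (by rw [hgk, h, mul_zero])
    · rw [hfg, hgk, Finset.prod_insert hz]
      ring

/-- Entire functions, zero-free in a ball: the logarithmic derivative varies slowly. -/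
lemma norm_logDeriv_sub_le {g : ℂ → ℂ} (hg : Differentiable ℂ g) {R M : ℝ} (hR : 0 < R)
    (hM : 0 < M) (h0 : ∀ s ∈ Metric.ball (0 : ℂ) R, g s ≠ 0)
    (hb : ∀ s ∈ Metric.ball (0 : ℂ) R, ‖g s‖ ≤ Real.exp M * ‖g 0‖) {s z : ℂ}
    (hs : ‖s‖ < R / 4) (hz : ‖z‖ < R / 4) :
    ‖logDeriv g s - logDeriv g z‖ ≤ 128 * M / R ^ 2 * ‖s - z‖ := by
  have hg' : Differentiable ℂ (deriv g) := hg.deriv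
  have hL : DifferentiableOn ℂ (logDeriv g) (Metric.ball 0 R) := fun w hw =>
    ((hg' w).div (hg w) (h0 w hw)).differentiableWithinAt
  obtain ⟨H, hH0, hH⟩ := hL.isExactOn_ball.with_val_at 0 0
  have h0mem : (0 : ℂ) ∈ Metric.ball (0 : ℂ) R := Metric.mem_ball_self hR
  have hconst : ∀ w ∈ Metric.ball (0 : ℂ) R, g w * Complex.exp (-H w) = g 0 := by
    intro w hw
    have hd : ∀ v ∈ Metric.ball (0 : ℂ) R,
        HasDerivAt (fun v => g v * Complex.exp (-H v)) 0 v := by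
      intro v hv
      have h1 := (hg v).hasDerivAt.mul ((hH v hv).neg.cexp)
      refine h1.congr_deriv ?_
      rw [logDeriv_apply]
      have := h0 v hv
      simp only [Pi.neg_apply]
      field_simp
      ring
    have := (convex_ball (0 : ℂ) R).is_const_of_fderivWithin_eq_zero (𝕜 := ℂ)
      (f := fun v => g v * Complex.exp (-H v))
      (fun v hv => (hd v hv).differentiableAt.differentiableWithinAt)
      (fun v hv => by
        rw [((hd v hv).hasFDerivAt.hasFDerivWithinAt).fderivWithin
          (Metric.isOpen_ball.uniqueDiffWithinAt hv)]
        ext; simp) hw h0mem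
    simpa [hH0] using this
  have hHre : ∀ w ∈ Metric.ball (0 : ℂ) R, (H w).re ≤ M := by
    intro w hw
    have h1 := hconst w hw
    have h2 : ‖g w‖ = ‖g 0‖ * Real.exp (H w).re := by
      rw [← h1, norm_mul, Complex.norm_exp, mul_assoc, ← Real.exp_add]
      simp
    have h3 := hb w hw
    rw [h2, mul_comm] at h3
    have h4 : 0 < ‖g 0‖ := norm_pos_iff.2 (h0 0 h0mem)
    exact Real.exp_le_exp.1 (le_of_mul_le_mul_right h3 h4)
  have hHd : DifferentiableOn ℂ H (Metric.ball 0 R) := fun w hw =>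
    (hH w hw).differentiableAt.differentiableWithinAt
  have hHb : ∀ w, ‖w‖ ≤ R / 2 → ‖H w‖ ≤ 2 * M := by
    intro w hw
    have hwR : w ∈ Metric.ball (0 : ℂ) R := by
      rw [mem_ball_zero_iff]; linarith
    refine (borelCaratheodory_zero hM hHd hHre hR hwR hH0).trans ?_
    rw [div_le_iff₀ (by linarith)]
    nlinarith
  have hballR : ∀ {w : ℂ}, ‖w‖ < R → w ∈ Metric.ball (0 : ℂ) R := fun hw =>
    mem_ball_zero_iff.2 hw
  have hcl : ∀ {c : ℂ} {x : ℂ}, x ∈ Metric.closedBall c (R / 8) → ‖x‖ ≤ ‖c‖ + R / 8 := by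
    intro c x hx
    have := norm_sub_norm_le x c
    rw [Metric.mem_closedBall, dist_eq_norm] at hx
    linarith
  have hLb : ∀ w, ‖w‖ ≤ 3 * R / 8 → ‖logDeriv g w‖ ≤ 2 * M / (R / 8) := by
    intro w hw
    rw [← (hH w (hballR (by linarith))).deriv]
    refine norm_deriv_le_of_forall_mem_sphere_norm_le (by positivity) ?_ ?_
    · refine DifferentiableOn.diffContOnCl (hHd.mono ?_)
      rw [closure_ball _ (by positivity)]
      intro x hx
      have := hcl hx
      exact hballR (by linarith)
    · intro x hx
      have := hcl (Metric.sphere_subset_closedBall hx)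
      exact hHb x (by linarith)
  have hLb2 : ∀ w ∈ Metric.ball (0 : ℂ) (R / 4), ‖deriv (logDeriv g) w‖ ≤ 128 * M / R ^ 2 := by
    intro w hw
    rw [mem_ball_zero_iff] at hw
    have : 128 * M / R ^ 2 = 2 * M / (R / 8) / (R / 8) := by
      field_simp; norm_num
    rw [this]
    refine norm_deriv_le_of_forall_mem_sphere_norm_le (by positivity) ?_ ?_
    · refine DifferentiableOn.diffContOnCl (hL.mono ?_)
      rw [closure_ball _ (by positivity)]
      intro x hx
      have := hcl hx
      exact hballR (by linarith)
    · intro x hx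
      have := hcl (Metric.sphere_subset_closedBall hx)
      exact hLb x (by linarith)
  refine (convex_ball (0 : ℂ) (R / 4)).norm_image_sub_le_of_norm_deriv_le (𝕜 := ℂ)
    (fun w hw => ?_) hLb2 (mem_ball_zero_iff.2 hz) (mem_ball_zero_iff.2 hs)
  rw [mem_ball_zero_iff] at hw
  exact hL.differentiableAt (Metric.isOpen_ball.mem_nhds (hballR (by linarith)))

/-- Approximate partial fraction expansion of `f'/f`. -/
lemma norm_logDeriv_sub_sum_le {f : ℂ → ℂ} (hf : Differentiable ℂ f) (hf0 : f 0 ≠ 0) {R M : ℝ}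
    (hR : 0 < R) (hM : 0 < M)
    (hb : ∀ s, ‖s‖ ≤ 2 * R → ‖f s‖ ≤ Real.exp M * ‖f 0‖) (Z : Finset ℂ)
    (hZ : ∀ z, z ∈ Z ↔ f z = 0 ∧ ‖z‖ ≤ R) {s z : ℂ}
    (hs : ‖s‖ < R / 4) (hz : ‖z‖ < R / 4) (hfs : f s ≠ 0) (hfz : f z ≠ 0) :
    ‖∑ w ∈ Z, (zeroOrder f w : ℂ) * (1 / (s - w) - 1 / (z - w))
      - (logDeriv f s - logDeriv f z)‖ ≤ 128 * M / R ^ 2 * ‖s - z‖ := by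
  obtain ⟨g, hg, hgZ, hfg⟩ := exists_entire_factorization hf hf0 Z
  have hne : ∀ {s w : ℂ}, f s ≠ 0 → w ∈ Z → s - w ≠ 0 := by
    intro s w hs hw
    refine sub_ne_zero.2 ?_
    rintro rfl
    exact hs ((hZ s).1 hw).1
  have hPne : ∀ {s : ℂ}, f s ≠ 0 → ∏ w ∈ Z, (s - w) ^ zeroOrder f w ≠ 0 := fun hs =>
    Finset.prod_ne_zero_iff.2 fun w hw => pow_ne_zero _ (hne hs hw)
  have hgne : ∀ {s : ℂ}, f s ≠ 0 → g s ≠ 0 := by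
    intro s hs h
    exact hs (by rw [hfg, h, mul_zero])
  have hlog : ∀ {s : ℂ}, f s ≠ 0 →
      logDeriv f s = ∑ w ∈ Z, (zeroOrder f w : ℂ) * (1 / (s - w)) + logDeriv g s := by
    intro s hs
    have h1 : f = fun s => (∏ w ∈ Z, (s - w) ^ zeroOrder f w) * g s := funext hfg
    conv_lhs => rw [h1]
    rw [logDeriv_mul s (hPne hs) (hgne hs) (by fun_prop) (hg s)]
    congr 1
    rw [logDeriv_prod (s := Z) (f := fun w s => (s - w) ^ zeroOrder f w)
      (fun w hw => pow_ne_zero _ (hne hs hw)) (fun w _ => by fun_prop)]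
    refine Finset.sum_congr rfl fun w _ => ?_
    rw [logDeriv_fun_pow (by fun_prop)]
    congr 1
    simp [logDeriv_apply]
  have hball : ∀ s ∈ Metric.ball (0 : ℂ) R, g s ≠ 0 := by
    intro s hs
    rw [mem_ball_zero_iff] at hs
    by_cases h : f s = 0
    · exact hgZ s ((hZ s).2 ⟨h, hs.le⟩)
    · exact hgne h
  have hmax : ∀ s ∈ Metric.ball (0 : ℂ) R, ‖g s‖ ≤ Real.exp M * ‖g 0‖ := by
    intro s hs
    rw [mem_ball_zero_iff] at hs
    refine Complex.norm_le_of_forall_mem_frontier_norm_le (U := Metric.ball (0 : ℂ) (2 * R))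
      Metric.isBounded_ball hg.diffContOnCl ?_ (subset_closure ?_)
    · intro x hx
      rw [frontier_ball _ (by positivity), mem_sphere_zero_iff_norm] at hx
      have hxw : ∀ w ∈ Z, ‖(0 - w) ^ zeroOrder f w‖ ≤ ‖(x - w) ^ zeroOrder f w‖ := by
        intro w hw
        rw [norm_pow, norm_pow, zero_sub, norm_neg]
        have := ((hZ w).1 hw).2
        have := norm_sub_norm_le x w
        gcongr
        linarith
      have hP : ‖∏ w ∈ Z, (0 - w) ^ zeroOrder f w‖ ≤ ‖∏ w ∈ Z, (x - w) ^ zeroOrder f w‖ := by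
        rw [norm_prod, norm_prod]
        exact Finset.prod_le_prod (fun _ _ => norm_nonneg _) hxw
      have hP0 : 0 < ‖∏ w ∈ Z, (0 - w) ^ zeroOrder f w‖ := norm_pos_iff.2 (hPne hf0)
      have hbx := hb x hx.le
      rw [hfg x, hfg 0, norm_mul, norm_mul] at hbx
      have h2 : ‖∏ w ∈ Z, (0 - w) ^ zeroOrder f w‖ * ‖g x‖
          ≤ ‖∏ w ∈ Z, (0 - w) ^ zeroOrder f w‖ * (Real.exp M * ‖g 0‖) := by
        calc _ ≤ ‖∏ w ∈ Z, (x - w) ^ zeroOrder f w‖ * ‖g x‖ := by gcongr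
          _ ≤ _ := hbx
          _ = _ := by ring
      exact le_of_mul_le_mul_left h2 hP0
    · rw [mem_ball_zero_iff]; linarith
  have h := norm_logDeriv_sub_le hg hR hM hball hmax hz hs
  rw [norm_sub_rev z s] at h
  convert h using 2
  rw [hlog hfs, hlog hfz]
  simp only [mul_sub, Finset.sum_sub_distrib]
  ring

/-- Partial fractions of `f'/f` for an entire function `f` of order less than two. -/
lemma tendsto_sum_zeros_logDeriv {f : ℂ → ℂ} (hf : Differentiable ℂ f) (hf0 : f 0 ≠ 0) {B : ℝ}
    (hb : ∀ s, ‖f s‖ ≤ Real.exp (B * (1 + ‖s‖) ^ (3 / 2 : ℝ))) (Z : ℝ → Finset ℂ)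
    (hZ : ∀ R z, z ∈ Z R ↔ f z = 0 ∧ ‖z‖ ≤ R) {s z : ℂ} (hfs : f s ≠ 0) (hfz : f z ≠ 0) :
    Tendsto (fun R => ∑ w ∈ Z R, (zeroOrder f w : ℂ) * (1 / (s - w) - 1 / (z - w))) atTop
      (nhds (logDeriv f s - logDeriv f z)) := by
  rw [tendsto_iff_norm_sub_tendsto_zero]
  set A : ℝ := |B| + |Real.log ‖f 0‖| + 1 with hA
  have hA0 : 0 < A := by positivity
  have hlim : Tendsto (fun R : ℝ => 128 * A * (1 + 2 * R) ^ (3 / 2 : ℝ) / R ^ 2 * ‖s - z‖) atTop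
      (nhds 0) := by
    have h1 : Tendsto (fun R : ℝ => 128 * A * 3 ^ (3 / 2 : ℝ) * ‖s - z‖ * R ^ (-(1 / 2) : ℝ)) atTop
        (nhds (128 * A * 3 ^ (3 / 2 : ℝ) * ‖s - z‖ * 0)) :=
      (tendsto_rpow_neg_atTop (by norm_num)).const_mul _
    rw [mul_zero] at h1
    refine squeeze_zero' ?_ ?_ h1
    · filter_upwards [eventually_gt_atTop 0] with R hR
      positivity
    · filter_upwards [eventually_ge_atTop 1] with R hR
      have hR0 : 0 < R := by linarith
      have e1 : (1 + 2 * R) ^ (3 / 2 : ℝ) ≤ 3 ^ (3 / 2 : ℝ) * R ^ (3 / 2 : ℝ) := by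
        rw [← Real.mul_rpow (by norm_num) hR0.le]
        gcongr
        linarith
      have e2 : R ^ (-(1 / 2) : ℝ) = R ^ (3 / 2 : ℝ) / R ^ 2 := by
        rw [← Real.rpow_natCast R 2, ← Real.rpow_sub hR0]
        norm_num
      rw [e2]
      calc 128 * A * (1 + 2 * R) ^ (3 / 2 : ℝ) / R ^ 2 * ‖s - z‖
          ≤ 128 * A * (3 ^ (3 / 2 : ℝ) * R ^ (3 / 2 : ℝ)) / R ^ 2 * ‖s - z‖ := by gcongr
        _ = _ := by ring
  refine squeeze_zero' (Eventually.of_forall fun _ => norm_nonneg _) ?_ hlim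
  filter_upwards [eventually_gt_atTop (4 * (‖s‖ + ‖z‖) + 1)] with R hR
  have hs0 := norm_nonneg s
  have hz0 := norm_nonneg z
  have hR0 : 0 < R := by linarith
  have hM : 0 < A * (1 + 2 * R) ^ (3 / 2 : ℝ) := by positivity
  have := norm_logDeriv_sub_sum_le hf hf0 hR0 hM (fun w hw => ?_) (Z R) (hZ R)
    (by linarith) (by linarith) hfs hfz
  · rw [← mul_assoc] at this
    exact this
  · have h1 : (1 : ℝ) ≤ (1 + 2 * R) ^ (3 / 2 : ℝ) := Real.one_le_rpow (by linarith) (by norm_num)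
    have h2 : (1 + ‖w‖) ^ (3 / 2 : ℝ) ≤ (1 + 2 * R) ^ (3 / 2 : ℝ) := by gcongr
    have hf0' : 0 < ‖f 0‖ := norm_pos_iff.2 hf0
    rw [← Real.exp_log hf0', ← Real.exp_add]
    refine (hb w).trans (Real.exp_le_exp.2 ?_)
    have h3 : B * (1 + ‖w‖) ^ (3 / 2 : ℝ) ≤ |B| * (1 + 2 * R) ^ (3 / 2 : ℝ) := by
      refine (mul_le_mul_of_nonneg_right (le_abs_self B) (by positivity)).trans ?_
      gcongr
    have h4 : -Real.log (‖f 0‖) ≤ |Real.log ‖f 0‖| * (1 + 2 * R) ^ (3 / 2 : ℝ) :=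
      (neg_le_abs _).trans (le_mul_of_one_le_right (abs_nonneg _) h1)
    rw [hA]
    nlinarith

/-- The defect of Euler's approximation `(1 - x / n) ^ n` to `exp (-x)`. -/
def eulerDefect (n : ℕ) (x : ℝ) : ℝ :=
  Real.exp (-x) - (Set.Ioc 0 (n : ℝ)).indicator (fun x => (1 - x / n) ^ n) x

lemma eulerDefect_mem {n : ℕ} {x : ℝ} : 0 ≤ eulerDefect n x ∧ eulerDefect n x ≤ Real.exp (-x) := by
  unfold eulerDefect
  by_cases hx : x ∈ Set.Ioc 0 (n : ℝ)
  · rw [Set.indicator_of_mem hx]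
    have h1 : (1 - x / n) ^ n ≤ Real.exp (-x) := Real.one_sub_div_pow_le_exp_neg hx.2
    have h2 : 0 ≤ (1 - x / n) ^ n :=
      pow_nonneg (sub_nonneg.2 (div_le_one_of_le₀ hx.2 (Nat.cast_nonneg n))) _
    constructor <;> linarith
  · rw [Set.indicator_of_notMem hx]
    simp [Real.exp_nonneg]

lemma measurable_eulerDefect (n : ℕ) : Measurable (eulerDefect n) := by
  unfold eulerDefect
  refine Measurable.sub (by fun_prop) (Measurable.indicator (by fun_prop) measurableSet_Ioc)

lemma integrableOn_eulerDefect {s : ℝ} (hs : 0 < s) (n : ℕ) :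
    IntegrableOn (fun x : ℝ => eulerDefect n x * x ^ (s - 1)) (Set.Ioi 0) := by
  refine (Real.GammaIntegral_convergent hs).mono'
    ((measurable_eulerDefect n).mul (by fun_prop)).aestronglyMeasurable ?_
  rw [ae_restrict_iff' measurableSet_Ioi]
  refine ae_of_all _ fun x (hx : 0 < x) => ?_
  have := eulerDefect_mem (n := n) (x := x)
  rw [norm_mul, Real.norm_of_nonneg this.1, Real.norm_of_nonneg (by positivity)]
  exact mul_le_mul_of_nonneg_right this.2 (by positivity)

lemma Gamma_sub_GammaSeq {s : ℂ} (hs : 0 < s.re) {n : ℕ} (hn : n ≠ 0) :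
    Gamma s - GammaSeq s n = ∫ x in Set.Ioi (0 : ℝ), (eulerDefect n x : ℂ) * (x : ℂ) ^ (s - 1) := by
  have hG := Complex.GammaIntegral_convergent hs
  have hI : IntegrableOn (fun x : ℝ => (eulerDefect n x : ℂ) * (x : ℂ) ^ (s - 1)) (Set.Ioi 0) := by
    refine (integrableOn_eulerDefect hs n).mono' ?_ ?_
    · exact ((measurable_eulerDefect n).complex_ofReal.mul (by fun_prop)).aestronglyMeasurable
    · rw [ae_restrict_iff' measurableSet_Ioi]
      refine ae_of_all _ fun x (hx : 0 < x) => ?_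
      rw [norm_mul, norm_real, Real.norm_of_nonneg eulerDefect_mem.1,
        norm_cpow_eq_rpow_re_of_pos hx]
      simp
  rw [sub_eq_iff_eq_add', ← sub_eq_iff_eq_add, Gamma_eq_integral hs, Complex.GammaIntegral,
    ← integral_sub hG hI, GammaSeq_eq_approx_Gamma_integral hs hn,
    intervalIntegral.integral_of_le (Nat.cast_nonneg n),
    ← Set.inter_eq_self_of_subset_right
      (Set.Ioc_subset_Ioi_self : Set.Ioc (0 : ℝ) (n : ℝ) ⊆ Set.Ioi 0),
    ← setIntegral_indicator measurableSet_Ioc]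
  refine setIntegral_congr_fun measurableSet_Ioi fun x hx => ?_
  simp only [eulerDefect]
  by_cases hx : x ∈ Set.Ioc 0 (n : ℝ)
  · rw [Set.indicator_of_mem hx, Set.indicator_of_mem hx]
    push_cast
    ring
  · rw [Set.indicator_of_notMem hx, Set.indicator_of_notMem hx]
    simp

lemma norm_Gamma_sub_GammaSeq_le {s : ℂ} {a b : ℝ} (ha : 0 < a) (has : a ≤ s.re) (hsb : s.re ≤ b)
    {n : ℕ} (hn : n ≠ 0) :
    ‖Gamma s - GammaSeq s n‖ ≤ ‖Gamma a - GammaSeq a n‖ + ‖Gamma b - GammaSeq b n‖ := by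
  have key : ∀ {c : ℝ}, 0 < c → ∫ x in Set.Ioi (0 : ℝ), eulerDefect n x * x ^ (c - 1) =
      ‖Gamma c - GammaSeq c n‖ := by
    intro c hc
    rw [Gamma_sub_GammaSeq (by simpa using hc) hn]
    have : ∫ x in Set.Ioi (0 : ℝ), (eulerDefect n x : ℂ) * (x : ℂ) ^ ((c : ℂ) - 1) =
        ((∫ x in Set.Ioi (0 : ℝ), eulerDefect n x * x ^ (c - 1) : ℝ) : ℂ) := by
      rw [← integral_complex_ofReal]
      refine setIntegral_congr_fun measurableSet_Ioi fun x (hx : 0 < x) => ?_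
      push_cast
      rw [ofReal_cpow hx.le]
      push_cast
      rfl
    rw [this, norm_real, Real.norm_of_nonneg]
    refine setIntegral_nonneg measurableSet_Ioi fun x (hx : 0 < x) => ?_
    exact mul_nonneg eulerDefect_mem.1 (by positivity)
  have hs : 0 < s.re := ha.trans_le has
  have hb : 0 < b := hs.trans_le hsb
  rw [Gamma_sub_GammaSeq hs hn, ← key ha, ← key hb,
    ← integral_add (integrableOn_eulerDefect ha n) (integrableOn_eulerDefect hb n)]
  refine norm_integral_le_of_norm_le
    ((integrableOn_eulerDefect ha n).add (integrableOn_eulerDefect hb n)) ?_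
  rw [ae_restrict_iff' measurableSet_Ioi]
  refine ae_of_all _ fun x (hx : 0 < x) => ?_
  have h0 := (eulerDefect_mem (n := n) (x := x)).1
  rw [norm_mul, norm_real, Real.norm_of_nonneg h0, norm_cpow_eq_rpow_re_of_pos hx, ← mul_add]
  refine mul_le_mul_of_nonneg_left ?_ h0
  rw [sub_re, one_re]
  rcases le_total x 1 with h | h
  · have := Real.rpow_le_rpow_of_exponent_ge hx h (sub_le_sub_right has 1)
    have : 0 ≤ x ^ (b - 1) := by positivity
    linarith
  · have := Real.rpow_le_rpow_of_exponent_le h (sub_le_sub_right hsb 1)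
    have : 0 ≤ x ^ (a - 1) := by positivity
    linarith

lemma tendstoUniformlyOn_GammaSeq {a b : ℝ} (ha : 0 < a) :
    TendstoUniformlyOn (fun n s => GammaSeq s n) Gamma atTop {s : ℂ | a ≤ s.re ∧ s.re ≤ b} := by
  rw [Metric.tendstoUniformlyOn_iff]
  intro ε hε
  have h : ∀ c : ℝ, Tendsto (fun n => ‖Gamma c - GammaSeq c n‖) atTop (nhds 0) := by
    intro c
    have := (tendsto_const_nhds (x := Gamma (c : ℂ))).sub (GammaSeq_tendsto_Gamma (c : ℂ))
    rw [sub_self] at this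
    simpa using this.norm
  have h2 := (h a).add (h b)
  rw [add_zero] at h2
  filter_upwards [h2.eventually_lt_const hε, eventually_ne_atTop 0] with n hn hn0 s hs
  rw [dist_eq_norm]
  exact (norm_Gamma_sub_GammaSeq_le ha hs.1 hs.2 hn0).trans_lt hn

lemma logDeriv_GammaSeq {s : ℂ} (hs : 0 < s.re) {n : ℕ} (hn : n ≠ 0) :
    logDeriv (fun s => GammaSeq s n) s =
      Complex.log n - ∑ j ∈ Finset.range (n + 1), 1 / (s + j) := by
  have hne : ∀ j : ℕ, s + j ≠ 0 := by
    intro j h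
    have := congrArg Complex.re h
    simp at this
    have : (0 : ℝ) ≤ j := Nat.cast_nonneg j
    linarith
  have hnC : (n : ℂ) ≠ 0 := Nat.cast_ne_zero.2 hn
  have e : (fun s => GammaSeq s n) = fun s : ℂ => ((n : ℂ) ^ s * (n.factorial : ℂ)) /
      ∏ j ∈ Finset.range (n + 1), (s + j) := by
    ext s; rfl
  have hd : DifferentiableAt ℂ (fun s : ℂ => (n : ℂ) ^ s) s :=
    (differentiableAt_id).const_cpow (Or.inl hnC)
  rw [e, logDeriv_div (f := fun s : ℂ => (n : ℂ) ^ s * (n.factorial : ℂ)) s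
    (mul_ne_zero ((cpow_ne_zero_iff_of_exponent_ne_zero
      (by rintro rfl; simp at hs)).2 hnC) (Nat.cast_ne_zero.2 n.factorial_ne_zero))
    (Finset.prod_ne_zero_iff.2 fun j _ => hne j) (hd.mul_const _) (by fun_prop),
    logDeriv_mul_const _ _ (Nat.cast_ne_zero.2 n.factorial_ne_zero),
    logDeriv_prod (s := Finset.range (n + 1)) (f := fun (j : ℕ) (s : ℂ) => s + j)
    (fun j _ => hne j) (fun j _ => by fun_prop)]
  congr 1
  · have h1 : HasDerivAt (fun s : ℂ => (n : ℂ) ^ s) ((n : ℂ) ^ s * Complex.log n * 1) s :=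
      (hasDerivAt_id s).const_cpow (Or.inl hnC)
    rw [logDeriv_apply, h1.deriv]
    have : (n : ℂ) ^ s ≠ 0 := (cpow_ne_zero_iff_of_exponent_ne_zero
      (by rintro rfl; simp at hs)).2 hnC
    field_simp
  · refine Finset.sum_congr rfl fun j _ => ?_
    simp [logDeriv_apply]

lemma tendsto_digamma {s : ℂ} (hs : 0 < s.re) :
    Tendsto (fun n : ℕ => Complex.log n - ∑ j ∈ Finset.range (n + 1), 1 / (s + j)) atTop
      (nhds (digamma s)) := by
  have hopen : IsOpen {z : ℂ | s.re / 2 < z.re ∧ z.re < s.re + 1} :=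
    (isOpen_lt continuous_const continuous_re).inter (isOpen_lt continuous_re continuous_const)
  have hU := (tendstoUniformlyOn_GammaSeq (b := s.re + 1) (half_pos hs)).mono
    (s' := {z : ℂ | s.re / 2 < z.re ∧ z.re < s.re + 1}) (fun z hz => ⟨hz.1.le, hz.2.le⟩)
  have h := Complex.logDeriv_tendsto hopen (x := s) (by constructor <;> linarith)
    hU.tendstoLocallyUniformlyOn ?_ (Gamma_ne_zero_of_re_pos hs)
  · refine h.congr' ?_
    filter_upwards [eventually_ne_atTop 0] with n hn
    exact logDeriv_GammaSeq hs hn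
  · filter_upwards [eventually_ne_atTop 0] with n hn z hz
    have hz0 : 0 < z.re := by
      have : s.re / 2 < z.re := hz.1
      linarith
    unfold GammaSeq
    refine DifferentiableAt.differentiableWithinAt ?_
    refine DifferentiableAt.div ?_ (by fun_prop) (Finset.prod_ne_zero_iff.2 fun j _ h => ?_)
    · exact (differentiableAt_id.const_cpow (Or.inl (Nat.cast_ne_zero.2 hn))).mul_const _
    · have := congrArg Complex.re h
      simp at this
      have : (0 : ℝ) ≤ j := Nat.cast_nonneg j
      linarith

lemma digamma_conj {s : ℂ} (hs : 0 < s.re) :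
    digamma ((starRingEnd ℂ) s) = (starRingEnd ℂ) (digamma s) := by
  have h1 := tendsto_digamma (s := (starRingEnd ℂ) s) (by simpa using hs)
  have h2 := (Complex.continuous_conj.tendsto _).comp (tendsto_digamma hs)
  refine tendsto_nhds_unique h1 (h2.congr fun n => ?_)
  simp only [Function.comp, map_sub, map_sum, map_div₀, map_one, map_add, map_natCast]
  rw [← Complex.ofReal_natCast, ← Complex.ofReal_log (Nat.cast_nonneg n), conj_ofReal]

lemma norm_add_natCast_ge {z : ℂ} (hz : 1 ≤ z.re) (j : ℕ) :
    ((1 + |z.im|) / 2) ^ (3 / 4 : ℝ) * (1 + j : ℝ) ^ (1 / 4 : ℝ) ≤ ‖z + j‖ := by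
  have h1 : (1 + j : ℝ) ≤ ‖z + j‖ := by
    refine le_trans ?_ (Complex.re_le_norm _)
    simp; linarith
  have h2 : |z.im| ≤ ‖z + j‖ := by
    refine le_trans ?_ (Complex.abs_im_le_norm _)
    simp
  have hj : (0 : ℝ) ≤ j := Nat.cast_nonneg j
  have h3 : (1 + |z.im|) / 2 ≤ ‖z + j‖ := by linarith
  calc ((1 + |z.im|) / 2) ^ (3 / 4 : ℝ) * (1 + j : ℝ) ^ (1 / 4 : ℝ)
      ≤ ‖z + j‖ ^ (3 / 4 : ℝ) * ‖z + j‖ ^ (1 / 4 : ℝ) := by gcongr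
    _ = ‖z + j‖ := by
      rw [← Real.rpow_add (by linarith)]; norm_num

/-- The digamma function varies slowly in the half-plane `Re z ≥ 1`. -/
lemma exists_norm_digamma_sub_le : ∃ C : ℝ, 0 ≤ C ∧ ∀ z w : ℂ, 1 ≤ z.re → 1 ≤ w.re →
    ‖digamma z - digamma w‖ ≤ C * ‖z - w‖ * (1 + |z.im|) ^ (-(3 / 4) : ℝ) := by
  have hsum : Summable fun j : ℕ => (1 + j : ℝ) ^ (-(5 / 4) : ℝ) := by
    have := (summable_nat_add_iff 1).2
      (Real.summable_nat_rpow.2 (by norm_num : (-(5 / 4) : ℝ) < -1))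
    refine this.congr fun j => ?_
    push_cast
    rw [add_comm]
  set K := ∑' j : ℕ, (1 + j : ℝ) ^ (-(5 / 4) : ℝ) with hK
  have hK0 : 0 ≤ K := tsum_nonneg fun j => by positivity
  refine ⟨2 ^ (3 / 4 : ℝ) * K, by positivity, fun z w hz hw => ?_⟩
  have ht := (tendsto_digamma (s := z) (by linarith)).sub (tendsto_digamma (s := w) (by linarith))
  refine le_of_tendsto ht.norm (Eventually.of_forall fun n => ?_)
  have hne : ∀ {z : ℂ}, 1 ≤ z.re → ∀ j : ℕ, (1 + j : ℝ) ≤ ‖z + j‖ := by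
    intro z hz j
    refine le_trans ?_ (Complex.re_le_norm _)
    simp; linarith
  have e : (Complex.log n - ∑ j ∈ Finset.range (n + 1), 1 / (z + j)) -
      (Complex.log n - ∑ j ∈ Finset.range (n + 1), 1 / (w + j)) =
      ∑ j ∈ Finset.range (n + 1), (1 / (w + j) - 1 / (z + j)) := by
    rw [Finset.sum_sub_distrib]; ring
  rw [e]
  have hterm : ∀ j : ℕ, ‖1 / (w + j) - 1 / (z + j)‖ ≤
      2 ^ (3 / 4 : ℝ) * ‖z - w‖ * (1 + |z.im|) ^ (-(3 / 4) : ℝ) * (1 + j : ℝ) ^ (-(5 / 4) : ℝ) := by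
    intro j
    have hj : (0 : ℝ) < 1 + j := by positivity
    have hzj := hne hz j
    have hwj := hne hw j
    have hz0 : z + j ≠ 0 := norm_pos_iff.1 (hj.trans_le hzj)
    have hw0 : w + j ≠ 0 := norm_pos_iff.1 (hj.trans_le hwj)
    have e1 : 1 / (w + j) - 1 / (z + j) = (z - w) / ((z + j) * (w + j)) := by
      field_simp; ring
    rw [e1, norm_div, norm_mul]
    have h3 := norm_add_natCast_ge hz j
    have hp : 0 < ((1 + |z.im|) / 2) ^ (3 / 4 : ℝ) * (1 + j : ℝ) ^ (1 / 4 : ℝ) := by positivity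
    calc ‖z - w‖ / (‖z + j‖ * ‖w + j‖)
        ≤ ‖z - w‖ / ((((1 + |z.im|) / 2) ^ (3 / 4 : ℝ) * (1 + j : ℝ) ^ (1 / 4 : ℝ)) * (1 + j)) := by
          gcongr
      _ = _ := by
          rw [Real.div_rpow (by positivity) (by positivity), Real.rpow_neg (by positivity),
            Real.rpow_neg (by positivity)]
          have : (1 + j : ℝ) ^ (5 / 4 : ℝ) = (1 + j : ℝ) ^ (1 / 4 : ℝ) * (1 + j) := by
            rw [← Real.rpow_add_one hj.ne']; norm_num
          rw [this]
          have h5 : (0 : ℝ) < 2 ^ (3 / 4 : ℝ) := by positivity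
          have h6 : (0 : ℝ) < (1 + |z.im|) ^ (3 / 4 : ℝ) := by positivity
          have h7 : (0 : ℝ) < (1 + j : ℝ) ^ (1 / 4 : ℝ) := by positivity
          field_simp
  calc ‖∑ j ∈ Finset.range (n + 1), (1 / (w + j) - 1 / (z + j))‖
      ≤ ∑ j ∈ Finset.range (n + 1),
        2 ^ (3 / 4 : ℝ) * ‖z - w‖ * (1 + |z.im|) ^ (-(3 / 4) : ℝ) * (1 + j : ℝ) ^ (-(5 / 4) : ℝ) :=
        norm_sum_le_of_le _ fun j _ => hterm j
    _ ≤ 2 ^ (3 / 4 : ℝ) * ‖z - w‖ * (1 + |z.im|) ^ (-(3 / 4) : ℝ) * K := by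
        rw [← Finset.mul_sum]
        gcongr
        exact hsum.sum_le_tsum _ fun j _ => by positivity
    _ = _ := by ring

/-- Polynomial growth on a set. -/
def PolyGrowthOn (H : Set ℂ) (f : ℂ → ℂ) : Prop :=
  ∃ (C : ℝ) (k : ℕ), 0 ≤ C ∧ ∀ s ∈ H, ‖f s‖ ≤ C * (1 + ‖s‖) ^ k

/-- Growth of order at most `3 / 2` on a set. -/
def SubGaussianGrowthOn (H : Set ℂ) (f : ℂ → ℂ) : Prop :=
  ∃ B : ℝ, 0 ≤ B ∧ ∀ s ∈ H, ‖f s‖ ≤ Real.exp (B * (1 + ‖s‖) ^ (3 / 2 : ℝ))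

namespace PolyGrowthOn

variable {H : Set ℂ} {f g : ℂ → ℂ}

lemma of_bounded {C : ℝ} (h : ∀ s ∈ H, ‖f s‖ ≤ C) : PolyGrowthOn H f :=
  ⟨max C 0, 0, le_max_right _ _, fun s hs => by simpa using Or.inl (h s hs)⟩

lemma mul (hf : PolyGrowthOn H f) (hg : PolyGrowthOn H g) :
    PolyGrowthOn H fun s => f s * g s := by
  obtain ⟨C, k, hC, hf⟩ := hf
  obtain ⟨D, l, hD, hg⟩ := hg
  refine ⟨C * D, k + l, by positivity, fun s hs => ?_⟩
  rw [norm_mul]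
  calc ‖f s‖ * ‖g s‖ ≤ (C * (1 + ‖s‖) ^ k) * (D * (1 + ‖s‖) ^ l) := by
        gcongr
        · exact hf s hs
        · exact hg s hs
    _ = _ := by ring

lemma prod {ι : Type*} {f : ι → ℂ → ℂ} (t : Finset ι) (h : ∀ i, PolyGrowthOn H (f i)) :
    PolyGrowthOn H fun s => ∏ i ∈ t, f i s := by
  classical
  induction t using Finset.induction_on with
  | empty => exact of_bounded (C := 1) (by simp)
  | insert i t hi ih => simpa [Finset.prod_insert hi] using (h i).mul ih

lemma pow (hf : PolyGrowthOn H f) (k : ℕ) : PolyGrowthOn H fun s => f s ^ k := by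
  simpa using prod (Finset.range k) (fun _ => hf)

lemma linear (a b : ℂ) : PolyGrowthOn H fun s => a * s + b := by
  refine ⟨‖a‖ + ‖b‖, 1, by positivity, fun s _ => ?_⟩
  refine (norm_add_le _ _).trans ?_
  rw [norm_mul]
  nlinarith [norm_nonneg a, norm_nonneg b, norm_nonneg s, mul_nonneg (norm_nonneg b) (norm_nonneg s)]

end PolyGrowthOn

namespace SubGaussianGrowthOn

variable {H : Set ℂ} {f g : ℂ → ℂ}

lemma mul (hf : SubGaussianGrowthOn H f) (hg : SubGaussianGrowthOn H g) :
    SubGaussianGrowthOn H fun s => f s * g s := by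
  obtain ⟨C, hC, hf⟩ := hf
  obtain ⟨D, hD, hg⟩ := hg
  refine ⟨C + D, by positivity, fun s hs => ?_⟩
  rw [norm_mul, add_mul, Real.exp_add]
  gcongr
  · exact hf s hs
  · exact hg s hs

lemma prod {ι : Type*} {f : ι → ℂ → ℂ} (t : Finset ι) (h : ∀ i, SubGaussianGrowthOn H (f i)) :
    SubGaussianGrowthOn H fun s => ∏ i ∈ t, f i s := by
  classical
  induction t using Finset.induction_on with
  | empty => exact ⟨0, le_rfl, by simp⟩
  | insert i t hi ih => simpa [Finset.prod_insert hi] using (h i).mul ih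

lemma of_exp_linear {B : ℝ} (h : ∀ s ∈ H, ‖f s‖ ≤ Real.exp (B * (1 + ‖s‖))) :
    SubGaussianGrowthOn H f := by
  refine ⟨|B|, abs_nonneg _, fun s hs => (h s hs).trans (Real.exp_le_exp.2 ?_)⟩
  have h1 : (1 : ℝ) ≤ 1 + ‖s‖ := by linarith [norm_nonneg s]
  have h2 : 1 + ‖s‖ ≤ (1 + ‖s‖) ^ (3 / 2 : ℝ) := by
    conv_lhs => rw [← Real.rpow_one (1 + ‖s‖)]
    exact Real.rpow_le_rpow_of_exponent_le h1 (by norm_num)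
  calc B * (1 + ‖s‖) ≤ |B| * (1 + ‖s‖) := by gcongr; exact le_abs_self _
    _ ≤ _ := by gcongr

end SubGaussianGrowthOn

lemma PolyGrowthOn.subGaussianGrowthOn {H : Set ℂ} {f : ℂ → ℂ} (hf : PolyGrowthOn H f) :
    SubGaussianGrowthOn H f := by
  obtain ⟨C, k, hC, hf⟩ := hf
  refine SubGaussianGrowthOn.of_exp_linear (B := C + k) fun s hs => (hf s hs).trans ?_
  have h1 : C ≤ Real.exp (C * (1 + ‖s‖)) := by
    have := Real.add_one_le_exp (C * (1 + ‖s‖))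
    nlinarith [norm_nonneg s, mul_nonneg hC (norm_nonneg s)]
  have h2 : (1 + ‖s‖) ^ k ≤ Real.exp (k * (1 + ‖s‖)) := by
    rw [Real.exp_nat_mul]
    gcongr
    linarith [Real.add_one_le_exp (1 + ‖s‖)]
  rw [add_mul, Real.exp_add]
  gcongr

lemma norm_Gamma_le {z : ℂ} (hz : 0 < z.re) : ‖Gamma z‖ ≤ Real.Gamma z.re := by
  rw [Gamma_eq_integral hz, Real.Gamma_eq_integral hz, Complex.GammaIntegral]
  refine norm_integral_le_of_norm_le (Real.GammaIntegral_convergent hz) ?_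
  rw [ae_restrict_iff' measurableSet_Ioi]
  refine ae_of_all _ fun x (hx : 0 < x) => ?_
  rw [norm_mul, norm_real, Real.norm_of_nonneg (Real.exp_nonneg _), norm_cpow_eq_rpow_re_of_pos hx]
  simp

lemma real_Gamma_le {x : ℝ} (hx : 2 ≤ x) : Real.Gamma x ≤ Real.exp (2 * (1 + x) ^ (3 / 2 : ℝ)) := by
  have h1 : x ≤ (⌈x⌉₊ : ℝ) + 1 := (Nat.le_ceil x).trans (by linarith)
  have hc : (⌈x⌉₊ : ℝ) ≤ 1 + x := by
    have := (Nat.ceil_lt_add_one (by linarith : 0 ≤ x)).le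
    linarith
  have h2 : Real.Gamma x ≤ Real.Gamma ((⌈x⌉₊ : ℝ) + 1) :=
    Real.Gamma_strictMonoOn_Ici.monotoneOn hx (hx.trans h1) h1
  have hx0 : 0 < 1 + x := by linarith
  rw [Real.Gamma_nat_eq_factorial] at h2
  have h3 : ((⌈x⌉₊.factorial : ℕ) : ℝ) ≤ (⌈x⌉₊ : ℝ) ^ (⌈x⌉₊) := by
    exact_mod_cast Nat.factorial_le_pow ⌈x⌉₊
  have h4 : (⌈x⌉₊ : ℝ) ^ (⌈x⌉₊) ≤ (1 + x) ^ (⌈x⌉₊) := by gcongr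
  have h5 : (1 + x) ^ (⌈x⌉₊) ≤ (1 + x) ^ (1 + x) := by
    rw [← Real.rpow_natCast]
    exact Real.rpow_le_rpow_of_exponent_le (by linarith) hc
  refine h2.trans (h3.trans (h4.trans (h5.trans ?_)))
  rw [Real.rpow_def_of_pos hx0]
  refine Real.exp_le_exp.2 ?_
  have h6 : Real.log (1 + x) ≤ (1 + x) ^ (1 / 2 : ℝ) / (1 / 2) :=
    Real.log_le_rpow_div hx0.le (by norm_num)
  have h7 : (1 + x) ^ (3 / 2 : ℝ) = (1 + x) ^ (1 / 2 : ℝ) * (1 + x) := by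
    rw [← Real.rpow_add_one hx0.ne']; norm_num
  rw [h7]
  nlinarith

lemma subGaussianGrowthOn_Gamma {H : Set ℂ} {l : ℝ} {μ : ℂ} (hl : 0 ≤ l)
    (h : ∀ s ∈ H, 2 ≤ ((l : ℂ) * s + μ).re) :
    SubGaussianGrowthOn H fun s => Gamma ((l : ℂ) * s + μ) := by
  refine ⟨2 * (1 + l + ‖μ‖) ^ (3 / 2 : ℝ), by positivity, fun s hs => ?_⟩
  have h2 := h s hs
  refine (norm_Gamma_le (by linarith)).trans ((real_Gamma_le h2).trans (Real.exp_le_exp.2 ?_))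
  rw [mul_assoc, ← Real.mul_rpow (by positivity) (by positivity)]
  gcongr
  have h3 := Complex.re_le_norm ((l : ℂ) * s + μ)
  have h4 := norm_add_le ((l : ℂ) * s) μ
  rw [norm_mul, norm_real, Real.norm_of_nonneg hl] at h4
  nlinarith [norm_nonneg μ, norm_nonneg s, mul_nonneg hl (norm_nonneg s),
    mul_nonneg (norm_nonneg μ) (norm_nonneg s)]

lemma norm_Gamma_le_of_one_le_abs_im {b : ℝ} (n : ℕ) {z : ℂ} (hn : 2 ≤ z.re + n) (hb : z.re ≤ b)
    (him : 1 ≤ |z.im|) : ‖Gamma z‖ ≤ Real.Gamma (b + n) := by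
  have h : ‖Gamma z‖ ≤ ‖Gamma (z + n)‖ := by
    clear hn hb
    induction n with
    | zero => simp
    | succ n ih =>
      refine ih.trans ?_
      have h1 : 1 ≤ ‖z + n‖ := him.trans (by simpa using Complex.abs_im_le_norm (z + n))
      have h0 : z + n ≠ 0 := norm_pos_iff.1 (by linarith)
      push_cast
      rw [← add_assoc, Gamma_add_one _ h0, norm_mul]
      nlinarith [norm_nonneg (Gamma (z + n))]
  have h2 : (z + n).re = z.re + n := by simp
  refine h.trans ((norm_Gamma_le (by rw [h2]; linarith)).trans ?_)
  rw [h2]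
  exact Real.Gamma_strictMonoOn_Ici.monotoneOn hn (by simp; linarith) (by linarith)

/-- Phragmén–Lindelöf principle for polynomial growth in a vertical strip. -/
lemma polyGrowthOn_strip {f : ℂ → ℂ} (hf : Differentiable ℂ f) {a b : ℝ} (hab : a < b)
    (ha : PolyGrowthOn {s | s.re = a} f) (hb : PolyGrowthOn {s | s.re = b} f) {Y D E B : ℝ}
    (hE : 0 ≤ E)
    (hap : ∀ s : ℂ, a ≤ s.re → s.re ≤ b → Y ≤ |s.im| →
      ‖f s‖ ≤ D * Real.exp (E * (1 + ‖s‖) ^ B)) :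
    PolyGrowthOn {s | a ≤ s.re ∧ s.re ≤ b} f := by
  obtain ⟨C1, k1, hC1, h1⟩ := ha
  obtain ⟨C2, k2, hC2, h2⟩ := hb
  set K : ℝ := |a| + 1 with hK
  have hK0 : 0 < K := by positivity
  have hKs : ∀ s : ℂ, a ≤ s.re → 1 ≤ ‖s + K‖ := by
    intro s hs
    refine le_trans ?_ (Complex.re_le_norm _)
    simp only [add_re, ofReal_re, hK]
    linarith [neg_abs_le a]
  have hKn : ∀ s : ℂ, a ≤ s.re → 1 + ‖s‖ ≤ (2 + K) * ‖s + K‖ := by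
    intro s hs
    have e1 := hKs s hs
    have e2 : ‖s‖ ≤ ‖s + K‖ + K := by
      have := norm_sub_le (s + K) (K : ℂ)
      rwa [add_sub_cancel_right, norm_real, Real.norm_of_nonneg hK0.le] at this
    nlinarith
  have hKne : ∀ s : ℂ, a ≤ s.re → (s + K) ^ (k1 + k2) ≠ 0 := fun s hs =>
    pow_ne_zero _ (norm_pos_iff.1 (by linarith [hKs s hs]))
  set C : ℝ := (C1 + C2) * (2 + K) ^ (k1 + k2) with hC
  have hedge : ∀ s : ℂ, a ≤ s.re → ∀ {C' : ℝ} {k : ℕ}, 0 ≤ C' → C' ≤ C1 + C2 → k ≤ k1 + k2 →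
      ‖f s‖ ≤ C' * (1 + ‖s‖) ^ k → ‖f s / (s + K) ^ (k1 + k2)‖ ≤ C := by
    intro s hs C' k hC' hCC hk h
    rw [norm_div, div_le_iff₀ (norm_pos_iff.2 (hKne s hs)), norm_pow, hC, mul_assoc, ← mul_pow]
    refine h.trans ?_
    have : (1 + ‖s‖) ^ k ≤ (1 + ‖s‖) ^ (k1 + k2) :=
      pow_le_pow_right₀ (by linarith [norm_nonneg s]) hk
    calc C' * (1 + ‖s‖) ^ k ≤ (C1 + C2) * (1 + ‖s‖) ^ (k1 + k2) := by gcongr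
      _ ≤ _ := by gcongr; exact hKn s hs
  have hmain : ∀ s : ℂ, a ≤ s.re → s.re ≤ b → ‖f s / (s + K) ^ (k1 + k2)‖ ≤ C := by
    intro s hsa hsb
    refine PhragmenLindelof.vertical_strip (f := fun s => f s / (s + K) ^ (k1 + k2))
      (a := a) (b := b) ?_ ?_ ?_ ?_ hsa hsb
    · refine DifferentiableOn.diffContOnCl fun z hz => ?_
      have hz' : a ≤ z.re := by
        have : closure (re ⁻¹' Set.Ioo a b) ⊆ {z : ℂ | a ≤ z.re} :=
          closure_minimal (fun z hz => hz.1.le) (isClosed_le continuous_const continuous_re)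
        exact this hz
      exact ((hf z).div (by fun_prop) (hKne z hz')).differentiableWithinAt
    · have hcpos : 0 < Real.pi / (b - a) / 2 := by
        have := Real.pi_pos
        have : 0 < b - a := by linarith
        positivity
      set c := Real.pi / (b - a) / 2 with hc
      refine ⟨c, by linarith, E * Real.exp (c * (1 + |a| + |b|)), ?_⟩
      have hlo : ∀ᶠ x : ℝ in atTop, x ^ B ≤ Real.exp (c * x) := by
        have := (isLittleO_rpow_exp_pos_mul_atTop B hcpos).bound (c := 1) one_pos
        filter_upwards [this, eventually_ge_atTop 0] with x hx hx0
        rwa [Real.norm_of_nonneg (by positivity), Real.norm_of_nonneg (by positivity),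
          one_mul] at hx
      obtain ⟨x0, hx0⟩ := eventually_atTop.1 hlo
      refine Asymptotics.IsBigO.of_bound |D| ?_
      rw [eventually_inf_principal]
      refine (eventually_comap.2 ?_)
      filter_upwards [eventually_ge_atTop Y, eventually_ge_atTop x0] with y hy hyx z hz hzs
      simp only [Function.comp] at hz
      have hz1 : ‖z‖ ≤ |a| + |b| + |z.im| := by
        refine (Complex.norm_le_abs_re_add_abs_im z).trans ?_
        have : |z.re| ≤ |a| + |b| := by
          rw [abs_le]
          have h1 := hzs.1
          have h2 := hzs.2
          constructor
          · linarith [neg_abs_le a, abs_nonneg b]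
          · linarith [le_abs_self b, abs_nonneg a]
        linarith
      have hz2 : |z.im| ≤ ‖z‖ := Complex.abs_im_le_norm z
      have hfz := hap z hzs.1.le hzs.2.le (by rw [hz]; exact hy)
      have hp := hx0 (1 + ‖z‖) (by linarith)
      rw [norm_div, Real.norm_of_nonneg (Real.exp_nonneg _)]
      have hge : 1 ≤ ‖(z + K) ^ (k1 + k2)‖ := by
        rw [norm_pow]
        exact one_le_pow₀ (hKs z hzs.1.le)
      refine (div_le_self (norm_nonneg _) hge).trans (hfz.trans ?_)
      refine mul_le_mul (le_abs_self D) ?_ (Real.exp_nonneg _) (abs_nonneg _)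
      refine Real.exp_le_exp.2 ?_
      rw [mul_assoc, ← Real.exp_add]
      refine mul_le_mul_of_nonneg_left (hp.trans (Real.exp_le_exp.2 ?_)) hE
      rw [← mul_add]
      refine mul_le_mul_of_nonneg_left ?_ hcpos.le
      linarith
    · intro z hz
      exact hedge z hz.ge hC1 (by linarith) (by lia) (h1 z hz)
    · intro z hz
      exact hedge z (by rw [hz]; exact hab.le) hC2 (by linarith) (by lia) (h2 z hz)
  obtain ⟨C3, k3, hC3, h3⟩ := (PolyGrowthOn.linear (H := {s | a ≤ s.re ∧ s.re ≤ b}) 1 K).pow (k1 + k2)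
  have hC0 : 0 ≤ C := by positivity
  refine ⟨C * C3, k3, by positivity, fun s hs => ?_⟩
  have := hmain s hs.1 hs.2
  rw [norm_div, div_le_iff₀ (norm_pos_iff.2 (hKne s hs.1))] at this
  refine this.trans ?_
  have h4 := h3 s hs
  simp only [one_mul] at h4
  rw [mul_assoc C C3]
  exact mul_le_mul_of_nonneg_left h4 hC0

namespace SSF

variable {σ0 σ1 : ℝ} (S : SSF σ0 σ1)

/-- The polynomial factor of `ξ` carrying the poles and those of their reflections that are not
themselves poles. -/
def poleFactor (s : ℂ) : ℂ :=
  (∏ i, (s - S.pole i) ^ S.m i) *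
    ∏ i : Fin S.N, (if 2 * S.M + S.dlt ≤ (i : ℕ)
      then ((σ1 : ℂ) - s - (starRingEnd ℂ) (S.pole i)) ^ S.m i else 1)

/-- A right half-plane `Re s ≥ c` which is far enough to the right for all factors of `ξ` to be
under control. -/
structure FarRight (c : ℝ) : Prop where
  lt : σ0 < c
  pole_lt : ∀ i, (S.pole i).re < c
  refl_lt : ∀ i, σ1 - (S.pole i).re < c
  gamma : ∀ j, 2 ≤ S.lam j * c + (S.mu j).re

variable {S}

lemma FarRight.mono {c c' : ℝ} (h : S.FarRight c) (hc : c ≤ c') : S.FarRight c' :=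
  ⟨h.lt.trans_le hc, fun i => (h.pole_lt i).trans_le hc, fun i => (h.refl_lt i).trans_le hc,
    fun j => (h.gamma j).trans (by have := S.hlam j; gcongr)⟩

variable (S) in
lemma exists_farRight : ∃ c, S.FarRight c := by
  have h : ∀ᶠ c : ℝ in atTop, S.FarRight c := by
    have h1 : ∀ᶠ c : ℝ in atTop, ∀ i, (S.pole i).re < c :=
      eventually_all.2 fun i => eventually_gt_atTop _
    have h2 : ∀ᶠ c : ℝ in atTop, ∀ i, σ1 - (S.pole i).re < c :=
      eventually_all.2 fun i => eventually_gt_atTop _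
    have h3 : ∀ᶠ c : ℝ in atTop, ∀ j, 2 ≤ S.lam j * c + (S.mu j).re :=
      eventually_all.2 fun j => (tendsto_atTop_add_const_right _ _
        (tendsto_id.const_mul_atTop (S.hlam j))).eventually_ge_atTop _
    filter_upwards [eventually_gt_atTop σ0, h1, h2, h3] with c a1 a2 a3 a4
    exact ⟨a1, a2, a3, a4⟩
  exact h.exists

namespace FarRight

variable {c : ℝ}

lemma two_le_re (hc : S.FarRight c) {s : ℂ} (hs : c ≤ s.re) (j : Fin S.r) :
    2 ≤ ((S.lam j : ℂ) * s + S.mu j).re := by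
  simp only [add_re, re_ofReal_mul]
  exact (hc.mono hs).gamma j

lemma ne_pole (hc : S.FarRight c) {s : ℂ} (hs : c ≤ s.re) (i : Fin S.N) : s ≠ S.pole i := by
  rintro rfl
  linarith [hc.pole_lt i]

lemma ne_refl (hc : S.FarRight c) {s : ℂ} (hs : c ≤ s.re) (i : Fin S.N) :
    (σ1 : ℂ) - s - (starRingEnd ℂ) (S.pole i) ≠ 0 := by
  intro h
  have := congrArg Complex.re h
  simp at this
  linarith [hc.refl_lt i]

lemma poleFactor_ne_zero (hc : S.FarRight c) {s : ℂ} (hs : c ≤ s.re) : S.poleFactor s ≠ 0 := by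
  refine mul_ne_zero (Finset.prod_ne_zero_iff.2 fun i _ => pow_ne_zero _
    (sub_ne_zero.2 (hc.ne_pole hs i))) (Finset.prod_ne_zero_iff.2 fun i _ => ?_)
  split_ifs
  · exact pow_ne_zero _ (hc.ne_refl hs i)
  · exact one_ne_zero

lemma xi_eq (hc : S.FarRight c) {s : ℂ} (hs : c ≤ s.re) :
    S.xi s = S.F s * ((S.Q : ℂ) ^ s * (∏ j, Gamma ((S.lam j : ℂ) * s + S.mu j)) *
      S.poleFactor s) := by
  rw [S.hxiEq s (hc.ne_pole hs) ?_, poleFactor]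
  · ring
  · intro j k h
    have h1 := hc.two_le_re hs j
    rw [h] at h1
    simp at h1
    have : (0 : ℝ) ≤ k := Nat.cast_nonneg k
    linarith

lemma archFactor_ne_zero (hc : S.FarRight c) {s : ℂ} (hs : c ≤ s.re) :
    (S.Q : ℂ) ^ s * (∏ j, Gamma ((S.lam j : ℂ) * s + S.mu j)) * S.poleFactor s ≠ 0 := by
  refine mul_ne_zero (mul_ne_zero ?_ ?_) (hc.poleFactor_ne_zero hs)
  · have : (S.Q : ℂ) ≠ 0 := ofReal_ne_zero.2 S.hQ.ne'
    rw [cpow_def_of_ne_zero this]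
    exact Complex.exp_ne_zero _
  · exact Finset.prod_ne_zero_iff.2 fun j _ =>
      Gamma_ne_zero_of_re_pos (by linarith [hc.two_le_re hs j])

lemma analyticAt_F (hc : S.FarRight c) {s : ℂ} (hs : c ≤ s.re) : AnalyticAt ℂ S.F s := by
  have h : (fun z => S.G z / ∏ i, (z - S.pole i) ^ S.m i) =ᶠ[nhds s] S.F := by
    have : ∀ᶠ z in nhds s, ∀ i, z ≠ S.pole i := by
      refine eventually_all.2 fun i => ?_
      exact isOpen_ne.mem_nhds (hc.ne_pole hs i)
    filter_upwards [this] with z hz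
    rw [S.hGF z hz, mul_div_cancel_left₀]
    exact Finset.prod_ne_zero_iff.2 fun i _ => pow_ne_zero _ (sub_ne_zero.2 (hz i))
  refine AnalyticAt.congr (AnalyticAt.div (S.hGdiff.analyticAt s) ?_ ?_) h
  · exact Differentiable.analyticAt (by fun_prop) s
  · exact Finset.prod_ne_zero_iff.2 fun i _ => pow_ne_zero _ (sub_ne_zero.2 (hc.ne_pole hs i))

end FarRight

lemma norm_term_le {x : ℂ} {n : ℕ} (hn : 1 ≤ n) {s : ℂ} {c : ℝ} (hs : c ≤ s.re) :
    ‖x * (n : ℂ) ^ (-s)‖ ≤ ‖x * (n : ℂ) ^ (-(c : ℂ))‖ := by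
  have hn0 : 0 < n := hn
  rw [norm_mul, norm_mul, norm_natCast_cpow_of_pos hn0, norm_natCast_cpow_of_pos hn0]
  refine mul_le_mul_of_nonneg_left (Real.rpow_le_rpow_of_exponent_le (by exact_mod_cast hn) ?_)
    (norm_nonneg _)
  simpa using hs

variable (S) in
lemma exists_norm_F_le {c : ℝ} (hc : σ0 < c) : ∃ C : ℝ, ∀ s : ℂ, c ≤ s.re → ‖S.F s‖ ≤ C := by
  have hsum := S.hDirAbs c (by simpa using hc)
  refine ⟨∑' n : ℕ, ‖S.a (n + 1) * ((n + 1 : ℕ) : ℂ) ^ (-(c : ℂ))‖, fun s hs => ?_⟩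
  have h := (S.hDir s (hc.trans_le hs)).tsum_eq
  rw [← h]
  exact tsum_of_norm_bounded hsum.hasSum fun n => norm_term_le (by lia) hs

variable (S) in
lemma exists_norm_logDeriv_F_le {c : ℝ} (hc : σ0 < c) :
    ∃ C : ℝ, ∀ s : ℂ, c ≤ s.re → ‖logDeriv S.F s‖ ≤ C := by
  have hsum := S.hEulerAbs c (by simpa using hc)
  refine ⟨∑' n : ℕ, ‖S.c (n + 2) * ((n + 2 : ℕ) : ℂ) ^ (-(c : ℂ))‖, fun s hs => ?_⟩
  have h := (S.hEuler s (hc.trans_le hs)).tsum_eq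
  rw [logDeriv_apply, ← norm_neg, ← h]
  exact tsum_of_norm_bounded hsum.hasSum fun n => norm_term_le (by lia) hs

lemma FarRight.F_ne_zero {c : ℝ} (hc : S.FarRight c) (h0 : S.xi 0 ≠ 0) {s : ℂ} (hs : c < s.re) :
    S.F s ≠ 0 := by
  intro hFs
  have hnhds : {z : ℂ | c < z.re} ∈ nhds s :=
    (isOpen_lt continuous_const continuous_re).mem_nhds hs
  have hF := hc.analyticAt_F hs.le
  have hord : analyticOrderAt S.F s ≠ ⊤ := by
    intro h
    rw [analyticOrderAt_eq_top] at h
    refine analyticOrderAt_ne_top_of_entire S.hxiDiff h0 s ?_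
    rw [analyticOrderAt_eq_top]
    filter_upwards [h, hnhds] with z hz hzc
    rw [hc.xi_eq (le_of_lt hzc), hz, zero_mul]
  obtain ⟨g, hg, hgs, hFg⟩ := hF.analyticOrderAt_ne_top.1 hord
  set n := analyticOrderNatAt S.F s with hn
  have hn0 : n ≠ 0 := by
    intro h
    have := hFg.self_of_nhds
    rw [h, hFs] at this
    simp at this
    exact hgs this.symm
  obtain ⟨C, hC⟩ := S.exists_norm_logDeriv_F_le hc.lt
  have hgne : ∀ᶠ z in nhds s, g z ≠ 0 := hg.continuousAt.eventually_ne hgs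
  have hlg : ContinuousAt (logDeriv g) s :=
    (hg.deriv.continuousAt).div hg.continuousAt hgs
  have hev : ∀ᶠ z in nhdsWithin s {s}ᶜ,
      (n : ℂ) = (z - s) * logDeriv S.F z - (z - s) * logDeriv g z := by
    filter_upwards [nhdsWithin_le_nhds hFg.eventually_nhds, nhdsWithin_le_nhds hgne,
      nhdsWithin_le_nhds hg.eventually_analyticAt, self_mem_nhdsWithin] with z hz hgz hga hzs
    have hzs' : z - s ≠ 0 := sub_ne_zero.2 hzs
    have e : logDeriv S.F z = n * (1 / (z - s)) + logDeriv g z := by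
      have h1 : S.F =ᶠ[nhds z] fun z => (z - s) ^ n * g z := hz
      rw [logDeriv_apply, h1.deriv_eq, h1.eq_of_nhds, ← logDeriv_apply (fun z => (z - s) ^ n * g z),
        logDeriv_mul (f := fun z => (z - s) ^ n) z (pow_ne_zero n hzs') hgz (by fun_prop)
          hga.differentiableAt,
        logDeriv_fun_pow (by fun_prop)]
      congr 2
      simp [logDeriv_apply]
    rw [e]
    field_simp
    ring
  have hsub : Tendsto (fun z : ℂ => z - s) (nhdsWithin s {s}ᶜ) (nhds 0) := by
    have : Tendsto (fun z : ℂ => z - s) (nhds s) (nhds (s - s)) :=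
      (continuous_id.sub continuous_const).tendsto s
    rw [sub_self] at this
    exact this.mono_left nhdsWithin_le_nhds
  have h1 : Tendsto (fun z => (z - s) * logDeriv S.F z) (nhdsWithin s {s}ᶜ) (nhds 0) := by
    refine hsub.zero_mul_isBoundedUnder_le ⟨C, ?_⟩
    rw [eventually_map]
    filter_upwards [nhdsWithin_le_nhds hnhds] with z hz
    exact hC z (le_of_lt hz)
  have h2 : Tendsto (fun z => (z - s) * logDeriv g z) (nhdsWithin s {s}ᶜ) (nhds 0) := by
    have := hsub.mul (hlg.tendsto.mono_left (nhdsWithin_le_nhds (s := {s}ᶜ)))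
    rwa [zero_mul] at this
  have h3 := h1.sub h2
  rw [sub_zero] at h3
  have h4 := tendsto_nhds_unique (h3.congr' (hev.mono fun z hz => hz.symm)) tendsto_const_nhds
  exact hn0 (by exact_mod_cast h4.symm)

lemma FarRight.xi_ne_zero {c : ℝ} (hc : S.FarRight c) (h0 : S.xi 0 ≠ 0) {s : ℂ} (hs : c < s.re) :
    S.xi s ≠ 0 := by
  rw [hc.xi_eq hs.le]
  exact mul_ne_zero (hc.F_ne_zero h0 hs) (hc.archFactor_ne_zero hs.le)

variable (S) in
lemma xi_eq_zero_iff (s : ℂ) : S.xi s = 0 ↔ S.xi ((σ1 : ℂ) - (starRingEnd ℂ) s) = 0 := by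
  have hω : S.ω ≠ 0 := norm_pos_iff.1 (by rw [S.hω]; exact one_pos)
  rw [S.hFE s]
  simp [hω]

variable (S) in
lemma norm_xi_eq (s : ℂ) : ‖S.xi s‖ = ‖S.xi ((σ1 : ℂ) - (starRingEnd ℂ) s)‖ := by
  rw [S.hFE s, norm_mul, S.hω, one_mul, RCLike.norm_conj]

/-- The zeros of `ξ` lie in a vertical strip. -/
lemma FarRight.re_mem {c : ℝ} (hc : S.FarRight c) (h0 : S.xi 0 ≠ 0) {s : ℂ} (hs : S.xi s = 0) :
    σ1 - c ≤ s.re ∧ s.re ≤ c := by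
  constructor
  · by_contra! h
    refine hc.xi_ne_zero h0 (s := (σ1 : ℂ) - (starRingEnd ℂ) s) ?_ ((S.xi_eq_zero_iff s).1 hs)
    simp
    linarith
  · by_contra! h
    exact hc.xi_ne_zero h0 h hs

lemma polyGrowthOn_reflFactor (H : Set ℂ) :
    PolyGrowthOn H fun s => ∏ i : Fin S.N, (if 2 * S.M + S.dlt ≤ (i : ℕ)
      then ((σ1 : ℂ) - s - (starRingEnd ℂ) (S.pole i)) ^ S.m i else 1) := by
  refine PolyGrowthOn.prod _ fun i => ?_
  split_ifs
  · refine PolyGrowthOn.pow ?_ _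
    have := PolyGrowthOn.linear (H := H) (-1) ((σ1 : ℂ) - (starRingEnd ℂ) (S.pole i))
    refine (funext fun s => ?_ : (fun s => -1 * s + ((σ1 : ℂ) - (starRingEnd ℂ) (S.pole i))) =
      fun s => (σ1 : ℂ) - s - (starRingEnd ℂ) (S.pole i)) ▸ this
    ring
  · exact PolyGrowthOn.of_bounded (C := 1) (by simp)

lemma polyGrowthOn_poleFactor (H : Set ℂ) : PolyGrowthOn H S.poleFactor := by
  refine PolyGrowthOn.mul (PolyGrowthOn.prod _ fun i => PolyGrowthOn.pow ?_ _)
    (polyGrowthOn_reflFactor H)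
  simpa [sub_eq_add_neg] using PolyGrowthOn.linear (H := H) 1 (-S.pole i)

lemma norm_Q_cpow (s : ℂ) : ‖(S.Q : ℂ) ^ s‖ = S.Q ^ s.re := norm_cpow_eq_rpow_re_of_pos S.hQ s

lemma FarRight.subGaussianGrowthOn_xi {c : ℝ} (hc : S.FarRight c) :
    SubGaussianGrowthOn {s | c ≤ s.re} S.xi := by
  obtain ⟨C, hC⟩ := S.exists_norm_F_le hc.lt
  have hF : PolyGrowthOn {s | c ≤ s.re} S.F := PolyGrowthOn.of_bounded fun s hs => hC s hs
  have hQ : SubGaussianGrowthOn {s | c ≤ s.re} fun s => (S.Q : ℂ) ^ s := by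
    refine SubGaussianGrowthOn.of_exp_linear (B := |Real.log S.Q|) fun s _ => ?_
    rw [norm_Q_cpow, Real.rpow_def_of_pos S.hQ]
    refine Real.exp_le_exp.2 ((le_abs_self _).trans ?_)
    rw [abs_mul]
    gcongr
    linarith [Complex.abs_re_le_norm s]
  have hG : SubGaussianGrowthOn {s | c ≤ s.re} fun s =>
      ∏ j, Gamma ((S.lam j : ℂ) * s + S.mu j) :=
    SubGaussianGrowthOn.prod _ fun j => subGaussianGrowthOn_Gamma (S.hlam j).le
      fun s hs => hc.two_le_re hs j
  obtain ⟨B, hB, h⟩ := hF.subGaussianGrowthOn.mul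
    ((hQ.mul hG).mul (polyGrowthOn_poleFactor {s | c ≤ s.re}).subGaussianGrowthOn)
  refine ⟨B, hB, fun s hs => ?_⟩
  rw [hc.xi_eq hs]
  exact h s hs

lemma FarRight.polyGrowthOn_line {c : ℝ} (hc : S.FarRight c) :
    PolyGrowthOn {s | s.re = c} S.xi := by
  obtain ⟨C, hC⟩ := S.exists_norm_F_le hc.lt
  have hF : PolyGrowthOn {s | s.re = c} S.F := PolyGrowthOn.of_bounded fun s hs => hC s hs.ge
  have hQ : PolyGrowthOn {s | s.re = c} fun s => (S.Q : ℂ) ^ s :=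
    PolyGrowthOn.of_bounded (C := S.Q ^ c) fun s (hs : s.re = c) => by rw [norm_Q_cpow, hs]
  have hG : PolyGrowthOn {s | s.re = c} fun s =>
      ∏ j, Gamma ((S.lam j : ℂ) * s + S.mu j) := by
    refine PolyGrowthOn.prod _ fun j => PolyGrowthOn.of_bounded
      (C := Real.Gamma (S.lam j * c + (S.mu j).re)) fun s (hs : s.re = c) => ?_
    have := hc.two_le_re hs.ge j
    refine (norm_Gamma_le (by linarith)).trans_eq ?_
    simp [hs]
  obtain ⟨B, k, hB, h⟩ := hF.mul ((hQ.mul hG).mul (polyGrowthOn_poleFactor _))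
  refine ⟨B, k, hB, fun s hs => ?_⟩
  rw [hc.xi_eq (le_of_eq (Eq.symm hs))]
  exact h s hs

lemma polyGrowthOn_archFactor_strip {a b Y : ℝ}
    (hY : ∀ j, 1 + |(S.mu j).im| ≤ S.lam j * Y) :
    PolyGrowthOn {s | a ≤ s.re ∧ s.re ≤ b ∧ Y ≤ |s.im|} fun s =>
      (S.Q : ℂ) ^ s * ∏ j, Gamma ((S.lam j : ℂ) * s + S.mu j) := by
  refine PolyGrowthOn.mul ?_ (PolyGrowthOn.prod _ fun j => ?_)
  · refine PolyGrowthOn.of_bounded (C := Real.exp (|Real.log S.Q| * (|a| + |b|)))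
      fun s ⟨h1, h2, _⟩ => ?_
    rw [norm_Q_cpow, Real.rpow_def_of_pos S.hQ]
    refine Real.exp_le_exp.2 ((le_abs_self _).trans ?_)
    rw [abs_mul]
    refine mul_le_mul_of_nonneg_left ?_ (abs_nonneg _)
    rw [abs_le]
    constructor
    · linarith [neg_abs_le a, abs_nonneg b]
    · linarith [le_abs_self b, abs_nonneg a]
  · obtain ⟨n, hn⟩ := exists_nat_ge (2 - (S.lam j * a + (S.mu j).re))
    refine PolyGrowthOn.of_bounded (C := Real.Gamma (S.lam j * b + (S.mu j).re + n))
      fun s ⟨h1, h2, h3⟩ => ?_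
    have hl := S.hlam j
    refine norm_Gamma_le_of_one_le_abs_im n ?_ ?_ ?_
    · simp only [add_re, re_ofReal_mul]
      nlinarith
    · simp only [add_re, re_ofReal_mul]
      nlinarith
    · simp only [add_im, im_ofReal_mul]
      have e1 : S.lam j * Y ≤ |S.lam j * s.im| := by
        rw [abs_mul, abs_of_pos hl]
        gcongr
      have e2 := abs_sub_abs_le_abs_sub (S.lam j * s.im) (-(S.mu j).im)
      rw [abs_neg, sub_neg_eq_add] at e2
      linarith [hY j]

lemma FarRight.polyGrowthOn_strip {c : ℝ} (hc : S.FarRight c) :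
    PolyGrowthOn {s | σ1 - c ≤ s.re ∧ s.re ≤ c} S.xi := by
  have hright := hc.polyGrowthOn_line
  have hσ := S.hσ1pos
  have hleft : PolyGrowthOn {s | s.re = σ1 - c} S.xi := by
    obtain ⟨C, k, hC, h⟩ := hright
    refine ⟨C * (1 + σ1) ^ k, k, by positivity, fun s (hs : s.re = σ1 - c) => ?_⟩
    rw [norm_xi_eq, mul_assoc, ← mul_pow]
    refine (h _ (by simp [hs])).trans ?_
    have e : ‖(σ1 : ℂ) - (starRingEnd ℂ) s‖ ≤ σ1 + ‖s‖ := by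
      refine (norm_sub_le _ _).trans ?_
      rw [norm_real, Real.norm_of_nonneg hσ.le, RCLike.norm_conj]
    gcongr
    nlinarith [norm_nonneg s, mul_nonneg hσ.le (norm_nonneg s)]
  obtain ⟨Y, hY1, hY2, hY3⟩ : ∃ Y : ℝ, 1 ≤ Y ∧ (∀ i, |(S.pole i).im| < Y) ∧
      ∀ j, 1 + |(S.mu j).im| ≤ S.lam j * Y := by
    have h1 : ∀ᶠ Y : ℝ in atTop, ∀ i, |(S.pole i).im| < Y :=
      eventually_all.2 fun i => eventually_gt_atTop _
    have h2 : ∀ᶠ Y : ℝ in atTop, ∀ j, 1 + |(S.mu j).im| ≤ S.lam j * Y :=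
      eventually_all.2 fun j => (tendsto_id.const_mul_atTop (S.hlam j)).eventually_ge_atTop _
    exact ((eventually_ge_atTop 1).and (h1.and h2)).exists
  obtain ⟨C, k, hC, hA⟩ := (polyGrowthOn_archFactor_strip (a := σ1 - c) (b := c) hY3).mul
    (polyGrowthOn_reflFactor (S := S) _)
  obtain ⟨c0, B0, hG⟩ := S.hGord
  set B : ℝ := max B0 1 with hB
  refine _root_.polyGrowthOn_strip S.hxiDiff (by linarith [hc.lt, S.hσ]) hleft hright
    (Y := Y) (D := |c0| * C) (E := 1 + k) (B := B) (by positivity) fun s hs1 hs2 hs3 => ?_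
  have hpole : ∀ i, s ≠ S.pole i := by
    rintro i rfl
    linarith [hY2 i]
  have hgam : ∀ (j : Fin S.r) (k : ℕ), (S.lam j : ℂ) * s + S.mu j ≠ -(k : ℂ) := by
    intro j k h
    have := congrArg Complex.im h
    simp only [add_im, im_ofReal_mul, neg_im, natCast_im, neg_zero] at this
    have e : |(S.mu j).im| = S.lam j * |s.im| := by
      conv_rhs => rw [← abs_of_pos (S.hlam j)]
      rw [← abs_mul, ← abs_neg]
      congr 1
      linarith
    have : S.lam j * Y ≤ S.lam j * |s.im| := by have := S.hlam j; gcongr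
    linarith [hY3 j]
  have hxi : S.xi s = S.G s * ((S.Q : ℂ) ^ s * (∏ j, Gamma ((S.lam j : ℂ) * s + S.mu j)) *
      ∏ i : Fin S.N, (if 2 * S.M + S.dlt ≤ (i : ℕ)
      then ((σ1 : ℂ) - s - (starRingEnd ℂ) (S.pole i)) ^ S.m i else 1)) := by
    rw [S.hxiEq s hpole hgam, S.hGF s hpole]
    ring
  have hs0 : 1 ≤ ‖s‖ := hY1.trans (hs3.trans (Complex.abs_im_le_norm s))
  have hpow : ‖s‖ ^ B0 ≤ (1 + ‖s‖) ^ B := by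
    calc ‖s‖ ^ B0 ≤ ‖s‖ ^ B := Real.rpow_le_rpow_of_exponent_le hs0 (le_max_left _ _)
      _ ≤ (1 + ‖s‖) ^ B := by gcongr; linarith
  have hlin : (1 + ‖s‖) ≤ (1 + ‖s‖) ^ B := by
    conv_lhs => rw [← Real.rpow_one (1 + ‖s‖)]
    exact Real.rpow_le_rpow_of_exponent_le (by linarith) (le_max_right _ _)
  have hk : (1 + ‖s‖) ^ k ≤ Real.exp (k * (1 + ‖s‖) ^ B) := by
    rw [Real.exp_nat_mul]
    gcongr
    linarith [Real.add_one_le_exp ((1 + ‖s‖) ^ B)]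
  rw [hxi, norm_mul, add_mul, one_mul, Real.exp_add]
  have h1 : ‖S.G s‖ ≤ |c0| * Real.exp ((1 + ‖s‖) ^ B) := by
    refine (hG s).trans ?_
    calc c0 * Real.exp (‖s‖ ^ B0) ≤ |c0| * Real.exp (‖s‖ ^ B0) := by gcongr; exact le_abs_self _
      _ ≤ _ := by gcongr
  have h2 := hA s ⟨hs1, hs2, hs3⟩
  calc _ ≤ (|c0| * Real.exp ((1 + ‖s‖) ^ B)) * (C * (1 + ‖s‖) ^ k) := by gcongr
    _ ≤ (|c0| * Real.exp ((1 + ‖s‖) ^ B)) * (C * Real.exp (k * (1 + ‖s‖) ^ B)) := by gcongr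
    _ = _ := by ring

variable (S) in
/-- The completed function `ξ` has growth of order at most `3 / 2`. -/
lemma exists_norm_xi_le :
    ∃ B : ℝ, ∀ s : ℂ, ‖S.xi s‖ ≤ Real.exp (B * (1 + ‖s‖) ^ (3 / 2 : ℝ)) := by
  obtain ⟨c, hc⟩ := S.exists_farRight
  obtain ⟨B1, hB1, h1⟩ := hc.subGaussianGrowthOn_xi
  obtain ⟨B2, hB2, h2⟩ := hc.polyGrowthOn_strip.subGaussianGrowthOn
  have hσ := S.hσ1pos
  refine ⟨B1 * (1 + σ1) ^ (3 / 2 : ℝ) + B2, fun s => ?_⟩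
  have hp : 0 ≤ (1 + ‖s‖) ^ (3 / 2 : ℝ) := by positivity
  have hq : 1 ≤ (1 + σ1) ^ (3 / 2 : ℝ) := Real.one_le_rpow (by linarith) (by norm_num)
  rcases le_total c s.re with hs | hs
  · refine (h1 s hs).trans (Real.exp_le_exp.2 (mul_le_mul_of_nonneg_right ?_ hp))
    nlinarith
  · rcases le_total (σ1 - c) s.re with hs' | hs'
    · refine (h2 s ⟨hs', hs⟩).trans (Real.exp_le_exp.2 (mul_le_mul_of_nonneg_right ?_ hp))
      nlinarith
    · rw [norm_xi_eq]
      refine (h1 _ ?_).trans (Real.exp_le_exp.2 ?_)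
      · simp
        linarith
      · have e : ‖(σ1 : ℂ) - (starRingEnd ℂ) s‖ ≤ σ1 + ‖s‖ := by
          refine (norm_sub_le _ _).trans ?_
          rw [norm_real, Real.norm_of_nonneg hσ.le, RCLike.norm_conj]
        have e2 : (1 + ‖(σ1 : ℂ) - (starRingEnd ℂ) s‖) ^ (3 / 2 : ℝ) ≤
            (1 + σ1) ^ (3 / 2 : ℝ) * (1 + ‖s‖) ^ (3 / 2 : ℝ) := by
          rw [← Real.mul_rpow (by positivity) (by positivity)]
          refine Real.rpow_le_rpow (by positivity) ?_ (by norm_num)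
          nlinarith [norm_nonneg s, mul_nonneg hσ.le (norm_nonneg s)]
        calc _ ≤ B1 * ((1 + σ1) ^ (3 / 2 : ℝ) * (1 + ‖s‖) ^ (3 / 2 : ℝ)) := by gcongr
          _ ≤ _ := by
            have := mul_nonneg hB2 hp
            rw [add_mul]
            linarith

end SSF

/-- The odd kernel `t / (1 + t ^ 2)`. -/
def oddKernel (t : ℝ) : ℝ := t / (1 + t ^ 2)

lemma continuous_oddKernel : Continuous oddKernel :=
  continuous_id.div (by fun_prop) fun t => by positivity

lemma oddKernel_neg (t : ℝ) : oddKernel (-t) = -oddKernel t := by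
  simp [oddKernel, neg_div]

lemma abs_oddKernel_le (t : ℝ) : |oddKernel t| ≤ 2 / (1 + |t|) := by
  rw [oddKernel, abs_div, abs_of_pos (by positivity : 0 < 1 + t ^ 2),
    div_le_div_iff₀ (by positivity) (by positivity), ← sq_abs t]
  nlinarith [abs_nonneg t, sq_nonneg (|t| - 1)]

lemma hasDerivAt_oddKernel (t : ℝ) :
    HasDerivAt oddKernel ((1 - t ^ 2) / (1 + t ^ 2) ^ 2) t := by
  have h : HasDerivAt (fun t : ℝ => 1 + t ^ 2) (2 * t) t := by
    simpa using (hasDerivAt_pow 2 t).const_add 1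
  refine ((hasDerivAt_id t).div h (by positivity)).congr_deriv ?_
  simp only [id]
  congr 1
  ring

/-- Continuous functions of growth at most `|t| ^ (1 / 4)` for which the symmetric improper
integral against `t / (1 + t ^ 2)` converges. -/
structure SymmetricallyIntegrable (u : ℝ → ℝ) : Prop where
  cont : Continuous u
  growth : ∃ C : ℝ, 0 ≤ C ∧ ∀ t, |u t| ≤ C * (1 + |t|) ^ (1 / 4 : ℝ)
  conv : ∃ L : ℝ, Tendsto (fun T : ℝ => ∫ t in (-T)..T, u t * oddKernel t) atTop (nhds L)

namespace SymmetricallyIntegrable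

variable {u v : ℝ → ℝ}

lemma intervalIntegrable (h : Continuous u) (a b : ℝ) :
    IntervalIntegrable (fun t => u t * oddKernel t) volume a b :=
  (h.mul continuous_oddKernel).intervalIntegrable a b

lemma add (hu : SymmetricallyIntegrable u) (hv : SymmetricallyIntegrable v) :
    SymmetricallyIntegrable fun t => u t + v t := by
  obtain ⟨C, hC, h1⟩ := hu.growth
  obtain ⟨D, hD, h2⟩ := hv.growth
  obtain ⟨L, hL⟩ := hu.conv
  obtain ⟨L', hL'⟩ := hv.conv
  refine ⟨hu.cont.add hv.cont, ⟨C + D, by positivity, fun t => ?_⟩, L + L', ?_⟩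
  · rw [add_mul]
    exact (abs_add_le _ _).trans (add_le_add (h1 t) (h2 t))
  · refine (hL.add hL').congr fun T => ?_
    rw [← intervalIntegral.integral_add (intervalIntegrable hu.cont _ _)
      (intervalIntegrable hv.cont _ _)]
    simp only [add_mul]

lemma const_mul (hu : SymmetricallyIntegrable u) (a : ℝ) :
    SymmetricallyIntegrable fun t => a * u t := by
  obtain ⟨C, hC, h1⟩ := hu.growth
  obtain ⟨L, hL⟩ := hu.conv
  refine ⟨continuous_const.mul hu.cont, ⟨|a| * C, by positivity, fun t => ?_⟩, a * L, ?_⟩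
  · rw [abs_mul, mul_assoc]
    exact mul_le_mul_of_nonneg_left (h1 t) (abs_nonneg a)
  · refine (hL.const_mul a).congr fun T => ?_
    rw [← intervalIntegral.integral_const_mul]
    simp only [mul_assoc]

lemma of_even (hc : Continuous u) (hu : ∀ t, u (-t) = u t) {C : ℝ}
    (hC : ∀ t, |u t| ≤ C * (1 + |t|) ^ (1 / 4 : ℝ)) : SymmetricallyIntegrable u := by
  refine ⟨hc, ⟨C, ?_, hC⟩, 0, ?_⟩
  · have := (abs_nonneg _).trans (hC 0)
    simpa using this
  · refine tendsto_const_nhds.congr fun T => ?_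
    have h := intervalIntegral.integral_comp_neg (a := -T) (b := T)
      (fun t => u t * oddKernel t)
    simp only [hu, oddKernel_neg, neg_neg, mul_neg, intervalIntegral.integral_neg] at h
    linarith

lemma const (a : ℝ) : SymmetricallyIntegrable fun _ => a :=
  of_even (C := |a|) continuous_const (fun _ => rfl) fun t => by
    have : 1 ≤ (1 + |t|) ^ (1 / 4 : ℝ) :=
      Real.one_le_rpow (by linarith [abs_nonneg t]) (by norm_num)
    nlinarith [abs_nonneg a]

lemma sum {ι : Type*} {u : ι → ℝ → ℝ} (s : Finset ι) (h : ∀ i, SymmetricallyIntegrable (u i)) :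
    SymmetricallyIntegrable fun t => ∑ i ∈ s, u i t := by
  classical
  induction s using Finset.induction_on with
  | empty => simpa using const 0
  | insert i s hi ih => simpa [Finset.sum_insert hi] using (h i).add ih

lemma integrable_one_add_abs_rpow {p : ℝ} (hp : p < -1) :
    Integrable fun t : ℝ => (1 + |t|) ^ p := by
  have := integrable_one_add_norm (E := ℝ) (μ := volume) (r := -p) (by simp; linarith)
  simpa using this

lemma of_decay (hc : Continuous u) {C : ℝ} (hC : ∀ t, |u t| ≤ C * (1 + |t|) ^ (-(1 / 2) : ℝ)) :
    SymmetricallyIntegrable u := by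
  have hC0 : 0 ≤ C := by
    have := (abs_nonneg _).trans (hC 0)
    simpa using this
  refine ⟨hc, ⟨C, hC0, fun t => (hC t).trans ?_⟩, ∫ t, u t * oddKernel t, ?_⟩
  · refine mul_le_mul_of_nonneg_left ?_ hC0
    exact Real.rpow_le_rpow_of_exponent_le (by linarith [abs_nonneg t]) (by norm_num)
  · refine intervalIntegral_tendsto_integral ?_ tendsto_neg_atTop_atBot tendsto_id
    refine ((integrable_one_add_abs_rpow (p := -(3 / 2)) (by norm_num)).const_mul (C * 2)).mono'
      (hc.mul continuous_oddKernel).aestronglyMeasurable (ae_of_all _ fun t => ?_)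
    have h1 : 0 < 1 + |t| := by positivity
    rw [norm_mul, Real.norm_eq_abs, Real.norm_eq_abs]
    calc |u t| * |oddKernel t| ≤ (C * (1 + |t|) ^ (-(1 / 2) : ℝ)) * (2 / (1 + |t|)) := by
          gcongr
          · exact hC t
          · exact abs_oddKernel_le t
      _ = C * 2 * ((1 + |t|) ^ (-(1 / 2) : ℝ) * (1 + |t|) ^ (-1 : ℝ)) := by
          rw [Real.rpow_neg_one]; ring
      _ = C * 2 * (1 + |t|) ^ (-(3 / 2) : ℝ) := by
          rw [← Real.rpow_add h1]; norm_num

lemma of_bounded_primitive (hc : Continuous u) {U : ℝ → ℝ} (hU : ∀ t, HasDerivAt U (u t) t)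
    {C D : ℝ} (hC : ∀ t, |U t| ≤ C) (hD : ∀ t, |u t| ≤ D) : SymmetricallyIntegrable u := by
  have hD0 : 0 ≤ D := (abs_nonneg _).trans (hD 0)
  have hC0 : 0 ≤ C := (abs_nonneg _).trans (hC 0)
  have hUc : Continuous U := continuous_iff_continuousAt.2 fun t => (hU t).continuousAt
  have hg' : Continuous fun t : ℝ => (1 - t ^ 2) / (1 + t ^ 2) ^ 2 :=
    Continuous.div (by fun_prop) (by fun_prop) fun t => by positivity
  refine ⟨hc, ⟨D, hD0, fun t => (hD t).trans ?_⟩,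
    0 - 0 - ∫ t, (1 - t ^ 2) / (1 + t ^ 2) ^ 2 * U t, ?_⟩
  · exact le_mul_of_one_le_right hD0
      (Real.one_le_rpow (by linarith [abs_nonneg t]) (by norm_num))
  · have hparts : ∀ T : ℝ, ∫ t in (-T)..T, u t * oddKernel t =
        oddKernel T * U T - oddKernel (-T) * U (-T) -
          ∫ t in (-T)..T, (1 - t ^ 2) / (1 + t ^ 2) ^ 2 * U t := by
      intro T
      rw [← intervalIntegral.integral_mul_deriv_eq_deriv_mul
        (fun t _ => hasDerivAt_oddKernel t) (fun t _ => hU t)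
        (hg'.intervalIntegrable _ _) (hc.intervalIntegrable _ _)]
      simp only [mul_comm]
    have hbd : ∀ {s : ℝ → ℝ}, (∀ T, |s T| = |T|) →
        Tendsto (fun T : ℝ => oddKernel (s T) * U (s T)) atTop (nhds 0) := by
      intro s hs
      have h1 : Tendsto (fun T : ℝ => 2 * C / (1 + |T|)) atTop (nhds 0) :=
        tendsto_const_nhds.div_atTop
          (tendsto_atTop_add_const_left _ _ tendsto_abs_atTop_atTop)
      refine squeeze_zero_norm (fun T => ?_) h1
      rw [norm_mul, Real.norm_eq_abs, Real.norm_eq_abs]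
      calc _ ≤ 2 / (1 + |s T|) * C := by
            gcongr
            · exact abs_oddKernel_le _
            · exact hC _
        _ = _ := by rw [hs]; ring
    have hinteg : Integrable fun t : ℝ => (1 - t ^ 2) / (1 + t ^ 2) ^ 2 * U t := by
      refine (integrable_inv_one_add_sq.mul_const C).mono' (hg'.mul hUc).aestronglyMeasurable
        (ae_of_all _ fun t => ?_)
      rw [norm_mul, Real.norm_eq_abs, Real.norm_eq_abs]
      refine mul_le_mul ?_ (hC t) (abs_nonneg _) (by positivity)
      rw [abs_div, abs_of_pos (by positivity : (0 : ℝ) < (1 + t ^ 2) ^ 2), inv_eq_one_div,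
        div_le_div_iff₀ (by positivity) (by positivity)]
      have : |1 - t ^ 2| ≤ 1 + t ^ 2 := by
        rw [abs_le]; constructor <;> nlinarith [sq_nonneg t]
      nlinarith [sq_nonneg t]
    have h3 := intervalIntegral_tendsto_integral hinteg tendsto_neg_atTop_atBot tendsto_id
    have h4 := ((hbd (s := fun T => T) fun _ => rfl).sub
      (hbd (s := fun T => -T) fun T => abs_neg T)).sub h3
    exact h4.congr fun T => (hparts T).symm

lemma digamma_line {l x v : ℝ} (hl : 0 < l) (hx : 1 ≤ x) :
    SymmetricallyIntegrable fun t : ℝ => (digamma (x + (l * t + v) * I)).re := by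
  obtain ⟨C, hC0, hC⟩ := exists_norm_digamma_sub_le
  have hre : ∀ t v : ℝ, ((x : ℂ) + (l * t + v) * I).re = x := by intro t v; simp
  have him : ∀ t v : ℝ, ((x : ℂ) + (l * t + v) * I).im = l * t + v := by intro t v; simp
  have hcont : ∀ v : ℝ, Continuous fun t : ℝ => (digamma (x + (l * t + v) * I)).re := by
    intro v
    refine continuous_re.comp (continuous_iff_continuousAt.2 fun t => ?_)
    have hpos : 0 < ((x : ℂ) + (l * t + v) * I).re := by rw [hre]; linarith
    have hopen : {z : ℂ | 0 < z.re} ∈ nhds ((x : ℂ) + (l * t + v) * I) :=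
      (isOpen_lt continuous_const continuous_re).mem_nhds hpos
    have hd : DifferentiableOn ℂ Gamma {z : ℂ | 0 < z.re} := fun z hz =>
      (differentiableAt_Gamma _ fun m h => by
        have hz' : 0 < z.re := hz
        rw [h] at hz'
        simp at hz'
        exact absurd hz' (not_lt.2 (Nat.cast_nonneg m))).differentiableWithinAt
    have ha := hd.analyticAt hopen
    have : ContinuousAt digamma ((x : ℂ) + (l * t + v) * I) := by
      rw [digamma_def]
      exact ha.deriv.continuousAt.div ha.continuousAt (Gamma_ne_zero_of_re_pos hpos)
    exact ContinuousAt.comp (f := fun t : ℝ => (x : ℂ) + (l * t + v) * I) this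
      (Continuous.continuousAt (by fun_prop))
  have heven : SymmetricallyIntegrable fun t : ℝ => (digamma (x + (l * t + (0 : ℝ)) * I)).re := by
    refine of_even (hcont 0) (fun t => ?_)
      (C := ‖digamma x‖ + C * (1 + l) ^ (1 / 4 : ℝ)) fun t => ?_
    · have : (x : ℂ) + (l * (-t : ℝ) + (0 : ℝ)) * I =
          (starRingEnd ℂ) ((x : ℂ) + (l * t + (0 : ℝ)) * I) := by
        simp
      rw [this, digamma_conj (by rw [hre]; linarith), conj_re]
    · have h1 := hC (x + (l * t + (0 : ℝ)) * I) x (by rw [hre]; exact hx) (by simpa using hx)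
      have e1 : ‖(x : ℂ) + (l * t + (0 : ℝ)) * I - x‖ = |l * t| := by
        rw [add_sub_cancel_left, norm_mul, norm_I, mul_one, ← ofReal_mul, ← ofReal_add, norm_real]
        simp
      rw [e1, him, add_zero] at h1
      have hp : 0 < 1 + |l * t| := by positivity
      have h2 : |l * t| * (1 + |l * t|) ^ (-(3 / 4) : ℝ) ≤ (1 + |l * t|) ^ (1 / 4 : ℝ) := by
        calc _ ≤ (1 + |l * t|) * (1 + |l * t|) ^ (-(3 / 4) : ℝ) := by gcongr; linarith
          _ = _ := by
            rw [mul_comm, ← Real.rpow_add_one hp.ne']; norm_num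
      have h3 : (1 + |l * t|) ^ (1 / 4 : ℝ) ≤ (1 + l) ^ (1 / 4 : ℝ) * (1 + |t|) ^ (1 / 4 : ℝ) := by
        rw [← Real.mul_rpow (by positivity) (by positivity)]
        refine Real.rpow_le_rpow hp.le ?_ (by norm_num)
        rw [abs_mul, abs_of_pos hl]
        nlinarith [abs_nonneg t]
      have h4 : 1 ≤ (1 + |t|) ^ (1 / 4 : ℝ) :=
        Real.one_le_rpow (by linarith [abs_nonneg t]) (by norm_num)
      have h5 := norm_le_norm_add_norm_sub' (digamma (x + (l * t + (0 : ℝ)) * I)) (digamma x)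
      refine (Complex.abs_re_le_norm _).trans (h5.trans ?_)
      rw [add_mul _ _ ((1 + |t|) ^ (1 / 4 : ℝ))]
      refine add_le_add (le_mul_of_one_le_right (norm_nonneg (digamma (x : ℂ))) h4) (h1.trans ?_)
      rw [mul_assoc C, mul_assoc C]
      exact mul_le_mul_of_nonneg_left (h2.trans h3) hC0
  have hdiff : SymmetricallyIntegrable fun t : ℝ => (digamma (x + (l * t + v) * I)).re -
      (digamma (x + (l * t + (0 : ℝ)) * I)).re := by
    refine of_decay ((hcont v).sub (hcont 0))
      (C := C * |v| * (min 1 l) ^ (-(3 / 4) : ℝ)) fun t => ?_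
    have h1 := hC (x + (l * t + (0 : ℝ)) * I) (x + (l * t + v) * I) (by rw [hre]; exact hx)
      (by rw [hre]; exact hx)
    have e1 : ‖(x : ℂ) + (l * t + (0 : ℝ)) * I - (x + (l * t + v) * I)‖ = |v| := by
      have : (x : ℂ) + (l * t + (0 : ℝ)) * I - (x + (l * t + v) * I) = ((-v : ℝ) : ℂ) * I := by
        push_cast; ring
      rw [this, norm_mul, norm_I, mul_one, norm_real, Real.norm_eq_abs, abs_neg]
    rw [e1, him, add_zero, norm_sub_rev] at h1
    rw [← sub_re]
    refine (Complex.abs_re_le_norm _).trans (h1.trans ?_)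
    rw [mul_assoc (C * |v|)]
    refine mul_le_mul_of_nonneg_left ?_ (by positivity)
    have hmin : 0 < min 1 l := lt_min one_pos hl
    have h1t : 1 ≤ 1 + |t| := by linarith [abs_nonneg t]
    have h2 : min 1 l * (1 + |t|) ≤ 1 + |l * t| := by
      rw [abs_mul, abs_of_pos hl, mul_add, mul_one]
      have := min_le_left 1 l
      have := mul_le_mul_of_nonneg_right (min_le_right 1 l) (abs_nonneg t)
      linarith
    calc (1 + |l * t|) ^ (-(3 / 4) : ℝ) ≤ (min 1 l * (1 + |t|)) ^ (-(3 / 4) : ℝ) :=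
          Real.rpow_le_rpow_of_nonpos (by positivity) h2 (by norm_num)
      _ = (min 1 l) ^ (-(3 / 4) : ℝ) * (1 + |t|) ^ (-(3 / 4) : ℝ) :=
          Real.mul_rpow hmin.le (by positivity)
      _ ≤ _ := by
          refine mul_le_mul_of_nonneg_left ?_ (by positivity)
          exact Real.rpow_le_rpow_of_exponent_le h1t (by norm_num)
  simpa using heven.add hdiff

lemma pole_line {c : ℝ} {p : ℂ} (hp : p.re < c) :
    SymmetricallyIntegrable fun t : ℝ => (1 / ((c : ℂ) + t * I - p)).re := by
  have hd : 0 < c - p.re := by linarith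
  have hre : ∀ t : ℝ, ((c : ℂ) + t * I - p).re = c - p.re := by intro t; simp
  have hne : ∀ t : ℝ, (c : ℂ) + t * I - p ≠ 0 := by
    intro t h
    have := hre t
    rw [h] at this
    simp at this
    linarith
  set K : ℝ := 1 + (1 + |p.im|) / (c - p.re) with hK
  refine of_decay (C := K) ?_ fun t => ?_
  · exact continuous_re.comp (continuous_const.div (by fun_prop) hne)
  · have hN : 0 < ‖(c : ℂ) + t * I - p‖ := norm_pos_iff.2 (hne t)
    have h1 : c - p.re ≤ ‖(c : ℂ) + t * I - p‖ := by
      have := Complex.re_le_norm ((c : ℂ) + t * I - p)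
      rwa [hre] at this
    have h2 : |t - p.im| ≤ ‖(c : ℂ) + t * I - p‖ := by
      have := Complex.abs_im_le_norm ((c : ℂ) + t * I - p)
      simpa using this
    have h3 : |t| ≤ |t - p.im| + |p.im| := by
      have := abs_add_le (t - p.im) p.im
      rwa [sub_add_cancel] at this
    have h4 : 1 + |t| ≤ K * ‖(c : ℂ) + t * I - p‖ := by
      have : 1 + |p.im| ≤ (1 + |p.im|) / (c - p.re) * ‖(c : ℂ) + t * I - p‖ := by
        rw [div_mul_eq_mul_div, le_div_iff₀ hd]
        gcongr
      rw [hK, add_mul, one_mul]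
      linarith
    have h5 : 1 ≤ 1 + |t| := by linarith [abs_nonneg t]
    have hK0 : 0 ≤ K := by positivity
    refine (Complex.abs_re_le_norm _).trans ?_
    rw [norm_div, norm_one]
    calc 1 / ‖(c : ℂ) + t * I - p‖ ≤ K * (1 + |t|) ^ (-1 : ℝ) := by
          rw [Real.rpow_neg_one, ← div_eq_mul_inv, div_le_div_iff₀ hN (by positivity)]
          linarith
      _ ≤ _ := by
          refine mul_le_mul_of_nonneg_left ?_ hK0
          exact Real.rpow_le_rpow_of_exponent_le h5 (by norm_num)

end SymmetricallyIntegrable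

namespace SSF

variable {σ0 σ1 : ℝ} {S : SSF σ0 σ1}

lemma FarRight.logDeriv_F_line {c0 c : ℝ} (hc0 : S.FarRight c0) (h0 : S.xi 0 ≠ 0) (hc : c0 < c) :
    SymmetricallyIntegrable fun t : ℝ => (logDeriv S.F (c + t * I)).re := by
  obtain ⟨D, hD⟩ := S.exists_norm_logDeriv_F_le hc0.lt
  have hre : ∀ t : ℝ, ((c : ℂ) + t * I).re = c := by intro t; simp
  have hsum := S.hEulerAbs c (by simpa using hc0.lt.trans hc)
  have hcont : Continuous fun t : ℝ => (logDeriv S.F (c + t * I)).re := by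
    refine continuous_re.comp (continuous_iff_continuousAt.2 fun t => ?_)
    have ha := hc0.analyticAt_F (s := c + t * I) (by rw [hre]; exact hc.le)
    have : ContinuousAt (logDeriv S.F) (c + t * I) :=
      ha.deriv.continuousAt.div ha.continuousAt (hc0.F_ne_zero h0 (by rw [hre]; exact hc))
    exact ContinuousAt.comp (f := fun t : ℝ => (c : ℂ) + t * I) this
      (Continuous.continuousAt (by fun_prop))
  set f : ℕ → ℝ → ℂ := fun n t => S.c (n + 2) * ((n + 2 : ℕ) : ℂ) ^ (-((c : ℂ) + t * I)) with hf
  set U : ℕ → ℝ → ℂ := fun n t => f n t / (-(Complex.log (n + 2 : ℕ) * I)) with hU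
  have hlog : ∀ n : ℕ, Real.log 2 ≤ ‖-(Complex.log (n + 2 : ℕ) * I)‖ := by
    intro n
    rw [norm_neg, norm_mul, norm_I, mul_one, ← natCast_log, norm_real, Real.norm_eq_abs]
    refine le_trans ?_ (le_abs_self _)
    refine Real.log_le_log (by norm_num) ?_
    push_cast
    linarith [(Nat.cast_nonneg n : (0 : ℝ) ≤ n)]
  have hl2 : 0 < Real.log 2 := Real.log_pos (by norm_num)
  have hfn : ∀ n t, ‖f n t‖ ≤ ‖S.c (n + 2) * ((n + 2 : ℕ) : ℂ) ^ (-(c : ℂ))‖ := fun n t =>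
    norm_term_le (by lia) (by rw [hre])
  have hUn : ∀ n t, ‖U n t‖ ≤ ‖S.c (n + 2) * ((n + 2 : ℕ) : ℂ) ^ (-(c : ℂ))‖ / Real.log 2 := by
    intro n t
    rw [hU]
    simp only [norm_div]
    gcongr
    · exact hfn n t
    · exact hlog n
  have hUd : ∀ n t, HasDerivAt (U n) (f n t) t := by
    intro n t
    have hn0 : ((n + 2 : ℕ) : ℂ) ≠ 0 := by exact_mod_cast (by lia : n + 2 ≠ 0)
    have h1 : HasDerivAt (fun z : ℂ => -((c : ℂ) + z * I)) (-(1 * I)) (t : ℂ) :=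
      (((hasDerivAt_id (t : ℂ)).mul_const I).const_add (c : ℂ)).neg
    have h2 := ((h1.const_cpow (c := ((n + 2 : ℕ) : ℂ)) (Or.inl hn0)).const_mul
      (S.c (n + 2))).div_const (-(Complex.log (n + 2 : ℕ) * I))
    refine h2.comp_ofReal.congr_deriv ?_
    have hl0 : -(Complex.log (n + 2 : ℕ) * I) ≠ 0 := norm_pos_iff.1 (hl2.trans_le (hlog n))
    rw [div_eq_iff hl0, hf]
    ring
  have hder : ∀ t, HasDerivAt (fun t => ∑' n, U n t) (∑' n, f n t) t :=
    hasDerivAt_tsum hsum (fun n t => hUd n t) hfn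
      (Summable.of_norm_bounded (hsum.div_const _) fun n => hUn n 0)
  have hval : ∀ t : ℝ, (∑' n, f n t) = -logDeriv S.F (c + t * I) := by
    intro t
    rw [logDeriv_apply]
    exact (S.hEuler (c + t * I) (by rw [hre]; exact hc0.lt.trans hc)).tsum_eq
  refine SymmetricallyIntegrable.of_bounded_primitive hcont
    (U := fun t => -(∑' n, U n t).re) (D := D)
    (C := (∑' n, ‖S.c (n + 2) * ((n + 2 : ℕ) : ℂ) ^ (-(c : ℂ))‖ / Real.log 2)) ?_ ?_ ?_
  · intro t
    have h := (reCLM.hasFDerivAt.comp_hasDerivAt t (hder t)).neg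
    rw [hval] at h
    refine h.congr_deriv ?_
    simp
  · intro t
    rw [abs_neg]
    refine (Complex.abs_re_le_norm _).trans ?_
    exact tsum_of_norm_bounded (hsum.div_const _).hasSum fun n => hUn n t
  · intro t
    exact (Complex.abs_re_le_norm _).trans (hD _ (by rw [hre]; exact hc.le))

lemma FarRight.logDeriv_xi_eq {c0 : ℝ} (hc0 : S.FarRight c0) (h0 : S.xi 0 ≠ 0) {s : ℂ}
    (hs : c0 < s.re) :
    logDeriv S.xi s = logDeriv S.F s + (Real.log S.Q +
      ∑ j, (S.lam j : ℂ) * digamma (S.lam j * s + S.mu j) +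
      (∑ i, (S.m i : ℂ) * (1 / (s - S.pole i)) + ∑ i : Fin S.N,
        (if 2 * S.M + S.dlt ≤ (i : ℕ) then
          (S.m i : ℂ) * (1 / (s - (σ1 - (starRingEnd ℂ) (S.pole i)))) else 0))) := by
  have hev : S.xi =ᶠ[nhds s] fun s => S.F s * ((S.Q : ℂ) ^ s *
      (∏ j, Gamma ((S.lam j : ℂ) * s + S.mu j)) * S.poleFactor s) := by
    filter_upwards [(isOpen_lt continuous_const continuous_re).mem_nhds hs] with z hz
    exact hc0.xi_eq (le_of_lt hz)
  have hQ0 : (S.Q : ℂ) ≠ 0 := ofReal_ne_zero.2 S.hQ.ne'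
  have hne := hc0.archFactor_ne_zero hs.le
  have hne1 := left_ne_zero_of_mul hne
  have hne2 := left_ne_zero_of_mul hne1
  have hne3 := right_ne_zero_of_mul hne1
  have hne4 := right_ne_zero_of_mul hne
  have hdQ : HasDerivAt (fun s : ℂ => (S.Q : ℂ) ^ s) ((S.Q : ℂ) ^ s * Complex.log S.Q * 1) s :=
    (hasDerivAt_id s).const_cpow (Or.inl hQ0)
  have hdG1 : ∀ j, DifferentiableAt ℂ Gamma ((S.lam j : ℂ) * s + S.mu j) := by
    intro j
    refine differentiableAt_Gamma _ fun m h => ?_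
    have h2 := hc0.two_le_re hs.le j
    rw [h] at h2
    simp at h2
    linarith [(Nat.cast_nonneg m : (0 : ℝ) ≤ m)]
  have hdG2 : ∀ j, DifferentiableAt ℂ (fun s => Gamma ((S.lam j : ℂ) * s + S.mu j)) s := fun j =>
    DifferentiableAt.comp (f := fun s => (S.lam j : ℂ) * s + S.mu j) s (hdG1 j) (by fun_prop)
  have hdG : DifferentiableAt ℂ (fun s => ∏ j, Gamma ((S.lam j : ℂ) * s + S.mu j)) s :=
    DifferentiableAt.fun_finsetProd fun j _ => hdG2 j
  have hif : ∀ i : Fin S.N, Differentiable ℂ fun s : ℂ => (if 2 * S.M + S.dlt ≤ (i : ℕ)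
      then ((σ1 : ℂ) - s - (starRingEnd ℂ) (S.pole i)) ^ S.m i else 1) := by
    intro i
    split_ifs <;> fun_prop
  have hdP2 : Differentiable ℂ fun s : ℂ => ∏ i : Fin S.N, (if 2 * S.M + S.dlt ≤ (i : ℕ)
      then ((σ1 : ℂ) - s - (starRingEnd ℂ) (S.pole i)) ^ S.m i else 1) := fun s =>
    DifferentiableAt.fun_finsetProd fun i _ => hif i s
  have hdP1 : Differentiable ℂ fun s : ℂ => ∏ i, (s - S.pole i) ^ S.m i := by fun_prop
  have hdP : DifferentiableAt ℂ S.poleFactor s := (hdP1 s).mul (hdP2 s)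
  have hP : logDeriv S.poleFactor s = ∑ i, (S.m i : ℂ) * (1 / (s - S.pole i)) + ∑ i : Fin S.N,
        (if 2 * S.M + S.dlt ≤ (i : ℕ) then
          (S.m i : ℂ) * (1 / (s - (σ1 - (starRingEnd ℂ) (S.pole i)))) else 0) := by
    have e : S.poleFactor = fun s => (∏ i, (s - S.pole i) ^ S.m i) *
      ∏ i : Fin S.N, (if 2 * S.M + S.dlt ≤ (i : ℕ)
      then ((σ1 : ℂ) - s - (starRingEnd ℂ) (S.pole i)) ^ S.m i else 1) := rfl
    rw [e] at hne4 ⊢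
    have hl := left_ne_zero_of_mul hne4
    have hr := right_ne_zero_of_mul hne4
    rw [logDeriv_mul (f := fun s => ∏ i, (s - S.pole i) ^ S.m i) s hl hr (hdP1 s) (hdP2 s),
      logDeriv_prod (s := Finset.univ) (f := fun i s => (s - S.pole i) ^ S.m i)
        (fun i _ => (Finset.prod_ne_zero_iff.1 hl) i (Finset.mem_univ i)) (fun i _ => by fun_prop),
      logDeriv_prod (s := Finset.univ) (f := fun (i : Fin S.N) s => (if 2 * S.M + S.dlt ≤ (i : ℕ)
        then ((σ1 : ℂ) - s - (starRingEnd ℂ) (S.pole i)) ^ S.m i else 1))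
        (fun i _ => (Finset.prod_ne_zero_iff.1 hr) i (Finset.mem_univ i)) (fun i _ => hif i s)]
    congr 1
    · refine Finset.sum_congr rfl fun i _ => ?_
      rw [logDeriv_fun_pow (by fun_prop)]
      simp [logDeriv_apply]
    · refine Finset.sum_congr rfl fun i _ => ?_
      split_ifs
      · rw [logDeriv_fun_pow (by fun_prop)]
        congr 1
        have hd : HasDerivAt (fun s : ℂ => (σ1 : ℂ) - s - (starRingEnd ℂ) (S.pole i)) (-1) s :=
          ((hasDerivAt_id s).const_sub _).sub_const _
        rw [logDeriv_apply, hd.deriv, ← neg_div_neg_eq]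
        congr 1 <;> ring
      · simp [logDeriv_apply]
  rw [logDeriv_apply, hev.deriv_eq, hev.eq_of_nhds, ← logDeriv_apply (fun s => S.F s *
      ((S.Q : ℂ) ^ s * (∏ j, Gamma ((S.lam j : ℂ) * s + S.mu j)) * S.poleFactor s)),
    logDeriv_mul (f := S.F) (g := fun s => (S.Q : ℂ) ^ s *
      (∏ j, Gamma ((S.lam j : ℂ) * s + S.mu j)) * S.poleFactor s) s (hc0.F_ne_zero h0 hs) hne
      (hc0.analyticAt_F hs.le).differentiableAt
      ((hdQ.differentiableAt.mul hdG).mul hdP),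
    logDeriv_mul (f := fun s => (S.Q : ℂ) ^ s * (∏ j, Gamma ((S.lam j : ℂ) * s + S.mu j)))
      (g := S.poleFactor) s hne1 hne4 (hdQ.differentiableAt.mul hdG) hdP,
    logDeriv_mul (f := fun s => (S.Q : ℂ) ^ s)
      (g := fun s => ∏ j, Gamma ((S.lam j : ℂ) * s + S.mu j)) s hne2 hne3 hdQ.differentiableAt hdG, hP,
    logDeriv_prod (s := Finset.univ) (f := fun j s => Gamma ((S.lam j : ℂ) * s + S.mu j))
      (fun j _ => (Finset.prod_ne_zero_iff.1 hne3) j (Finset.mem_univ j)) (fun j _ => hdG2 j)]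
  congr 3
  · rw [logDeriv_apply, hdQ.deriv, ofReal_log S.hQ.le]
    field_simp
  · refine Finset.sum_congr rfl fun j _ => ?_
    have hd : HasDerivAt (fun s : ℂ => (S.lam j : ℂ) * s + S.mu j) (S.lam j) s := by
      simpa using ((hasDerivAt_id s).const_mul (S.lam j : ℂ)).add_const (S.mu j)
    have := logDeriv_comp (f := Gamma) (g := fun s : ℂ => (S.lam j : ℂ) * s + S.mu j) (x := s)
      (hdG1 j) hd.differentiableAt
    rw [hd.deriv] at this
    rw [digamma_def, mul_comm]
    exact this

/-- The real part of `ξ'/ξ` on a vertical line far to the right. -/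
lemma FarRight.symmetricallyIntegrable_logDeriv_xi {c0 c : ℝ} (hc0 : S.FarRight c0)
    (h0 : S.xi 0 ≠ 0) (hc : c0 < c) :
    SymmetricallyIntegrable fun t : ℝ => (logDeriv S.xi (c + t * I)).re := by
  have hre : ∀ t : ℝ, ((c : ℂ) + t * I).re = c := by intro t; simp
  have h1 := hc0.logDeriv_F_line h0 hc
  have h2 : SymmetricallyIntegrable fun t : ℝ =>
      ∑ j, S.lam j * (digamma (S.lam j * (c + t * I) + S.mu j)).re := by
    refine SymmetricallyIntegrable.sum _ fun j => SymmetricallyIntegrable.const_mul ?_ _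
    have := SymmetricallyIntegrable.digamma_line (x := S.lam j * c + (S.mu j).re) (v := (S.mu j).im)
      (S.hlam j) (by linarith [(hc0.mono hc.le).gamma j])
    have e : ∀ t : ℝ, (S.lam j * (c + t * I) + S.mu j : ℂ) =
        ((S.lam j * c + (S.mu j).re : ℝ) : ℂ) + (S.lam j * t + (S.mu j).im) * I := by
      intro t
      apply Complex.ext <;> simp
    simpa only [e] using this
  have h3 : SymmetricallyIntegrable fun t : ℝ =>
      ∑ i, (S.m i : ℝ) * (1 / ((c : ℂ) + t * I - S.pole i)).re :=
    SymmetricallyIntegrable.sum _ fun i =>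
      (SymmetricallyIntegrable.pole_line ((hc0.mono hc.le).pole_lt i)).const_mul _
  have h4 : SymmetricallyIntegrable fun t : ℝ =>
      ∑ i : Fin S.N, (if 2 * S.M + S.dlt ≤ (i : ℕ) then
        (S.m i : ℝ) * (1 / ((c : ℂ) + t * I - (σ1 - (starRingEnd ℂ) (S.pole i)))).re else 0) := by
    refine SymmetricallyIntegrable.sum _ fun i => ?_
    split_ifs
    · exact (SymmetricallyIntegrable.pole_line
        (by simpa using (hc0.mono hc.le).refl_lt i)).const_mul _
    · exact SymmetricallyIntegrable.const 0
  have h5 := h1.add (((SymmetricallyIntegrable.const (Real.log S.Q)).add h2).add (h3.add h4))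
  convert h5 using 2 with t
  rw [hc0.logDeriv_xi_eq h0 (by rw [hre]; exact hc)]
  simp only [add_re, ofReal_re, re_sum, re_ofReal_mul]
  congr 3
  · refine Finset.sum_congr rfl fun i _ => ?_
    rw [← ofReal_natCast, re_ofReal_mul]
  · refine Finset.sum_congr rfl fun i _ => ?_
    split_ifs
    · rw [← ofReal_natCast, re_ofReal_mul]
    · simp

end SSF

lemma integrable_poisson {b : ℝ} (hb : 0 < b) : Integrable fun x : ℝ => b / (b ^ 2 + x ^ 2) := by
  have h := (integrable_inv_one_add_sq.comp_div hb.ne').const_mul b⁻¹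
  refine h.congr (ae_of_all _ fun x => ?_)
  have : 0 < b ^ 2 + x ^ 2 := by positivity
  field_simp

lemma integral_poisson {b : ℝ} (hb : 0 < b) : ∫ x : ℝ, b / (b ^ 2 + x ^ 2) = Real.pi := by
  have h := Measure.integral_comp_div (fun x : ℝ => (1 + x ^ 2)⁻¹) b
  rw [integral_univ_inv_one_add_sq, abs_of_pos hb, smul_eq_mul] at h
  have e : (fun x : ℝ => b / (b ^ 2 + x ^ 2)) = fun x => b⁻¹ * (1 + (x / b) ^ 2)⁻¹ := by
    ext x
    have : 0 < b ^ 2 + x ^ 2 := by positivity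
    field_simp
  rw [e, integral_const_mul, h]
  field_simp

lemma inv_one_add_sq_le (x : ℝ) : (1 + x ^ 2)⁻¹ ≤ 2 * ((1 + |x|) ^ 2)⁻¹ := by
  rw [← div_eq_mul_inv, le_div_iff₀ (by positivity), inv_mul_le_iff₀ (by positivity), ← sq_abs x]
  nlinarith [sq_nonneg (1 - |x|)]

lemma inv_sq_one_add_abs_le (x : ℝ) : ((1 + |x|) ^ 2)⁻¹ ≤ (1 + x ^ 2)⁻¹ := by
  refine inv_anti₀ (by positivity) ?_
  rw [← sq_abs]
  nlinarith [abs_nonneg x]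

lemma integrable_inv_sq_one_add_abs (γ : ℝ) : Integrable fun t : ℝ => ((1 + |t - γ|) ^ 2)⁻¹ := by
  refine (integrable_inv_one_add_sq.comp_sub_right γ).mono' (by fun_prop) (ae_of_all _ fun t => ?_)
  rw [Real.norm_of_nonneg (by positivity)]
  exact inv_sq_one_add_abs_le _

lemma setIntegral_tail_le {γ d : ℝ} (hd : 0 ≤ d) {A : Set ℝ} (hA : MeasurableSet A)
    (h : ∀ t ∈ A, d ≤ |t - γ|) :
    ∫ t in A, ((1 + |t - γ|) ^ 2)⁻¹ ≤ 2 * Real.pi / (1 + d) := by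
  have hd1 : 0 < 1 + d := by linarith
  have hi := (((integrable_poisson hd1).comp_sub_right γ).const_mul (2 / (1 + d)))
  calc ∫ t in A, ((1 + |t - γ|) ^ 2)⁻¹
      ≤ ∫ t in A, 2 / (1 + d) * ((1 + d) / ((1 + d) ^ 2 + (t - γ) ^ 2)) := by
        refine setIntegral_mono_on (integrable_inv_sq_one_add_abs γ).integrableOn hi.integrableOn hA
          fun t ht => ?_
        have h1 := h t ht
        have h2 : 0 < (1 + d) ^ 2 + (t - γ) ^ 2 := by positivity
        have e : 2 / (1 + d) * ((1 + d) / ((1 + d) ^ 2 + (t - γ) ^ 2)) =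
            2 / ((1 + d) ^ 2 + (t - γ) ^ 2) := by field_simp
        rw [e, ← one_div, div_le_div_iff₀ (by positivity) h2, ← sq_abs (t - γ)]
        nlinarith [abs_nonneg (t - γ)]
    _ ≤ ∫ t, 2 / (1 + d) * ((1 + d) / ((1 + d) ^ 2 + (t - γ) ^ 2)) :=
        setIntegral_le_integral hi (ae_of_all _ fun t => by positivity)
    _ = _ := by
        rw [integral_const_mul,
          integral_sub_right_eq_self (fun t : ℝ => (1 + d) / ((1 + d) ^ 2 + t ^ 2)),
          integral_poisson hd1]
        ring

/-- A continuous kernel of Poisson type, comparable with `1 / (1 + x ^ 2)`. -/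
structure PoissonKernel (B : ℝ) (k : ℝ → ℝ) : Prop where
  cont : Continuous k
  nonneg : ∀ x, 0 ≤ k x
  le : ∀ x, k x ≤ B / (1 + x ^ 2)

namespace PoissonKernel

variable {B : ℝ} {k : ℝ → ℝ}

lemma bound_nonneg (hk : PoissonKernel B k) : 0 ≤ B := by
  have := (hk.nonneg 0).trans (hk.le 0)
  simpa using this

lemma le_const (hk : PoissonKernel B k) (x : ℝ) : k x ≤ B := by
  refine (hk.le x).trans (div_le_self hk.bound_nonneg ?_)
  nlinarith [sq_nonneg x]

lemma le_inv_sq (hk : PoissonKernel B k) (x : ℝ) : k x ≤ 2 * B * ((1 + |x|) ^ 2)⁻¹ := by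
  refine (hk.le x).trans ?_
  rw [div_eq_mul_inv, mul_comm 2 B, mul_assoc]
  exact mul_le_mul_of_nonneg_left (inv_one_add_sq_le x) hk.bound_nonneg

lemma abs_mul_oddKernel_le (hk : PoissonKernel B k) (x t : ℝ) :
    |k x * oddKernel t| ≤ 4 * B * (((1 + |x|) ^ 2)⁻¹ * (1 + |t|)⁻¹) := by
  rw [abs_mul, abs_of_nonneg (hk.nonneg x)]
  have := mul_le_mul (hk.le_inv_sq x) (abs_oddKernel_le t) (abs_nonneg _)
    (mul_nonneg (mul_nonneg zero_le_two hk.bound_nonneg) (by positivity))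
  refine this.trans (le_of_eq ?_)
  ring

lemma integrable (hk : PoissonKernel B k) : Integrable k := by
  refine (integrable_inv_one_add_sq.const_mul B).mono' hk.cont.aestronglyMeasurable
    (ae_of_all _ fun t => ?_)
  rw [Real.norm_of_nonneg (hk.nonneg t), ← div_eq_mul_inv]
  exact hk.le t

lemma integrable_mul_oddKernel (hk : PoissonKernel B k) (γ : ℝ) :
    Integrable fun t => k (t - γ) * oddKernel t := by
  refine ((integrable_inv_sq_one_add_abs γ).const_mul (4 * B)).mono' ?_ (ae_of_all _ fun t => ?_)
  · exact ((hk.cont.comp (continuous_sub_right γ)).mul continuous_oddKernel).aestronglyMeasurable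
  · rw [Real.norm_eq_abs]
    refine (hk.abs_mul_oddKernel_le _ t).trans (mul_le_mul_of_nonneg_left ?_
      (by linarith [hk.bound_nonneg]))
    exact mul_le_of_le_one_right (by positivity) (inv_le_one_of_one_le₀ (by linarith [abs_nonneg t]))

lemma abs_setIntegral_le (hk : PoissonKernel B k) {γ d M : ℝ} (hd : 0 ≤ d) (hM : 0 ≤ M) {A : Set ℝ}
    (hA : MeasurableSet A) (h : ∀ t ∈ A, d ≤ |t - γ|) (hT : ∀ t ∈ A, M ≤ |t|) :
    |∫ t in A, k (t - γ) * oddKernel t| ≤ 8 * Real.pi * B * ((1 + M)⁻¹ * (1 + d)⁻¹) := by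
  have hB := hk.bound_nonneg
  have hi := ((integrable_inv_sq_one_add_abs γ).const_mul (4 * B * (1 + M)⁻¹)).integrableOn (s := A)
  calc |∫ t in A, k (t - γ) * oddKernel t|
      ≤ ∫ t in A, 4 * B * (1 + M)⁻¹ * ((1 + |t - γ|) ^ 2)⁻¹ := by
        rw [← Real.norm_eq_abs]
        refine norm_integral_le_of_norm_le hi ((ae_restrict_iff' hA).2 (ae_of_all _ fun t ht => ?_))
        rw [Real.norm_eq_abs]
        refine (hk.abs_mul_oddKernel_le _ t).trans ?_
        rw [mul_assoc (4 * B), mul_comm (((1 + |t - γ|) ^ 2)⁻¹)]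
        have := hT t ht
        gcongr
    _ = 4 * B * (1 + M)⁻¹ * ∫ t in A, ((1 + |t - γ|) ^ 2)⁻¹ := integral_const_mul _ _
    _ ≤ 4 * B * (1 + M)⁻¹ * (2 * Real.pi / (1 + d)) := by
        gcongr
        exact setIntegral_tail_le hd hA h
    _ = _ := by ring

end PoissonKernel

/-- A weighted arithmetic-geometric mean bound. -/
lemma inv_mul_inv_le_rpow {T M d D : ℝ} (hT : 0 ≤ T) (hTM : T ≤ M) (hd : 0 ≤ d) (hD : 1 ≤ D)
    (hDM : D ≤ 1 + M) :
    (1 + M)⁻¹ * (1 + d)⁻¹ ≤ (1 + T) ^ (-(1 / 4) : ℝ) * D ^ (-(11 / 8) : ℝ) +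
      (1 + T) ^ (-(3 / 8) : ℝ) * ((1 + d) ^ 2)⁻¹ := by
  have hT1 : 0 < 1 + T := by linarith
  have hM1 : 0 < 1 + M := by linarith
  have hd1 : 0 < 1 + d := by linarith
  have hD1 : 0 < D := by linarith
  set κ := (1 + T) ^ (3 / 8 : ℝ) with hκ
  have hκ0 : 0 < κ := Real.rpow_pos_of_pos hT1 _
  have hκ1 : (1 + T) ^ (-(3 / 8) : ℝ) = κ⁻¹ := by rw [Real.rpow_neg hT1.le]
  have h1 : ((1 + M)⁻¹) ^ 2 ≤ (1 + T) ^ (-(5 / 8) : ℝ) * D ^ (-(11 / 8) : ℝ) := by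
    have e : ((1 + M)⁻¹) ^ 2 = (1 + M) ^ (-(5 / 8) : ℝ) * (1 + M) ^ (-(11 / 8) : ℝ) := by
      rw [← Real.rpow_add hM1, inv_pow, ← Real.rpow_natCast, ← Real.rpow_neg hM1.le]
      norm_num
    rw [e]
    refine mul_le_mul ?_ ?_ (by positivity) (by positivity)
    · exact Real.rpow_le_rpow_of_nonpos hT1 (by linarith) (by norm_num)
    · exact Real.rpow_le_rpow_of_nonpos hD1 hDM (by norm_num)
  have h2 : κ * ((1 + T) ^ (-(5 / 8) : ℝ)) = (1 + T) ^ (-(1 / 4) : ℝ) := by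
    rw [hκ, ← Real.rpow_add hT1]; norm_num
  have h3 : (1 + M)⁻¹ * (1 + d)⁻¹ ≤ κ * ((1 + M)⁻¹) ^ 2 + κ⁻¹ * ((1 + d)⁻¹) ^ 2 := by
    have h4 : 0 ≤ κ⁻¹ * (κ * (1 + M)⁻¹ - (1 + d)⁻¹) ^ 2 := by positivity
    have e : κ⁻¹ * (κ * (1 + M)⁻¹ - (1 + d)⁻¹) ^ 2 =
        κ * ((1 + M)⁻¹) ^ 2 + κ⁻¹ * ((1 + d)⁻¹) ^ 2 - 2 * ((1 + M)⁻¹ * (1 + d)⁻¹) := by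
      field_simp
      ring
    have : 0 ≤ (1 + M)⁻¹ * (1 + d)⁻¹ := by positivity
    linarith
  rw [hκ1, ← inv_pow (1 + d), ← h2]
  refine h3.trans (add_le_add_left ?_ _)
  rw [mul_assoc]
  exact mul_le_mul_of_nonneg_left h1 hκ0.le

/-- The truncated integral against the odd kernel, compared with its sharp cut-off. -/
lemma exists_abs_truncated_sub_le {B : ℝ} (hB : 0 ≤ B) : ∃ C, 0 ≤ C ∧ ∀ k : ℝ → ℝ,
    PoissonKernel B k → ∀ γ T : ℝ, 0 ≤ T →
    |(∫ t in (-T)..T, k (t - γ) * oddKernel t) -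
      (if |γ| ≤ T then ∫ t, k (t - γ) * oddKernel t else 0)| ≤
    C * ((1 + T) ^ (-(1 / 4) : ℝ) * (1 + |γ|) ^ (-(11 / 8) : ℝ) +
      (1 + T) ^ (-(3 / 8) : ℝ) * ((1 + |(|γ| - T)|) ^ 2)⁻¹) := by
  set K := ∫ t : ℝ, (1 + |t|) ^ (-(9 / 8) : ℝ) with hK
  have hKi : Integrable fun t : ℝ => (1 + |t|) ^ (-(9 / 8) : ℝ) :=
    SymmetricallyIntegrable.integrable_one_add_abs_rpow (by norm_num)
  have hK0 : 0 ≤ K := integral_nonneg fun t => by positivity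
  refine ⟨8 * Real.pi * B * 2 + 16 * B * K, by positivity, fun k hk γ T hT => ?_⟩
  have hD : 1 ≤ 1 + |γ| := by linarith [abs_nonneg γ]
  have hT1 : 0 < 1 + T := by linarith
  have hg := hk.integrable_mul_oddKernel γ
  have hle : -T ≤ T := by linarith
  rw [intervalIntegral.integral_of_le hle]
  split_ifs with h
  · rw [← integral_add_compl measurableSet_Ioc hg (s := Set.Ioc (-T) T), sub_add_cancel_left,
      abs_neg]
    have hsub : ∀ t ∈ (Set.Ioc (-T) T)ᶜ, T ≤ |t| := by
      intro t ht
      by_contra hlt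
      rw [not_le, abs_lt] at hlt
      exact ht ⟨hlt.1, hlt.2.le⟩
    have h1 := hk.abs_setIntegral_le (γ := γ) (d := T - |γ|) (sub_nonneg.2 h) hT
      measurableSet_Ioc.compl (fun t ht => by
        have := hsub t ht
        have := abs_sub_abs_le_abs_sub t γ
        linarith) hsub
    have h2 := inv_mul_inv_le_rpow hT le_rfl (sub_nonneg.2 h) hD (by linarith)
    rw [abs_sub_comm |γ| T, abs_of_nonneg (sub_nonneg.2 h)]
    refine h1.trans (mul_le_mul ?_ h2 ?_ (by positivity))
    · have : 0 ≤ 8 * Real.pi * B := by positivity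
      have : 0 ≤ 16 * B * K := by positivity
      linarith
    · have := sub_nonneg.2 h
      positivity
  · rw [not_le] at h
    rw [sub_zero]
    have hd : 0 ≤ |γ| - T := by linarith
    have hdt : ∀ t ∈ Set.Ioc (-T) T, |γ| - T ≤ |t - γ| := by
      intro t ht
      have h1 : |t| ≤ T := abs_le.2 ⟨ht.1.le, ht.2⟩
      have := abs_sub_abs_le_abs_sub γ t
      rw [abs_sub_comm] at this
      linarith
    set D := 1 + |γ| with hDdef
    have hD0 : 0 < D := by linarith
    have hi1 : IntegrableOn (fun t => 8 * B * D⁻¹ * ((1 + |t - γ|) ^ 2)⁻¹) (Set.Ioc (-T) T) :=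
      ((integrable_inv_sq_one_add_abs γ).const_mul _).integrableOn
    have hi2 : Integrable (fun t : ℝ => 16 * B * D ^ (-(15 / 8) : ℝ) * (1 + |t|) ^ (-(9 / 8) : ℝ)) :=
      hKi.const_mul _
    have hpt : ∀ t ∈ Set.Ioc (-T) T, |k (t - γ) * oddKernel t| ≤
        8 * B * D⁻¹ * ((1 + |t - γ|) ^ 2)⁻¹ +
          16 * B * D ^ (-(15 / 8) : ℝ) * (1 + |t|) ^ (-(9 / 8) : ℝ) := by
      intro t ht
      have ht1 : |t| ≤ T := abs_le.2 ⟨ht.1.le, ht.2⟩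
      have htri : |γ| ≤ |t - γ| + |t| := by
        have := abs_sub_abs_le_abs_sub γ t
        rw [abs_sub_comm] at this
        linarith
      refine (hk.abs_mul_oddKernel_le _ t).trans ?_
      have ht0 : 0 < 1 + |t| := by positivity
      rcases le_total (D / 2) (1 + |t|) with hc | hc
      · have h3 : (1 + |t|)⁻¹ ≤ 2 * D⁻¹ := by
          rw [← div_eq_mul_inv, le_div_iff₀ hD0, inv_mul_le_iff₀ ht0]
          linarith
        have h4 : 0 ≤ 16 * B * D ^ (-(15 / 8) : ℝ) * (1 + |t|) ^ (-(9 / 8) : ℝ) := by positivity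
        have h5 : 4 * B * (((1 + |t - γ|) ^ 2)⁻¹ * (1 + |t|)⁻¹) ≤
            4 * B * (((1 + |t - γ|) ^ 2)⁻¹ * (2 * D⁻¹)) := by gcongr
        linarith
      · have h3 : D / 2 ≤ 1 + |t - γ| := by linarith
        have h4 : ((1 + |t - γ|) ^ 2)⁻¹ ≤ 4 * (D ^ 2)⁻¹ := by
          rw [← div_eq_mul_inv, le_div_iff₀ (by positivity), inv_mul_le_iff₀ (by positivity)]
          nlinarith
        have h5 : (1 + |t|)⁻¹ ≤ D ^ (1 / 8 : ℝ) * (1 + |t|) ^ (-(9 / 8) : ℝ) := by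
          have e : (1 + |t|)⁻¹ = (1 + |t|) ^ (1 / 8 : ℝ) * (1 + |t|) ^ (-(9 / 8) : ℝ) := by
            rw [← Real.rpow_add ht0, ← Real.rpow_neg_one]; norm_num
          rw [e]
          refine mul_le_mul_of_nonneg_right ?_ (by positivity)
          exact Real.rpow_le_rpow ht0.le (by linarith) (by norm_num)
        have h6 : (D ^ 2)⁻¹ * D ^ (1 / 8 : ℝ) = D ^ (-(15 / 8) : ℝ) := by
          rw [← Real.rpow_natCast, ← Real.rpow_neg hD0.le, ← Real.rpow_add hD0]; norm_num
        have h7 : ((1 + |t - γ|) ^ 2)⁻¹ * (1 + |t|)⁻¹ ≤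
            4 * (D ^ 2)⁻¹ * (D ^ (1 / 8 : ℝ) * (1 + |t|) ^ (-(9 / 8) : ℝ)) := by
          gcongr
        have h8 : 0 ≤ 8 * B * D⁻¹ * ((1 + |t - γ|) ^ 2)⁻¹ := by positivity
        have h9 := mul_le_mul_of_nonneg_left h7 (by positivity : 0 ≤ 4 * B)
        have e : 4 * B * (4 * (D ^ 2)⁻¹ * (D ^ (1 / 8 : ℝ) * (1 + |t|) ^ (-(9 / 8) : ℝ))) =
            16 * B * D ^ (-(15 / 8) : ℝ) * (1 + |t|) ^ (-(9 / 8) : ℝ) := by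
          rw [← h6]; ring
        linarith
    have hmain : |∫ t in Set.Ioc (-T) T, k (t - γ) * oddKernel t| ≤
        8 * B * D⁻¹ * (2 * Real.pi / (1 + (|γ| - T))) + 16 * B * D ^ (-(15 / 8) : ℝ) * K := by
      calc |∫ t in Set.Ioc (-T) T, k (t - γ) * oddKernel t|
          ≤ ∫ t in Set.Ioc (-T) T, (8 * B * D⁻¹ * ((1 + |t - γ|) ^ 2)⁻¹ +
            16 * B * D ^ (-(15 / 8) : ℝ) * (1 + |t|) ^ (-(9 / 8) : ℝ)) := by
            rw [← Real.norm_eq_abs]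
            exact norm_integral_le_of_norm_le (hi1.add hi2.integrableOn)
              ((ae_restrict_iff' measurableSet_Ioc).2 (ae_of_all _ fun t ht => hpt t ht))
        _ = (∫ t in Set.Ioc (-T) T, 8 * B * D⁻¹ * ((1 + |t - γ|) ^ 2)⁻¹) +
            ∫ t in Set.Ioc (-T) T, 16 * B * D ^ (-(15 / 8) : ℝ) * (1 + |t|) ^ (-(9 / 8) : ℝ) :=
            integral_add hi1 hi2.integrableOn
        _ ≤ _ := by
            refine add_le_add ?_ ?_
            · rw [integral_const_mul]
              exact mul_le_mul_of_nonneg_left (setIntegral_tail_le hd measurableSet_Ioc hdt)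
                (by positivity)
            · rw [← integral_const_mul]
              exact setIntegral_le_integral hi2 (ae_of_all _ fun t => by positivity)
    have h2 := inv_mul_inv_le_rpow hT h.le hd hD le_rfl
    have h3 : D ^ (-(15 / 8) : ℝ) ≤ (1 + T) ^ (-(1 / 4) : ℝ) * D ^ (-(11 / 8) : ℝ) := by
      calc D ^ (-(15 / 8) : ℝ) ≤ D ^ (-(1 / 4) + -(11 / 8) : ℝ) :=
            Real.rpow_le_rpow_of_exponent_le hD (by norm_num)
        _ = D ^ (-(1 / 4) : ℝ) * D ^ (-(11 / 8) : ℝ) := Real.rpow_add hD0 _ _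
        _ ≤ _ := by
            refine mul_le_mul_of_nonneg_right ?_ (by positivity)
            exact Real.rpow_le_rpow_of_nonpos hT1 (by linarith) (by norm_num)
    rw [abs_of_nonneg hd]
    set X := (1 + T) ^ (-(1 / 4) : ℝ) * D ^ (-(11 / 8) : ℝ)
    set Y := (1 + T) ^ (-(3 / 8) : ℝ) * ((1 + (|γ| - T)) ^ 2)⁻¹
    have hY : 0 ≤ Y := by positivity
    refine hmain.trans ?_
    have e : 8 * B * D⁻¹ * (2 * Real.pi / (1 + (|γ| - T))) =
        8 * Real.pi * B * 2 * (D⁻¹ * (1 + (|γ| - T))⁻¹) := by ring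
    rw [e, add_mul]
    refine add_le_add (mul_le_mul_of_nonneg_left h2 (by positivity)) ?_
    rw [mul_right_comm]
    exact mul_le_mul_of_nonneg_left (h3.trans (by linarith)) (by positivity)

lemma abs_oddKernel_sub_le (a b : ℝ) :
    |oddKernel a - oddKernel b| ≤ 2 * (|a - b| * ((1 + |a|)⁻¹ * (1 + |b|)⁻¹)) := by
  have ha : 0 < 1 + a ^ 2 := by positivity
  have hb : 0 < 1 + b ^ 2 := by positivity
  have e : oddKernel a - oddKernel b = (a - b) * (1 - a * b) / ((1 + a ^ 2) * (1 + b ^ 2)) := by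
    rw [oddKernel, oddKernel]
    field_simp
    ring
  have h1 : |1 - a * b| * ((1 + |a|) * (1 + |b|)) ≤ 2 * ((1 + a ^ 2) * (1 + b ^ 2)) := by
    have hX : |1 - a * b| ^ 2 ≤ (1 + a ^ 2) * (1 + b ^ 2) := by
      rw [sq_abs]
      nlinarith [sq_nonneg (a + b)]
    have hA : (1 + |a|) ^ 2 ≤ 2 * (1 + a ^ 2) := by
      rw [← sq_abs a]; nlinarith [sq_nonneg (|a| - 1)]
    have hB : (1 + |b|) ^ 2 ≤ 2 * (1 + b ^ 2) := by
      rw [← sq_abs b]; nlinarith [sq_nonneg (|b| - 1)]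
    have hY : ((1 + |a|) * (1 + |b|)) ^ 2 ≤ 4 * ((1 + a ^ 2) * (1 + b ^ 2)) := by
      rw [mul_pow]
      have := mul_le_mul hA hB (by positivity) (by positivity)
      linarith
    nlinarith [sq_nonneg (2 * |1 - a * b| - (1 + |a|) * (1 + |b|))]
  rw [e, abs_div, abs_mul, abs_of_pos (by positivity : 0 < (1 + a ^ 2) * (1 + b ^ 2)),
    div_le_iff₀ (by positivity)]
  have h2 : |1 - a * b| ≤ 2 * ((1 + a ^ 2) * (1 + b ^ 2)) * ((1 + |a|)⁻¹ * (1 + |b|)⁻¹) := by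
    rw [← mul_inv, ← div_eq_mul_inv, le_div_iff₀ (by positivity)]
    exact h1
  refine (mul_le_mul_of_nonneg_left h2 (abs_nonneg (a - b))).trans (le_of_eq ?_)
  ring

/-- Averaging the odd kernel against a Poisson kernel changes it by a summable amount. -/
lemma exists_abs_integral_sub_le {B : ℝ} (hB : 0 ≤ B) : ∃ C, 0 ≤ C ∧ ∀ k : ℝ → ℝ,
    PoissonKernel B k → ∫ x, k x = Real.pi → ∀ γ : ℝ,
    |(∫ t, k (t - γ) * oddKernel t) - Real.pi * oddKernel γ| ≤
      C * (1 + |γ|) ^ (-(11 / 8) : ℝ) := by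
  have hKi : Integrable fun t : ℝ => (1 + |t|) ^ (-(5 / 4) : ℝ) :=
    SymmetricallyIntegrable.integrable_one_add_abs_rpow (by norm_num)
  set K := ∫ t : ℝ, (1 + |t|) ^ (-(5 / 4) : ℝ) with hK
  have hK0 : 0 ≤ K := integral_nonneg fun t => by positivity
  refine ⟨4 * B * (K + K), by positivity, fun k hk hki γ => ?_⟩
  set D := 1 + |γ| with hD
  have hD0 : 0 < D := by positivity
  have e1 : (∫ t, k (t - γ) * oddKernel t) - Real.pi * oddKernel γ =
      ∫ t, k (t - γ) * (oddKernel t - oddKernel γ) := by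
    rw [← hki, ← integral_sub_right_eq_self k γ, ← integral_mul_const,
      ← integral_sub (hk.integrable_mul_oddKernel γ) ((hk.integrable.comp_sub_right γ).mul_const _)]
    simp only [mul_sub]
  have hi : Integrable fun t : ℝ => 4 * B * D ^ (-(11 / 8) : ℝ) *
      ((1 + |t - γ|) ^ (-(5 / 4) : ℝ) + (1 + |t|) ^ (-(5 / 4) : ℝ)) :=
    ((hKi.comp_sub_right γ).add hKi).const_mul _
  have hpt : ∀ t, ‖k (t - γ) * (oddKernel t - oddKernel γ)‖ ≤ 4 * B * D ^ (-(11 / 8) : ℝ) *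
      ((1 + |t - γ|) ^ (-(5 / 4) : ℝ) + (1 + |t|) ^ (-(5 / 4) : ℝ)) := by
    intro t
    set a := 1 + |t - γ| with ha
    set b := 1 + |t| with hb
    have ha0 : 0 < a := by positivity
    have hb0 : 0 < b := by positivity
    have ha1 : 1 ≤ a := by linarith [abs_nonneg (t - γ)]
    have hDab : D ≤ a * b := by
      have := abs_sub_abs_le_abs_sub γ t
      rw [abs_sub_comm] at this
      nlinarith [abs_nonneg (t - γ), abs_nonneg t]
    have h1 : |k (t - γ)| ≤ 2 * B * (a ^ 2)⁻¹ := by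
      rw [abs_of_nonneg (hk.nonneg _)]
      exact hk.le_inv_sq _
    have h2 : |oddKernel t - oddKernel γ| ≤ 2 * (a * (b⁻¹ * D⁻¹)) := by
      refine (abs_oddKernel_sub_le t γ).trans ?_
      have : |t - γ| ≤ a := by linarith
      gcongr
    have h3 : (a * b)⁻¹ ≤ D ^ (-(3 / 8) : ℝ) *
        (a ^ (-(5 / 4) : ℝ) + b ^ (-(5 / 4) : ℝ)) := by
      have e : (a * b)⁻¹ = (a * b) ^ (-(3 / 8) : ℝ) * (a ^ (-(5 / 8) : ℝ) * b ^ (-(5 / 8) : ℝ)) := by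
        rw [← Real.mul_rpow ha0.le hb0.le, ← Real.rpow_add (by positivity), ← Real.rpow_neg_one]
        norm_num
      have ea : a ^ (-(5 / 4) : ℝ) = (a ^ (-(5 / 8) : ℝ)) ^ 2 := by
        rw [← Real.rpow_natCast, ← Real.rpow_mul ha0.le]; norm_num
      have eb : b ^ (-(5 / 4) : ℝ) = (b ^ (-(5 / 8) : ℝ)) ^ 2 := by
        rw [← Real.rpow_natCast, ← Real.rpow_mul hb0.le]; norm_num
      rw [e, ea, eb]
      refine mul_le_mul (Real.rpow_le_rpow_of_nonpos hD0 hDab (by norm_num)) ?_ (by positivity)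
        (by positivity)
      nlinarith [sq_nonneg (a ^ (-(5 / 8) : ℝ) - b ^ (-(5 / 8) : ℝ)),
        Real.rpow_nonneg ha0.le (-(5 / 8)), Real.rpow_nonneg hb0.le (-(5 / 8)),
        mul_nonneg (Real.rpow_nonneg ha0.le (-(5 / 8))) (Real.rpow_nonneg hb0.le (-(5 / 8)))]
    have h4 : D⁻¹ * D ^ (-(3 / 8) : ℝ) = D ^ (-(11 / 8) : ℝ) := by
      rw [← Real.rpow_neg_one, ← Real.rpow_add hD0]; norm_num
    rw [norm_mul, Real.norm_eq_abs, Real.norm_eq_abs]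
    calc |k (t - γ)| * |oddKernel t - oddKernel γ|
        ≤ (2 * B * (a ^ 2)⁻¹) * (2 * (a * (b⁻¹ * D⁻¹))) :=
          mul_le_mul h1 h2 (abs_nonneg _) (by positivity)
      _ = 4 * B * D⁻¹ * (a * b)⁻¹ := by field_simp; ring
      _ ≤ 4 * B * D⁻¹ * (D ^ (-(3 / 8) : ℝ) * (a ^ (-(5 / 4) : ℝ) + b ^ (-(5 / 4) : ℝ))) :=
          mul_le_mul_of_nonneg_left h3 (by positivity)
      _ = _ := by rw [← h4]; ring
  rw [e1, ← Real.norm_eq_abs]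
  refine (norm_integral_le_of_norm_le hi (ae_of_all _ hpt)).trans (le_of_eq ?_)
  rw [integral_const_mul, integral_add (hKi.comp_sub_right γ) hKi,
    integral_sub_right_eq_self (fun t : ℝ => (1 + |t|) ^ (-(5 / 4) : ℝ))]
  ring

section PoissonSum

variable {ι : Type*} {m γ : ι → ℝ} {k : ι → ℝ → ℝ} {δ B : ℝ} {u : ℝ → ℝ}

/-- A Poisson-type sum of moderate growth has a sparse support. -/
lemma summable_of_poisson_growth (hm : ∀ i, 0 ≤ m i) (hk : ∀ i, PoissonKernel B (k i)) (hδ : 0 < δ)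
    (hkδ : ∀ i x, δ / (1 + x ^ 2) ≤ k i x) (hu : SymmetricallyIntegrable u)
    (hsum : ∀ t, HasSum (fun i => m i * k i (t - γ i)) (u t)) :
    Summable fun i => m i * (1 + |γ i|) ^ (-(11 / 8) : ℝ) := by
  obtain ⟨C, hC0, hC⟩ := hu.growth
  have hwc : Continuous fun t : ℝ => (1 + |t|) ^ (-(11 / 8) : ℝ) :=
    (continuous_const.add continuous_abs).rpow_const fun t =>
      Or.inl (by positivity : 1 + |t| ≠ 0)
  have hui : Integrable fun t => u t * (1 + |t|) ^ (-(11 / 8) : ℝ) := by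
    refine ((SymmetricallyIntegrable.integrable_one_add_abs_rpow (p := -(9 / 8))
      (by norm_num)).const_mul C).mono' (hu.cont.mul hwc).aestronglyMeasurable
      (ae_of_all _ fun t => ?_)
    have h0 : 0 < 1 + |t| := by positivity
    rw [norm_mul, Real.norm_eq_abs, Real.norm_of_nonneg (by positivity)]
    refine (mul_le_mul_of_nonneg_right (hC t) (by positivity)).trans (le_of_eq ?_)
    rw [mul_assoc, ← Real.rpow_add h0]
    norm_num
  have hki : ∀ i, Integrable fun t => k i (t - γ i) * (1 + |t|) ^ (-(11 / 8) : ℝ) := by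
    intro i
    refine ((SymmetricallyIntegrable.integrable_one_add_abs_rpow (p := -(11 / 8))
      (by norm_num)).const_mul B).mono'
      (((hk i).cont.comp (continuous_sub_right (γ i))).mul hwc).aestronglyMeasurable
      (ae_of_all _ fun t => ?_)
    rw [norm_mul, Real.norm_of_nonneg ((hk i).nonneg _), Real.norm_of_nonneg (by positivity)]
    exact mul_le_mul_of_nonneg_right ((hk i).le_const _) (by positivity)
  have hlow : ∀ i, δ / 2 * 2 ^ (-(11 / 8) : ℝ) * (1 + |γ i|) ^ (-(11 / 8) : ℝ) ≤
      ∫ t, k i (t - γ i) * (1 + |t|) ^ (-(11 / 8) : ℝ) := by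
    intro i
    have hD : 0 < 1 + |γ i| := by positivity
    calc δ / 2 * 2 ^ (-(11 / 8) : ℝ) * (1 + |γ i|) ^ (-(11 / 8) : ℝ)
        = ∫ _ in Set.Icc (γ i) (γ i + 1),
            δ / 2 * 2 ^ (-(11 / 8) : ℝ) * (1 + |γ i|) ^ (-(11 / 8) : ℝ) := by
          simp
      _ ≤ ∫ t in Set.Icc (γ i) (γ i + 1), k i (t - γ i) * (1 + |t|) ^ (-(11 / 8) : ℝ) := by
          refine setIntegral_mono_on continuous_const.integrableOn_Icc (hki i).integrableOn
             measurableSet_Icc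
            fun t ht => ?_
          have h1 : 0 ≤ t - γ i := sub_nonneg.2 ht.1
          have h2 : t - γ i ≤ 1 := by linarith [ht.2]
          have h3 : δ / 2 ≤ k i (t - γ i) := by
            refine le_trans ?_ (hkδ i _)
            gcongr
            nlinarith
          have h4 : 1 + |t| ≤ 2 * (1 + |γ i|) := by
            have := abs_sub_abs_le_abs_sub t (γ i)
            rw [abs_of_nonneg h1] at this
            linarith [abs_nonneg (γ i)]
          rw [mul_assoc, ← Real.mul_rpow zero_le_two hD.le]
          refine mul_le_mul h3 ?_ (by positivity) ((hk i).nonneg _)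
          exact Real.rpow_le_rpow_of_nonpos (by positivity) h4 (by norm_num)
      _ ≤ _ := setIntegral_le_integral (hki i) (ae_of_all _ fun t =>
          mul_nonneg ((hk i).nonneg _) (by positivity))
  have hs : Summable fun i => m i * ∫ t, k i (t - γ i) * (1 + |t|) ^ (-(11 / 8) : ℝ) := by
    refine summable_of_sum_le (c := ∫ t, u t * (1 + |t|) ^ (-(11 / 8) : ℝ))
      (fun i => mul_nonneg (hm i) (integral_nonneg fun t =>
        mul_nonneg ((hk i).nonneg _) (by positivity))) fun s => ?_
    simp only [← integral_const_mul]
    rw [← integral_finsetSum _ fun i _ => (hki i).const_mul _]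
    refine integral_mono (integrable_finsetSum _ fun i _ => (hki i).const_mul _) hui fun t => ?_
    simp only [← mul_assoc, ← Finset.sum_mul]
    refine mul_le_mul_of_nonneg_right ?_ (by positivity)
    exact sum_le_hasSum s (fun i _ => mul_nonneg (hm i) ((hk i).nonneg _)) (hsum t)
  set c := δ / 2 * 2 ^ (-(11 / 8) : ℝ) with hc
  have hc0 : 0 < c := by positivity
  refine Summable.of_nonneg_of_le (fun i => mul_nonneg (hm i) (by positivity)) (fun i => ?_)
    (hs.mul_left c⁻¹)
  rw [mul_left_comm]
  refine mul_le_mul_of_nonneg_left ?_ (hm i)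
  rw [← div_eq_inv_mul, le_div_iff₀ hc0, mul_comm]
  exact hlow i

/-- If a Poisson-type sum is symmetrically integrable against the odd kernel, then the
symmetric partial sums of the odd kernel over its nodes converge. -/
theorem exists_tendsto_sum_oddKernel (hm : ∀ i, 0 ≤ m i) (hk : ∀ i, PoissonKernel B (k i))
    (hδ : 0 < δ) (hkδ : ∀ i x, δ / (1 + x ^ 2) ≤ k i x) (hki : ∀ i, ∫ x, k i x = Real.pi)
    (hu : SymmetricallyIntegrable u) (hsum : ∀ t, HasSum (fun i => m i * k i (t - γ i)) (u t))
    (s : ℝ → Finset ι) (hs : ∀ T i, i ∈ s T ↔ |γ i| ≤ T) (hB : 0 ≤ B) :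
    ∃ L, Tendsto (fun T => ∑ i ∈ s T, m i * oddKernel (γ i)) atTop (nhds L) := by
  have hA := summable_of_poisson_growth hm hk hδ hkδ hu hsum
  obtain ⟨C0, hC0, hgrow⟩ := hu.growth
  obtain ⟨C1, hC1, htrunc⟩ := exists_abs_truncated_sub_le hB
  obtain ⟨C2, hC2, hinteg⟩ := exists_abs_integral_sub_le hB
  obtain ⟨L, hL⟩ := hu.conv
  have hs_top : Tendsto s atTop atTop :=
    tendsto_atTop_finset_of_monotone (fun T T' h i hi => (hs _ _).2 (((hs _ _).1 hi).trans h))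
      fun i => ⟨|γ i|, (hs _ _).2 le_rfl⟩
  set J : ι → ℝ := fun i => ∫ t, k i (t - γ i) * oddKernel t with hJ
  set JT : ℝ → ι → ℝ := fun T i => ∫ t in (-T)..T, k i (t - γ i) * oddKernel t with hJT
  have he : Summable fun i => m i * (J i - Real.pi * oddKernel (γ i)) := by
    refine Summable.of_norm_bounded (hA.mul_left C2) fun i => ?_
    rw [norm_mul, Real.norm_of_nonneg (hm i), Real.norm_eq_abs, mul_left_comm]
    exact mul_le_mul_of_nonneg_left (hinteg _ (hk i) (hki i) _) (hm i)
  have hJTsum : ∀ T, 0 ≤ T → HasSum (fun i => m i * JT T i) (∫ t in (-T)..T, u t * oddKernel t) := by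
    intro T hT
    have hcount : Countable ι := by
      refine Set.countable_univ_iff.1 (Set.Countable.mono (fun i _ => ?_)
        (Set.countable_iUnion fun n : ℕ => (s n).countable_toSet))
      obtain ⟨n, hn⟩ := exists_nat_ge |γ i|
      exact Set.mem_iUnion.2 ⟨n, (hs _ _).2 hn⟩
    simp only [hJT, ← intervalIntegral.integral_const_mul]
    refine intervalIntegral.hasSum_integral_of_dominated_convergence
      (fun i t => 2 * (m i * k i (t - γ i))) (fun i => ?_) (fun i => ?_) ?_ ?_ ?_
    · exact (continuous_const.mul (((hk i).cont.comp (continuous_sub_right _)).mul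
        continuous_oddKernel)).aestronglyMeasurable
    · refine ae_of_all _ fun t _ => ?_
      rw [norm_mul, norm_mul, Real.norm_of_nonneg (hm i), Real.norm_of_nonneg ((hk i).nonneg _),
        Real.norm_eq_abs, ← mul_assoc, mul_comm 2]
      refine mul_le_mul_of_nonneg_left ((abs_oddKernel_le t).trans ?_)
        (mul_nonneg (hm i) ((hk i).nonneg _))
      exact div_le_self zero_le_two (by linarith [abs_nonneg t])
    · exact ae_of_all _ fun t _ => (hsum t).summable.mul_left 2
    · have e : (fun t => ∑' i, 2 * (m i * k i (t - γ i))) = fun t => 2 * u t := by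
        ext t
        exact ((hsum t).mul_left 2).tsum_eq
      rw [e]
      exact (continuous_const.mul hu.cont).intervalIntegrable _ _
    · refine ae_of_all _ fun t _ => ?_
      simpa only [mul_assoc] using (hsum t).mul_right (oddKernel t)
  set w : ℝ → ι → ℝ := fun T i => m i * (JT T i - if |γ i| ≤ T then J i else 0) with hw
  set A := ∑' i, m i * (1 + |γ i|) ^ (-(11 / 8) : ℝ) with hAdef
  have hwb : ∀ T, 0 ≤ T → Summable (w T) ∧ |∑' i, w T i| ≤
      C1 * ((1 + T) ^ (-(1 / 4) : ℝ) * A + (1 + T) ^ (-(3 / 8) : ℝ) * (δ⁻¹ * (u T + u (-T)))) := by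
    intro T hT
    have hmaj : HasSum (fun i => C1 * ((1 + T) ^ (-(1 / 4) : ℝ) *
        (m i * (1 + |γ i|) ^ (-(11 / 8) : ℝ)) + (1 + T) ^ (-(3 / 8) : ℝ) *
          (δ⁻¹ * (m i * k i (T - γ i) + m i * k i (-T - γ i)))))
        (C1 * ((1 + T) ^ (-(1 / 4) : ℝ) * A + (1 + T) ^ (-(3 / 8) : ℝ) * (δ⁻¹ * (u T + u (-T))))) :=
      ((hA.hasSum.mul_left _).add ((((hsum T).add (hsum (-T))).mul_left _).mul_left _)).mul_left _
    have hle : ∀ i, ‖w T i‖ ≤ C1 * ((1 + T) ^ (-(1 / 4) : ℝ) *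
        (m i * (1 + |γ i|) ^ (-(11 / 8) : ℝ)) + (1 + T) ^ (-(3 / 8) : ℝ) *
          (δ⁻¹ * (m i * k i (T - γ i) + m i * k i (-T - γ i)))) := by
      intro i
      have hq : ((1 + |(|γ i| - T)|) ^ 2)⁻¹ ≤ δ⁻¹ * (k i (T - γ i) + k i (-T - γ i)) := by
        have h1 : ∀ x, (1 + x ^ 2)⁻¹ ≤ δ⁻¹ * k i x := fun x => by
          rw [← div_eq_inv_mul, le_div_iff₀ hδ, mul_comm, ← div_eq_mul_inv]
          exact hkδ i x
        have h0 : ∀ x, 0 ≤ δ⁻¹ * k i x := fun x => mul_nonneg (by positivity) ((hk i).nonneg x)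
        refine (inv_sq_one_add_abs_le _).trans ?_
        rw [mul_add]
        rcases abs_choice (γ i) with h | h <;> rw [h]
        · have := h1 (T - γ i)
          rw [← sq_abs, abs_sub_comm, sq_abs] at this
          linarith [h0 (-T - γ i)]
        · have := h1 (-T - γ i)
          rw [show (-T - γ i) = (-γ i - T) by ring] at this ⊢
          linarith [h0 (T - γ i)]
      have h1 := htrunc (k i) (hk i) (γ i) T hT
      rw [hw]
      simp only [norm_mul]
      rw [Real.norm_of_nonneg (hm i), Real.norm_eq_abs]
      refine (mul_le_mul_of_nonneg_left h1 (hm i)).trans ?_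
      rw [mul_left_comm]
      refine mul_le_mul_of_nonneg_left ?_ hC1
      rw [mul_add, mul_left_comm (m i)]
      refine add_le_add_right ?_ _
      rw [mul_left_comm (m i), ← mul_add (m i), mul_left_comm δ⁻¹ (m i)]
      refine mul_le_mul_of_nonneg_left ?_ (by positivity)
      exact mul_le_mul_of_nonneg_left hq (hm i)
    exact ⟨Summable.of_norm_bounded hmaj.summable hle, tsum_of_norm_bounded hmaj hle⟩
  have hR : Tendsto (fun T => ∑' i, w T i) atTop (nhds 0) := by
    have hpow : ∀ y : ℝ, 0 < y → Tendsto (fun T : ℝ => (1 + T) ^ (-y)) atTop (nhds 0) := fun y hy =>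
      (tendsto_rpow_neg_atTop hy).comp (tendsto_atTop_add_const_left _ _ tendsto_id)
    have hlim : Tendsto (fun T : ℝ => C1 * ((1 + T) ^ (-(1 / 4) : ℝ) * A +
        (1 + T) ^ (-(1 / 8) : ℝ) * (δ⁻¹ * (2 * C0)))) atTop (nhds 0) := by
      have := (((hpow (1 / 4) (by norm_num)).mul_const A).add
        ((hpow (1 / 8) (by norm_num)).mul_const (δ⁻¹ * (2 * C0)))).const_mul C1
      simpa using this
    refine squeeze_zero_norm' ?_ hlim
    filter_upwards [eventually_ge_atTop 0] with T hT
    have hT1 : 0 < 1 + T := by linarith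
    refine ((hwb T hT).2).trans (mul_le_mul_of_nonneg_left (add_le_add_right ?_ _) hC1)
    have h1 : u T + u (-T) ≤ 2 * C0 * (1 + T) ^ (1 / 4 : ℝ) := by
      have a := (le_abs_self _).trans (hgrow T)
      have b := (le_abs_self _).trans (hgrow (-T))
      rw [abs_neg] at b
      rw [abs_of_nonneg hT] at a b
      linarith
    have e : (1 + T) ^ (-(1 / 8) : ℝ) = (1 + T) ^ (-(3 / 8) : ℝ) * (1 + T) ^ (1 / 4 : ℝ) := by
      rw [← Real.rpow_add hT1]; norm_num
    rw [e, mul_assoc]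
    refine mul_le_mul_of_nonneg_left ?_ (by positivity)
    rw [mul_left_comm]
    refine mul_le_mul_of_nonneg_left ?_ (by positivity)
    linarith
  have hkey : ∀ T, 0 ≤ T → ∑ i ∈ s T, m i * J i =
      (∫ t in (-T)..T, u t * oddKernel t) - ∑' i, w T i := by
    intro T hT
    have h1 := (hJTsum T hT).sub (hwb T hT).1.hasSum
    have h2 : HasSum (fun i => m i * JT T i - w T i) (∑ i ∈ s T, m i * J i) := by
      have e : ∑ i ∈ s T, m i * J i = ∑ i ∈ s T, (m i * JT T i - w T i) := by
        refine Finset.sum_congr rfl fun i hi => ?_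
        rw [hw]
        simp only [if_pos ((hs T i).1 hi)]
        ring
      rw [e]
      refine hasSum_sum_of_ne_finset_zero fun i hi => ?_
      rw [hw]
      simp only [if_neg fun h => hi ((hs T i).2 h)]
      ring
    exact h2.unique h1
  have hlim := ((hL.sub hR).sub (he.hasSum.comp hs_top)).const_mul Real.pi⁻¹
  refine ⟨_, hlim.congr' ?_⟩
  filter_upwards [eventually_ge_atTop 0] with T hT
  rw [← hkey T hT, Function.comp_apply, ← Finset.sum_sub_distrib, Finset.mul_sum]
  refine Finset.sum_congr rfl fun i _ => ?_
  have := Real.pi_ne_zero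
  field_simp
  ring

end PoissonSum

lemma hasSum_of_tendsto_sum_of_nonneg {ι : Type*} {f : ι → ℝ} (hf : ∀ i, 0 ≤ f i)
    {s : ℝ → Finset ι} (hs : Tendsto s atTop atTop) {L : ℝ}
    (h : Tendsto (fun R => ∑ i ∈ s R, f i) atTop (nhds L)) : HasSum f L := by
  have hsum : Summable f := by
    refine summable_of_sum_le hf fun t => ge_of_tendsto h ?_
    filter_upwards [hs.eventually_ge_atTop t] with R hR
    exact Finset.sum_le_sum_of_subset_of_nonneg hR fun i _ _ => hf i
  rw [← tendsto_nhds_unique (hsum.hasSum.comp hs) h]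
  exact hsum.hasSum

namespace SSF

variable {σ0 σ1 : ℝ} {S : SSF σ0 σ1}

variable (S) in
lemma logDeriv_xi_eq_neg_conj (s : ℂ) :
    logDeriv S.xi s = -(starRingEnd ℂ) (logDeriv S.xi (σ1 - (starRingEnd ℂ) s)) := by
  set h : ℂ → ℂ := fun w => S.xi (σ1 - w) with hh
  have hd : HasDerivAt h (-deriv S.xi (σ1 - (starRingEnd ℂ) s)) ((starRingEnd ℂ) s) := by
    have h1 : HasDerivAt (fun w : ℂ => (σ1 : ℂ) - w) (-1) ((starRingEnd ℂ) s) :=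
      (hasDerivAt_id _).const_sub _
    have := HasDerivAt.comp (h₂ := S.xi) ((starRingEnd ℂ) s)
      (S.hxiDiff (σ1 - (starRingEnd ℂ) s)).hasDerivAt h1
    exact this.congr_deriv (by ring)
  have h2 := (hd.conj_conj).const_mul S.ω
  rw [conj_conj] at h2
  have e : S.xi = fun w => S.ω * ((starRingEnd ℂ) ∘ h ∘ (starRingEnd ℂ)) w := funext S.hFE
  have h3 : deriv S.xi s = S.ω * (starRingEnd ℂ) (-deriv S.xi (σ1 - (starRingEnd ℂ) s)) := by
    conv_lhs => rw [e]
    exact h2.deriv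
  have hω : S.ω ≠ 0 := by
    intro h0
    have := S.hω
    rw [h0, norm_zero] at this
    exact zero_ne_one this
  rw [logDeriv_apply, logDeriv_apply, h3, S.hFE s, mul_div_mul_left _ _ hω, map_div₀, map_neg,
    neg_div]

/-- The symmetrised Poisson kernel attached to a zero with real part `β`. -/
def zeroKernel (σ1 c β x : ℝ) : ℝ :=
  ((c - β) / ((c - β) ^ 2 + x ^ 2) + (c - σ1 + β) / ((c - σ1 + β) ^ 2 + x ^ 2)) / 2

lemma div_sq_add_sq_le {b B : ℝ} (hb : 1 ≤ b) (hB : b ≤ B) (x : ℝ) :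
    b / (b ^ 2 + x ^ 2) ≤ B / (1 + x ^ 2) := by
  have : 1 ≤ b ^ 2 := one_le_pow₀ hb
  have : 0 ≤ B := by linarith
  gcongr

lemma le_div_sq_add_sq {b B : ℝ} (hb : 1 ≤ b) (hB : b ≤ B) (x : ℝ) :
    B⁻¹ / (1 + x ^ 2) ≤ b / (b ^ 2 + x ^ 2) := by
  have hB0 : 0 < B := by linarith
  rw [← one_div, div_div, div_le_div_iff₀ (by positivity) (by positivity)]
  have h0 : 1 ≤ b ^ 2 := one_le_pow₀ hb
  have h1 : b ^ 2 + x ^ 2 ≤ b * b * (1 + x ^ 2) := by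
    nlinarith [mul_nonneg (sub_nonneg.2 h0) (sq_nonneg x)]
  have h2 : b * b * (1 + x ^ 2) ≤ b * B * (1 + x ^ 2) := by gcongr
  linarith

lemma poissonKernel_zeroKernel {c B β : ℝ} (h1 : 1 ≤ c - β) (h2 : c - β ≤ B)
    (h3 : 1 ≤ c - σ1 + β) (h4 : c - σ1 + β ≤ B) : PoissonKernel B (zeroKernel σ1 c β) where
  cont := by
    have h5 : ∀ x : ℝ, (c - β) ^ 2 + x ^ 2 ≠ 0 := fun x => by positivity
    have h6 : ∀ x : ℝ, (c - σ1 + β) ^ 2 + x ^ 2 ≠ 0 := fun x => by positivity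
    exact ((continuous_const.div (by fun_prop) h5).add
      (continuous_const.div (by fun_prop) h6)).div_const 2
  nonneg x := by unfold zeroKernel; positivity
  le x := by
    unfold zeroKernel
    linarith [div_sq_add_sq_le h1 h2 x, div_sq_add_sq_le h3 h4 x]

lemma le_zeroKernel {c B β : ℝ} (h1 : 1 ≤ c - β) (h2 : c - β ≤ B)
    (h3 : 1 ≤ c - σ1 + β) (h4 : c - σ1 + β ≤ B) (x : ℝ) :
    B⁻¹ / (1 + x ^ 2) ≤ zeroKernel σ1 c β x := by
  unfold zeroKernel
  linarith [le_div_sq_add_sq h1 h2 x, le_div_sq_add_sq h3 h4 x]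

lemma integral_zeroKernel {c β : ℝ} (h1 : 0 < c - β) (h3 : 0 < c - σ1 + β) :
    ∫ x, zeroKernel σ1 c β x = Real.pi := by
  unfold zeroKernel
  rw [integral_div, integral_add (integrable_poisson h1) (integrable_poisson h3),
    integral_poisson h1, integral_poisson h3]
  ring

lemma re_pair_eq_zeroKernel (c t : ℝ) (ρ : ℂ) :
    (1 / ((c : ℂ) + t * I - ρ) - 1 / (σ1 - (starRingEnd ℂ) ((c : ℂ) + t * I) - ρ)).re =
      2 * zeroKernel σ1 c ρ.re (t - ρ.im) := by
  have e : ∀ z : ℂ, (1 / z).re = z.re / (z.re ^ 2 + z.im ^ 2) := by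
    intro z
    rw [one_div, inv_re, normSq_apply]
    ring
  rw [sub_re, e, e]
  unfold zeroKernel
  simp
  have e2 : (σ1 - c - ρ.re) = -(c - σ1 + ρ.re) := by ring
  rw [e2, neg_div, neg_sq]
  ring

lemma FarRight.finite_zeros_im {c : ℝ} (hc : S.FarRight c) (h0 : S.xi 0 ≠ 0) (T : ℝ) :
    {i : {ρ : ℂ // S.xi ρ = 0} | |(i : ℂ).im| ≤ T}.Finite := by
  have hb : Bornology.IsBounded {z : ℂ | z ∈ Set.Icc (σ1 - c) c ×ℂ Set.Icc (-T) T} :=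
    (Metric.isBounded_Icc _ _).reProdIm (Metric.isBounded_Icc _ _)
  have := (finite_zeros_of_isBounded S.hxiDiff h0 hb).preimage
    (f := ((↑) : {ρ : ℂ // S.xi ρ = 0} → ℂ)) Subtype.val_injective.injOn
  refine this.subset fun i hi => ?_
  exact ⟨i.2, hc.re_mem h0 i.2, abs_le.1 hi⟩

/-- The zeros of `ξ` up to a given height. -/
def FarRight.zerosUpTo {c : ℝ} (hc : S.FarRight c) (h0 : S.xi 0 ≠ 0) (T : ℝ) :
    Finset {ρ : ℂ // S.xi ρ = 0} :=
  (hc.finite_zeros_im h0 T).toFinset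

lemma FarRight.mem_zerosUpTo {c : ℝ} (hc : S.FarRight c) (h0 : S.xi 0 ≠ 0) (T : ℝ)
    (i : {ρ : ℂ // S.xi ρ = 0}) : i ∈ hc.zerosUpTo h0 T ↔ |(i : ℂ).im| ≤ T := by
  simp [zerosUpTo]

lemma FarRight.tendsto_zerosUpTo {c : ℝ} (hc : S.FarRight c) (h0 : S.xi 0 ≠ 0) :
    Tendsto (hc.zerosUpTo h0) atTop atTop :=
  tendsto_atTop_finset_of_monotone
    (fun _ _ h _ hi => (hc.mem_zerosUpTo h0 _ _).2 (((hc.mem_zerosUpTo h0 _ _).1 hi).trans h))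
    fun _ => ⟨_, (hc.mem_zerosUpTo h0 _ _).2 le_rfl⟩

lemma FarRight.tsum_eq_sum_zerosUpTo {c : ℝ} (hc : S.FarRight c) (h0 : S.xi 0 ≠ 0) (w : ℂ → ℂ)
    (T : ℝ) : ∑' ρ : {ρ : ℂ // S.xi ρ = 0 ∧ |ρ.im| ≤ T}, (zeroOrder S.xi ρ : ℂ) * w ρ =
      ∑ i ∈ hc.zerosUpTo h0 T, (zeroOrder S.xi i : ℂ) * w i := by
  have h : ∀ x : ℂ, x ∈ (hc.zerosUpTo h0 T).map (Function.Embedding.subtype _) ↔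
      S.xi x = 0 ∧ |x.im| ≤ T := by
    intro x
    simp [hc.mem_zerosUpTo h0, and_comm]
  have : Fintype {ρ : ℂ // S.xi ρ = 0 ∧ |ρ.im| ≤ T} := Fintype.subtype _ h
  rw [tsum_fintype, ← Finset.sum_subtype _ h fun ρ => (zeroOrder S.xi ρ : ℂ) * w ρ, Finset.sum_map]
  rfl

lemma FarRight.hasSum_zeroKernel {c0 c : ℝ} (hc0 : S.FarRight c0) (h0 : S.xi 0 ≠ 0)
    (hc : c0 < c) (hpos : ∀ i : {ρ : ℂ // S.xi ρ = 0}, ∀ x, 0 ≤ zeroKernel σ1 c (i : ℂ).re x)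
    (t : ℝ) :
    HasSum (fun i : {ρ : ℂ // S.xi ρ = 0} =>
      (zeroOrder S.xi i : ℝ) * zeroKernel σ1 c (i : ℂ).re (t - (i : ℂ).im))
      (logDeriv S.xi (c + t * I)).re := by
  have hfin : ∀ R : ℝ, {i : {ρ : ℂ // S.xi ρ = 0} | ‖(i : ℂ)‖ ≤ R}.Finite := fun R => by
    have := (finite_zeros_of_isBounded S.hxiDiff h0
      (Metric.isBounded_closedBall (x := (0 : ℂ)) (r := R))).preimage
      (f := ((↑) : {ρ : ℂ // S.xi ρ = 0} → ℂ)) Subtype.val_injective.injOn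
    refine this.subset fun i hi => ?_
    exact ⟨i.2, by simpa using hi⟩
  set Z : ℝ → Finset {ρ : ℂ // S.xi ρ = 0} := fun R => (hfin R).toFinset with hZ
  have hmem : ∀ R i, i ∈ Z R ↔ ‖(i : ℂ)‖ ≤ R := fun R i => by simp [hZ]
  have hZtop : Tendsto Z atTop atTop :=
    tendsto_atTop_finset_of_monotone
      (fun _ _ h _ hi => (hmem _ _).2 (((hmem _ _).1 hi).trans h))
      fun _ => ⟨_, (hmem _ _).2 le_rfl⟩
  obtain ⟨B, hB⟩ := S.exists_norm_xi_le
  have hs : S.xi (c + t * I) ≠ 0 := hc0.xi_ne_zero h0 (by simpa using hc)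
  have hz : S.xi (σ1 - (starRingEnd ℂ) (c + t * I)) ≠ 0 := fun h =>
    hs ((S.xi_eq_zero_iff _).2 h)
  have hlim := tendsto_sum_zeros_logDeriv S.hxiDiff h0 hB
    (fun R => (Z R).map (Function.Embedding.subtype _)) (fun R z => by simp [hmem, and_comm]) hs hz
  have hre := (continuous_re.tendsto _).comp hlim
  have hval : (logDeriv S.xi (c + t * I) -
      logDeriv S.xi (σ1 - (starRingEnd ℂ) (c + t * I))).re =
      2 * (logDeriv S.xi (c + t * I)).re := by
    have := congrArg re (S.logDeriv_xi_eq_neg_conj (c + t * I))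
    rw [neg_re, conj_re] at this
    rw [sub_re]
    linarith
  rw [hval] at hre
  refine hasSum_of_tendsto_sum_of_nonneg
    (fun i => mul_nonneg (Nat.cast_nonneg _) (hpos i _)) hZtop ?_
  have h2 := hre.const_mul (1 / 2)
  have e : 1 / 2 * (2 * (logDeriv S.xi (c + t * I)).re) = (logDeriv S.xi (c + t * I)).re := by ring
  rw [e] at h2
  refine h2.congr fun R => ?_
  simp only [Function.comp_apply, Finset.sum_map, re_sum, Finset.mul_sum]
  refine Finset.sum_congr rfl fun i _ => ?_
  rw [← ofReal_natCast, re_ofReal_mul, Function.Embedding.subtype_apply, re_pair_eq_zeroKernel]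
  ring

/-- Distribution of the zeros of `ξ`: they are square-summable in height, and the symmetric sums
of the odd kernel over their ordinates converge. -/
theorem FarRight.zeros_sums {c : ℝ} (hc : S.FarRight c) (h0 : S.xi 0 ≠ 0) :
    (Summable fun i : {ρ : ℂ // S.xi ρ = 0} =>
      (zeroOrder S.xi i : ℝ) * (1 + (i : ℂ).im ^ 2)⁻¹) ∧
    ∃ L : ℝ, Tendsto (fun T => ∑ i ∈ hc.zerosUpTo h0 T,
      (zeroOrder S.xi i : ℝ) * oddKernel (i : ℂ).im) atTop (nhds L) := by
  set B : ℝ := 2 * c - σ1 + 1 with hBdef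
  have hre := fun i : {ρ : ℂ // S.xi ρ = 0} => hc.re_mem h0 i.2
  have h1 : ∀ i : {ρ : ℂ // S.xi ρ = 0}, 1 ≤ c + 1 - (i : ℂ).re := fun i => by linarith [(hre i).2]
  have h2 : ∀ i : {ρ : ℂ // S.xi ρ = 0}, c + 1 - (i : ℂ).re ≤ B := fun i => by linarith [(hre i).1]
  have h3 : ∀ i : {ρ : ℂ // S.xi ρ = 0}, 1 ≤ c + 1 - σ1 + (i : ℂ).re := fun i => by
    linarith [(hre i).1]
  have h4 : ∀ i : {ρ : ℂ // S.xi ρ = 0}, c + 1 - σ1 + (i : ℂ).re ≤ B := fun i => by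
    linarith [(hre i).2]
  have hB : 0 < B := by
    have := hc.lt
    have := S.hσ1pos
    have := S.hσ
    linarith
  have hk := fun i => poissonKernel_zeroKernel (σ1 := σ1) (h1 i) (h2 i) (h3 i) (h4 i)
  have hkδ := fun i => le_zeroKernel (σ1 := σ1) (h1 i) (h2 i) (h3 i) (h4 i)
  have hsum := hc.hasSum_zeroKernel h0 (lt_add_one c) fun i => (hk i).nonneg
  constructor
  · refine Summable.of_nonneg_of_le (fun i => by positivity) (fun i => ?_)
      ((hsum 0).summable.mul_left B)
    have := hkδ i (0 - (i : ℂ).im)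
    rw [zero_sub, neg_sq, div_eq_mul_inv, inv_mul_le_iff₀ hB] at this
    rw [mul_left_comm, zero_sub]
    exact mul_le_mul_of_nonneg_left this (Nat.cast_nonneg _)
  · exact exists_tendsto_sum_oddKernel (fun i => Nat.cast_nonneg _) hk (inv_pos.2 hB) hkδ
      (fun i => integral_zeroKernel (by linarith [h1 i]) (by linarith [h3 i]))
      (hc.symmetricallyIntegrable_logDeriv_xi h0 (lt_add_one c)) hsum _ (hc.mem_zerosUpTo h0) hB.le

end SSF

lemma norm_div_sub_le_one_iff {ρ : ℂ} {τ : ℝ} (hτ : 0 < τ) (hρ : ρ - τ ≠ 0) :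
    ‖ρ / (ρ - τ)‖ ≤ 1 ↔ ρ.re ≤ τ / 2 := by
  rw [norm_div, div_le_one (norm_pos_iff.2 hρ), ← sq_le_sq₀ (norm_nonneg _) (norm_nonneg _),
    Complex.sq_norm, Complex.sq_norm, normSq_apply, normSq_apply]
  simp only [sub_re, sub_im, ofReal_re, ofReal_im]
  constructor <;> intro h <;> nlinarith

/-- Expansion of `1 / (ρ - τ)` for `ρ` of large height in a vertical strip. -/
lemma norm_inv_add_oddKernel_le {ρ : ℂ} {τ ε A : ℝ} (hε : 0 < ε) (h : ε ≤ ‖ρ - τ‖)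
    (hA : |ρ.re - τ| ≤ A) :
    ‖(ρ - τ)⁻¹ + oddKernel ρ.im * I‖ ≤ (ε⁻¹ + A) * (1 + ρ.im ^ 2)⁻¹ := by
  have hn : 0 < ‖ρ - τ‖ := hε.trans_le h
  have hne : ρ - τ ≠ 0 := norm_pos_iff.1 hn
  have hp : 0 < 1 + ρ.im ^ 2 := by positivity
  have hpc : (1 + (ρ.im : ℂ) ^ 2) ≠ 0 := by exact_mod_cast hp.ne'
  have hρ : ρ - τ = ((ρ.re - τ : ℝ) : ℂ) + ρ.im * I := by
    apply Complex.ext <;> simp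
  have e : (ρ - τ)⁻¹ + oddKernel ρ.im * I =
      (1 + ρ.im * ((ρ.re - τ : ℝ) : ℂ) * I) * (ρ - τ)⁻¹ * ((1 + ρ.im ^ 2 : ℝ) : ℂ)⁻¹ := by
    rw [oddKernel]
    push_cast
    field_simp
    rw [hρ]
    push_cast
    linear_combination (ρ.im : ℂ) ^ 2 * I_sq
  have him : |ρ.im| ≤ ‖ρ - τ‖ := by simpa using Complex.abs_im_le_norm (ρ - τ)
  rw [e, norm_mul, norm_mul, norm_inv, norm_inv, norm_real, Real.norm_of_nonneg hp.le]
  refine mul_le_mul_of_nonneg_right ?_ (by positivity)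
  have h1 : ‖(1 : ℂ) + ρ.im * ((ρ.re - τ : ℝ) : ℂ) * I‖ ≤ 1 + |ρ.im| * A := by
    refine (norm_add_le _ _).trans ?_
    rw [norm_one, norm_mul, norm_mul, norm_I, mul_one, norm_real, norm_real, Real.norm_eq_abs,
      Real.norm_eq_abs]
    gcongr
  rw [← div_eq_mul_inv, div_le_iff₀ hn]
  have hA0 : 0 ≤ A := (abs_nonneg _).trans hA
  have h2 : 1 ≤ ε⁻¹ * ‖ρ - τ‖ := by
    rw [← div_eq_inv_mul, le_div_iff₀ hε]; linarith
  have h3 : |ρ.im| * A ≤ A * ‖ρ - τ‖ := by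
    rw [mul_comm]; gcongr
  linarith

lemma inv_sq_norm_sub_le {ρ : ℂ} {τ ε : ℝ} (hε : 0 < ε) (h : ε ≤ ‖ρ - τ‖) :
    (‖ρ - τ‖ ^ 2)⁻¹ ≤ (1 + (ε ^ 2)⁻¹) * (1 + ρ.im ^ 2)⁻¹ := by
  have hn : 0 < ‖ρ - τ‖ := hε.trans_le h
  have him : |ρ.im| ≤ ‖ρ - τ‖ := by simpa using Complex.abs_im_le_norm (ρ - τ)
  have h1 : ρ.im ^ 2 ≤ ‖ρ - τ‖ ^ 2 := by rw [← sq_abs]; gcongr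
  have h2 : 1 ≤ (ε ^ 2)⁻¹ * ‖ρ - τ‖ ^ 2 := by
    rw [← div_eq_inv_mul, le_div_iff₀ (by positivity), one_mul]
    gcongr
  rw [← div_eq_mul_inv, le_div_iff₀ (by positivity), inv_mul_le_iff₀ (by positivity)]
  linarith

/-- **generalized τ-Li criterion.** For `F ∈ S^♯♭(σ₀,σ₁)` and `τ ≥ σ₁` with
`0, τ ∉ Z(F)`, all nontrivial zeros satisfy `σ₁ − τ/2 ≤ Re ρ ≤ τ/2` if and only if
`Re(λ_F(n,τ)) ≥ 0` for every positive integer `n`. -/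
theorem tauLi_criterion (σ0 σ1 : ℝ) (S : SSF σ0 σ1) (τ : ℝ) (hτ : σ1 ≤ τ)
    (h0 : S.xi 0 ≠ 0) (hτZ : S.xi (τ : ℂ) ≠ 0) :
    (∀ ρ : ℂ, S.xi ρ = 0 → σ1 - τ / 2 ≤ ρ.re ∧ ρ.re ≤ τ / 2) ↔
    (∀ n : ℕ, 0 < n → ∃ L : ℂ,
      Filter.Tendsto (fun T : ℝ =>
          ∑' ρ : {ρ : ℂ // S.xi ρ = 0 ∧ |ρ.im| ≤ T},
            (zeroOrder S.xi ρ : ℂ) * (1 - ((ρ : ℂ) / ((ρ : ℂ) - τ)) ^ n))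
        Filter.atTop (nhds L) ∧ 0 ≤ L.re) := by
  have hτ0 : 0 < τ := S.hσ1pos.trans_le hτ
  obtain ⟨c, hc⟩ := S.exists_farRight
  obtain ⟨hsum, Lg, hLg⟩ := hc.zeros_sums h0
  obtain ⟨ε, hε, hball⟩ : ∃ ε > 0, ∀ ρ : ℂ, S.xi ρ = 0 → ε ≤ ‖ρ - τ‖ := by
    have hev : ∀ᶠ z in nhds (τ : ℂ), S.xi z ≠ 0 := S.hxiDiff.continuous.continuousAt.eventually_ne hτZ
    obtain ⟨ε, hε, h⟩ := Metric.eventually_nhds_iff.1 hev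
    refine ⟨ε, hε, fun ρ hρ => ?_⟩
    by_contra! hlt
    exact h (by rwa [dist_eq_norm]) hρ
  set A : ℝ := |c| + |σ1| + |τ| with hA
  have hAre : ∀ i : {ρ : ℂ // S.xi ρ = 0}, |(i : ℂ).re - τ| ≤ A := fun i => by
    have h1 := hc.re_mem h0 i.2
    rw [abs_le]
    constructor <;>
      linarith [abs_nonneg c, abs_nonneg σ1, le_abs_self c, neg_abs_le σ1, le_abs_self τ,
        neg_abs_le τ]
  have hne : ∀ i : {ρ : ℂ // S.xi ρ = 0}, (i : ℂ) - τ ≠ 0 := fun i =>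
    norm_pos_iff.1 (hε.trans_le (hball i i.2))
  set w : {ρ : ℂ // S.xi ρ = 0} → ℂ := fun i => τ * ((i : ℂ) - τ)⁻¹ with hw
  have hw1 : ∀ i : {ρ : ℂ // S.xi ρ = 0}, (i : ℂ) / ((i : ℂ) - τ) = 1 + w i := fun i => by
    have := hne i
    rw [hw]
    field_simp
    ring
  have hwn : ∀ i : {ρ : ℂ // S.xi ρ = 0}, ‖w i‖ ^ 2 = τ ^ 2 * (‖(i : ℂ) - τ‖ ^ 2)⁻¹ := fun i => by
    rw [hw, norm_mul, norm_real, norm_inv, mul_pow, inv_pow, Real.norm_eq_abs, sq_abs]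
  set K : ℝ := τ ^ 2 * (1 + (ε ^ 2)⁻¹) with hK
  have hwle : ∀ i : {ρ : ℂ // S.xi ρ = 0}, ‖w i‖ ^ 2 ≤ K * (1 + (i : ℂ).im ^ 2)⁻¹ := fun i => by
    rw [hwn, hK, mul_assoc]
    exact mul_le_mul_of_nonneg_left (inv_sq_norm_sub_le hε (hball i i.2)) (sq_nonneg _)
  have hwsum : Summable fun i : {ρ : ℂ // S.xi ρ = 0} => (zeroOrder S.xi i : ℝ) * ‖w i‖ ^ 2 := by
    refine Summable.of_nonneg_of_le (fun i => by positivity) (fun i => ?_) (hsum.mul_left K)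
    rw [mul_left_comm]
    exact mul_le_mul_of_nonneg_left (hwle i) (Nat.cast_nonneg _)
  have hterm : ∀ (n : ℕ) (T : ℝ), ∑' ρ : {ρ : ℂ // S.xi ρ = 0 ∧ |ρ.im| ≤ T},
      (zeroOrder S.xi ρ : ℂ) * (1 - ((ρ : ℂ) / ((ρ : ℂ) - τ)) ^ n) =
      ∑ i ∈ hc.zerosUpTo h0 T, (zeroOrder S.xi i : ℂ) * (1 - (1 + w i) ^ n) := fun n T => by
    rw [hc.tsum_eq_sum_zerosUpTo h0 (fun ρ => 1 - (ρ / (ρ - τ)) ^ n)]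
    simp only [hw1]
  simp only [hterm]
  constructor
  · intro h n _
    have hnorm : ∀ i : {ρ : ℂ // S.xi ρ = 0}, ‖1 + w i‖ ≤ 1 := fun i => by
      rw [← hw1, norm_div_sub_le_one_iff hτ0 (hne i)]
      exact (h i i.2).2
    set e : {ρ : ℂ // S.xi ρ = 0} → ℂ := fun i =>
      1 - (1 + w i) ^ n - n * τ * (oddKernel (i : ℂ).im * I) with he
    set D : ℝ := n ^ 2 * K + n * τ * (ε⁻¹ + A) with hD
    have hen : ∀ i : {ρ : ℂ // S.xi ρ = 0}, ‖e i‖ ≤ D * (1 + (i : ℂ).im ^ 2)⁻¹ := fun i => by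
      have e1 : e i = -((1 + w i) ^ n - 1 - n * w i) -
          n * τ * (((i : ℂ) - τ)⁻¹ + oddKernel (i : ℂ).im * I) := by
        rw [he, hw]
        ring
      have h1 := norm_one_add_pow_sub_le le_rfl (hnorm i) n
      rw [one_pow, mul_one] at h1
      have h2 := norm_inv_add_oddKernel_le hε (hball i i.2) (hAre i)
      rw [e1]
      refine (norm_sub_le _ _).trans ?_
      rw [norm_neg, norm_mul, norm_mul, Complex.norm_natCast, norm_real, Real.norm_of_nonneg hτ0.le, hD,
        add_mul]
      refine add_le_add (h1.trans ?_) ?_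
      · rw [mul_assoc]
        exact mul_le_mul_of_nonneg_left (hwle i) (sq_nonneg _)
      · rw [mul_assoc (n * τ : ℝ)]
        exact mul_le_mul_of_nonneg_left h2 (by positivity)
    have hesum : Summable fun i : {ρ : ℂ // S.xi ρ = 0} => (zeroOrder S.xi i : ℂ) * e i := by
      refine Summable.of_norm_bounded (hsum.mul_left D) fun i => ?_
      rw [norm_mul, Complex.norm_natCast, mul_left_comm]
      exact mul_le_mul_of_nonneg_left (hen i) (Nat.cast_nonneg _)
    have hlim1 := ((continuous_ofReal.tendsto Lg).comp hLg).const_mul (n * τ * I : ℂ)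
    have hlim := hlim1.add (hesum.hasSum.comp (hc.tendsto_zerosUpTo h0))
    have hlim' : Tendsto (fun T => ∑ i ∈ hc.zerosUpTo h0 T,
        (zeroOrder S.xi i : ℂ) * (1 - (1 + w i) ^ n)) atTop
        (nhds (n * τ * I * Lg + ∑' i : {ρ : ℂ // S.xi ρ = 0}, (zeroOrder S.xi i : ℂ) * e i)) := by
      refine hlim.congr fun T => ?_
      simp only [Function.comp_apply, ofReal_sum, Finset.mul_sum]
      rw [← Finset.sum_add_distrib]
      refine Finset.sum_congr rfl fun i _ => ?_
      rw [he]
      push_cast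
      ring
    refine ⟨_, hlim', ge_of_tendsto' ((continuous_re.tendsto _).comp hlim') fun T => ?_⟩
    rw [Function.comp_apply, re_sum]
    refine Finset.sum_nonneg fun i _ => ?_
    rw [← ofReal_natCast, re_ofReal_mul, sub_re, one_re]
    refine mul_nonneg (Nat.cast_nonneg _) (sub_nonneg.2 ?_)
    refine (re_le_norm _).trans ?_
    rw [norm_pow]
    exact pow_le_one₀ (norm_nonneg _) (hnorm i)
  · intro H
    have hpow := norm_one_add_le_one_of_powersum (fun i : {ρ : ℂ // S.xi ρ = 0} => zeroOrder S.xi i)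
      (fun i => one_le_zeroOrder S.hxiDiff h0 i.2) w (A / τ) (fun i => ?_) hwsum
      (hc.zerosUpTo h0) (hc.tendsto_zerosUpTo h0) H
    · have hle : ∀ ρ : ℂ, S.xi ρ = 0 → ρ.re ≤ τ / 2 := fun ρ hρ => by
        have := hpow ⟨ρ, hρ⟩
        rw [← hw1] at this
        exact (norm_div_sub_le_one_iff hτ0 (hne ⟨ρ, hρ⟩)).1 this
      intro ρ hρ
      refine ⟨?_, hle ρ hρ⟩
      have := hle _ ((S.xi_eq_zero_iff ρ).1 hρ)
      simp at this
      linarith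
    · have e1 : (w i).re = τ * (((i : ℂ).re - τ) * (‖(i : ℂ) - τ‖ ^ 2)⁻¹) := by
        rw [hw]
        simp only [re_ofReal_mul, inv_re, Complex.sq_norm, sub_re, ofReal_re, div_eq_mul_inv]
      rw [e1, hwn, abs_mul, abs_mul, abs_of_pos hτ0, abs_of_nonneg (by positivity :
        0 ≤ (‖(i : ℂ) - τ‖ ^ 2)⁻¹)]
      have : A / τ * (τ ^ 2 * (‖(i : ℂ) - τ‖ ^ 2)⁻¹) = τ * (A * (‖(i : ℂ) - τ‖ ^ 2)⁻¹) := by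
        field_simp
      rw [this]
      gcongr
      exact hAre i

end
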